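/- Let d = 2, and suppose |Ω| < min{γ_x, γ_y}, c₀ > −C_b and c₀ + c₁ > −C_b, where C_b is the best 2D Gagliardo–Nirenberg constant. Then the energy functional E(Φ) = E₁(Φ)+E₂(Φ)+E₃(Φ) of the rotating spin-orbit coupled spin-1 BEC is bounded below on the constraint manifold M = {Φ = (φ₁,φ₀,φ₋₁)ᵀ : φ_j ∈ H¹(ℝ²)∩L²_V(ℝ²), ‖Φ‖₂² = 1}, and there exists a minimizer Φ_g ∈ M with E(Φ_g) = inf_{Φ∈M} E(Φ). -/

import Mathlib

open MeasureTheory Complex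

noncomputable section

abbrev Pt (d : ℕ) := EuclideanSpace ℝ (Fin d)

/-- Classical partial derivative `∂_j f`, junk `0` if `j ≥ d`. -/
def pdC (d : ℕ) (f : Pt d → ℂ) (j : ℕ) (x : Pt d) : ℂ :=
  if h : j < d then fderiv ℝ f x (EuclideanSpace.single ⟨j, h⟩ 1) else 0

def nthC (d : ℕ) (x : Pt d) (j : ℕ) : ℝ := if h : j < d then x ⟨j, h⟩ else 0

/-- `L₀ = i∂ₓ + ∂_y`. -/
def L0op (d : ℕ) (f : Pt d → ℂ) (x : Pt d) : ℂ := Complex.I * pdC d f 0 x + pdC d f 1 x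

/-- `L₁ = i∂ₓ − ∂_y`. -/
def L1op (d : ℕ) (f : Pt d → ℂ) (x : Pt d) : ℂ := Complex.I * pdC d f 0 x - pdC d f 1 x

/-- Rotation operator `L_z = −i(x∂_y − y∂ₓ)`. -/
def Lzop (d : ℕ) (f : Pt d → ℂ) (x : Pt d) : ℂ :=
  -Complex.I * (((nthC d x 0 : ℝ) : ℂ) * pdC d f 1 x - ((nthC d x 1 : ℝ) : ℂ) * pdC d f 0 x)

/-- `|∇f|²`. -/
def gradsq (d : ℕ) (f : Pt d → ℂ) (x : Pt d) : ℝ := ∑ j : Fin d, ‖pdC d f j x‖ ^ 2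

/-- Total density `ρ = |φ₁|² + |φ₀|² + |φ₋₁|²`. -/
def rho (d : ℕ) (φ1 φ0 φm1 : Pt d → ℂ) (x : Pt d) : ℝ :=
  ‖φ1 x‖ ^ 2 + ‖φ0 x‖ ^ 2 + ‖φm1 x‖ ^ 2

/-- Spin vector magnitude squared `|F|²`. -/
def Fsq (d : ℕ) (φ1 φ0 φm1 : Pt d → ℂ) (x : Pt d) : ℝ :=
  2 * ((((starRingEnd ℂ) (φ1 x) + (starRingEnd ℂ) (φm1 x)) * φ0 x).re) ^ 2
    + 2 * ((φ0 x * ((starRingEnd ℂ) (φm1 x) - (starRingEnd ℂ) (φ1 x))).im) ^ 2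
    + (‖φ1 x‖ ^ 2 - ‖φm1 x‖ ^ 2) ^ 2

/-- The (real) SOC integrand `Φ†SΦ = φ̄₁L₀φ₀ + φ̄₀(L₀φ₋₁ + L₁φ₁) + φ̄₋₁L₁φ₀`. -/
def socDen (d : ℕ) (φ1 φ0 φm1 : Pt d → ℂ) (x : Pt d) : ℝ :=
  ((starRingEnd ℂ) (φ1 x) * L0op d φ0 x
    + (starRingEnd ℂ) (φ0 x) * (L0op d φm1 x + L1op d φ1 x)
    + (starRingEnd ℂ) (φm1 x) * L1op d φ0 x).re

/-- The (real) rotation integrand `φ̄ L_z φ`. -/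
def rotDen (d : ℕ) (φ : Pt d → ℂ) (x : Pt d) : ℝ :=
  ((starRingEnd ℂ) (φ x) * Lzop d φ x).re

/-- Kinetic energy. -/
def Ekin (d : ℕ) (φ1 φ0 φm1 : Pt d → ℂ) : ℝ :=
  (1 / 2 : ℝ) * ∫ x, (gradsq d φ1 x + gradsq d φ0 x + gradsq d φm1 x)

/-- Potential energy. -/
def Epot (d : ℕ) (V : Pt d → ℝ) (φ1 φ0 φm1 : Pt d → ℂ) : ℝ :=
  ∫ x, V x * rho d φ1 φ0 φm1 x

/-- Interaction (spin) energy. -/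
def Espin (d : ℕ) (c0 c1 : ℝ) (φ1 φ0 φm1 : Pt d → ℂ) : ℝ :=
  ∫ x, (c0 / 2 * (rho d φ1 φ0 φm1 x) ^ 2 + c1 / 2 * Fsq d φ1 φ0 φm1 x)

/-- Rotation energy. -/
def Erot (d : ℕ) (Ω : ℝ) (φ1 φ0 φm1 : Pt d → ℂ) : ℝ :=
  -Ω * ∫ x, (rotDen d φ1 x + rotDen d φ0 x + rotDen d φm1 x)

/-- Spin-orbit coupling energy. -/
def Esoc (d : ℕ) (γ : ℝ) (φ1 φ0 φm1 : Pt d → ℂ) : ℝ :=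
  -γ * ∫ x, socDen d φ1 φ0 φm1 x

/-- Total energy of the rotating SOC spin-1 BEC. -/
def Etot (d : ℕ) (V : Pt d → ℝ) (c0 c1 Ω γ : ℝ) (φ1 φ0 φm1 : Pt d → ℂ) : ℝ :=
  Ekin d φ1 φ0 φm1 + Epot d V φ1 φ0 φm1 + Espin d c0 c1 φ1 φ0 φm1
    + Erot d Ω φ1 φ0 φm1 + Esoc d γ φ1 φ0 φm1

/-- The constraint manifold `M`: triples in `H¹ ∩ L²_V` (with all energy integrands
integrable) of unit total mass. -/
def InM (d : ℕ) (V : Pt d → ℝ) (φ1 φ0 φm1 : Pt d → ℂ) : Prop :=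
  Differentiable ℝ φ1 ∧ Differentiable ℝ φ0 ∧ Differentiable ℝ φm1 ∧
  Integrable (fun x => rho d φ1 φ0 φm1 x) ∧
  Integrable (fun x => gradsq d φ1 x + gradsq d φ0 x + gradsq d φm1 x) ∧
  Integrable (fun x => V x * rho d φ1 φ0 φm1 x) ∧
  Integrable (fun x => (rho d φ1 φ0 φm1 x) ^ 2) ∧
  Integrable (fun x => Fsq d φ1 φ0 φm1 x) ∧
  Integrable (fun x => rotDen d φ1 x + rotDen d φ0 x + rotDen d φm1 x) ∧
  Integrable (fun x => socDen d φ1 φ0 φm1 x) ∧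
  (∫ x, rho d φ1 φ0 φm1 x) = 1

/-- Membership in `H¹(ℝ²)` (plus `L⁴`). -/
def InH1 (f : Pt 2 → ℂ) : Prop :=
  Differentiable ℝ f ∧ Integrable (fun x => ‖f x‖ ^ 2) ∧
    Integrable (fun x => gradsq 2 f x) ∧ Integrable (fun x => ‖f x‖ ^ 4)

/-- Best constant in the 2D Gagliardo–Nirenberg inequality. -/
def Cb : ℝ :=
  sInf {t : ℝ | ∃ f : Pt 2 → ℂ, InH1 f ∧ ¬ (f =ᵐ[volume] 0) ∧
    t = (∫ x, gradsq 2 f x) * (∫ x, ‖f x‖ ^ 2) / ∫ x, ‖f x‖ ^ 4}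

section
open scoped FourierTransform SchwartzMap Laplacian LineDeriv ContDiff ENNReal
open TemperedDistribution

/-- complexification of a real test function as Schwartz map -/
theorem r1_schwartz_of_real (g : Pt 2 → ℝ) (hg : ContDiff ℝ ∞ g) (hc : HasCompactSupport g) :
    ∃ ψ : 𝓢(Pt 2, ℂ), ∀ x, ψ x = (g x : ℂ) := by
  have h1 : HasCompactSupport (fun x => (g x : ℂ)) := hc.comp_left (g := fun t : ℝ => (t : ℂ)) (by simp)
  have h2 : ContDiff ℝ ∞ (fun x => (g x : ℂ)) := Complex.ofRealCLM.contDiff.comp hg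
  exact ⟨h1.toSchwartzMap h2, fun x => rfl⟩

theorem r1_ae_eq (f g : Pt 2 → ℂ) (hf : LocallyIntegrable f) (hg : LocallyIntegrable g)
    (h : ∀ ψ : 𝓢(Pt 2, ℂ), ∫ x, ψ x * f x = ∫ x, ψ x * g x) : f =ᵐ[volume] g := by
  apply ae_eq_of_integral_contDiff_smul_eq hf hg
  intro u hu huc
  obtain ⟨ψ, hψ⟩ := r1_schwartz_of_real u hu huc
  have := h ψ
  simpa [hψ] using this

theorem r1_fourier_L1 (u : Lp ℂ 2 (volume : Measure (Pt 2))) (v : Lp ℂ 1 (volume : Measure (Pt 2)))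
    (h : 𝓕 (u : 𝓢'(Pt 2, ℂ)) = (v : 𝓢'(Pt 2, ℂ))) :
    (u : Pt 2 → ℂ) =ᵐ[volume] 𝓕⁻ (v : Pt 2 → ℂ) := by
  have hv : Integrable (v : Pt 2 → ℂ) := L1.integrable_coeFn v
  have hcont : Continuous (𝓕⁻ (v : Pt 2 → ℂ)) := by
    have : Continuous (𝓕 (v : Pt 2 → ℂ)) :=
      VectorFourier.fourierIntegral_continuous Real.continuous_fourierChar (by
        exact continuous_inner) hv
    have h2 : 𝓕⁻ (v : Pt 2 → ℂ) = fun w => 𝓕 (v : Pt 2 → ℂ) (-w) := by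
      ext w; exact Real.fourierInv_eq_fourier_neg _ w
    rw [h2]; exact this.comp continuous_neg
  apply r1_ae_eq
  · exact (Lp.memLp u).locallyIntegrable (by norm_num)
  · exact hcont.locallyIntegrable
  intro ψ
  have e1 : (u : 𝓢'(Pt 2, ℂ)) ψ = ∫ x, ψ x * u x := by
    simp
  rw [← e1]
  have e2 : (u : 𝓢'(Pt 2, ℂ)) ψ = 𝓕 (u : 𝓢'(Pt 2, ℂ)) (𝓕⁻ ψ) := by
    rw [TemperedDistribution.fourier_apply, FourierTransform.fourier_fourierInv_eq]
  rw [e2, h]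
  simp only [Lp.toTemperedDistribution_apply, smul_eq_mul]
  have e3 : ∀ x, (𝓕⁻ ψ : 𝓢(Pt 2, ℂ)) x = 𝓕 (fun y => ψ (-y)) x := by
    intro x
    rw [SchwartzMap.fourierInv_coe, Real.fourierInv_eq_fourier_comp_neg]
  simp only [e3]
  have hψ : Integrable (fun y => ψ (-y)) := ψ.integrable.comp_neg
  have key : ∫ ξ : Pt 2, 𝓕 (fun y => ψ (-y)) ξ • (v ξ) = ∫ x : Pt 2, ψ (-x) • 𝓕 (v : Pt 2 → ℂ) x := by
    simpa using! VectorFourier.integral_fourierIntegral_smul_eq_flip (L := innerₗ (Pt 2))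
      Real.continuous_fourierChar continuous_inner hψ hv
  simp only [smul_eq_mul] at key
  rw [key, ← integral_neg_eq_self]
  simp [Real.fourierInv_eq_fourier_neg]

theorem r1_bounded (u : Lp ℂ 2 (volume : Measure (Pt 2)))
    (hu : MemSobolev 2 2 (u : 𝓢'(Pt 2, ℂ))) :
    ∃ C : ℝ, ∀ᵐ x, ‖u x‖ ≤ C := by
  obtain ⟨v, hv⟩ := hu.fourier_memL1 (by simp)
  have h := r1_fourier_L1 u v hv
  refine ⟨∫ x, ‖v x‖, ?_⟩
  filter_upwards [h] with x hx
  rw [hx, Real.fourierInv_eq_fourier_neg]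
  exact VectorFourier.norm_fourierIntegral_le_integral_norm _ _ _ _ _

/-- unit vectors -/
abbrev ee (k : Fin 2) : Pt 2 := EuclideanSpace.single k (1 : ℝ)

theorem r1_smooth (u : Lp ℂ 2 (volume : Measure (Pt 2)))
    (hu : MemSobolev 2 2 (u : 𝓢'(Pt 2, ℂ)))
    (hk : ∀ k, MemSobolev 2 2 (∂_{ee k} (u : 𝓢'(Pt 2, ℂ)))) :
    ∃ f : Pt 2 → ℂ, ContDiff ℝ 1 f ∧ u =ᵐ[volume] f := by
  obtain ⟨v, hv⟩ := hu.fourier_memL1 (by simp)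
  have h := r1_fourier_L1 u v hv
  have hvi : Integrable (v : Pt 2 → ℂ) := L1.integrable_coeFn v
  have hcomp : ∀ k, Integrable (fun ξ : Pt 2 => ‖ξ k‖ * ‖v ξ‖) := by
    intro k
    obtain ⟨vk, hvk⟩ := (hk k).fourier_memL1 (by simp)
    rw [fourier_lineDerivOp_eq, hv] at hvk
    have hvki : Integrable (vk : Pt 2 → ℂ) := L1.integrable_coeFn vk
    have hcl : LocallyIntegrable (fun ξ : Pt 2 => (2 * Real.pi * I) * ((ξ k : ℂ) * v ξ)) := by
      have h0 : Continuous (fun ξ : Pt 2 => (2 * Real.pi * I) * (ξ k : ℂ)) := by fun_prop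
      have := hvi.locallyIntegrable.continuous_smul (f := (v : Pt 2 → ℂ)) h0
      refine this.congr ?_
      filter_upwards with x
      simp [mul_assoc]
    have hae := r1_ae_eq _ _ hcl hvki.locallyIntegrable (by
      intro ψ
      have := congrArg (fun T : 𝓢'(Pt 2, ℂ) => T ψ) hvk
      have ht : (fun x : Pt 2 => ((inner ℝ x (ee k) : ℝ) : ℂ)).HasTemperateGrowth := by fun_prop
      simp only [smul_apply, smulLeftCLM_apply_apply,
        Lp.toTemperedDistribution_apply, smul_eq_mul,
        SchwartzMap.smulLeftCLM_apply_apply ht] at this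
      rw [← this, ← integral_const_mul]
      congr 1
      ext x
      have hin : inner ℝ x (ee k) = x k := by
        rw [real_inner_comm, EuclideanSpace.inner_single_left]; simp
      rw [hin]
      ring)
    have h3 : Integrable (fun ξ : Pt 2 => (2 * Real.pi * I) * ((ξ k : ℂ) * v ξ)) := hvki.congr hae.symm
    have h4 := (h3.norm).const_mul (1 / (2 * Real.pi))
    refine h4.congr ?_
    filter_upwards with x
    simp [abs_of_pos Real.pi_pos]
    field_simp
  have hn : Integrable (fun ξ : Pt 2 => ‖ξ‖ * ‖v ξ‖) := by
    have hs := (hcomp 0).add (hcomp 1)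
    refine Integrable.mono' hs ?_ ?_
    · exact (continuous_norm.aestronglyMeasurable).mul hvi.aestronglyMeasurable.norm
    · filter_upwards with x
      simp only [Pi.add_apply]
      rw [Real.norm_of_nonneg (by positivity), ← add_mul]
      gcongr
      rw [EuclideanSpace.norm_eq, Fin.sum_univ_two]
      apply Real.sqrt_le_iff.mpr
      constructor
      · positivity
      · nlinarith [norm_nonneg (x 0), norm_nonneg (x 1)]
  refine ⟨𝓕⁻ (v : Pt 2 → ℂ), ?_, h⟩
  have hd : ContDiff ℝ 1 (𝓕 (v : Pt 2 → ℂ)) := by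
    refine Real.contDiff_fourier (N := 1) fun n hN => ?_
    have hN' : n ≤ 1 := by exact_mod_cast hN
    interval_cases n
    · simpa using hvi.norm
    · simpa using hn
  have h2 : 𝓕⁻ (v : Pt 2 → ℂ) = fun w => 𝓕 (v : Pt 2 → ℂ) (-w) := by
    ext w; exact Real.fourierInv_eq_fourier_neg _ w
  rw [h2]
  exact hd.comp contDiff_neg

theorem r1_memSobolev_two (u w : Lp ℂ 2 (volume : Measure (Pt 2)))
    (h : Δ (u : 𝓢'(Pt 2, ℂ)) = (w : 𝓢'(Pt 2, ℂ))) : MemSobolev 2 2 (u : 𝓢'(Pt 2, ℂ)) := by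
  have hb : besselPotential (Pt 2) ℂ 2 (u : 𝓢'(Pt 2, ℂ)) =
      (u : 𝓢'(Pt 2, ℂ)) + (-(1 / (2 * Real.pi) ^ 2 : ℝ)) • Δ (u : 𝓢'(Pt 2, ℂ)) := by
    rw [laplacian_eq_fourierMultiplierCLM, smul_smul, besselPotential]
    have : (-(1 / (2 * Real.pi) ^ 2 : ℝ)) * (-(2 * Real.pi) ^ 2) = 1 := by
      have := Real.pi_pos
      field_simp
    rw [this, one_smul]
    have e1 : (fun x : Pt 2 => (((1 + ‖x‖ ^ 2) ^ ((2 : ℝ) / 2) : ℝ) : ℂ)) =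
        (fun _ : Pt 2 => (1 : ℂ)) + (fun x : Pt 2 => ((‖x‖ ^ 2 : ℝ) : ℂ)) := by
      ext x; simp
    rw [e1, fourierMultiplierCLM_apply, fourierMultiplierCLM_apply,
      smulLeftCLM_add (by fun_prop) (by fun_prop)]
    rw [add_apply, FourierTransform.fourierInv_add]
    simp
  refine ⟨u + ((-(1 / (2 * Real.pi) ^ 2 : ℝ)) : ℂ) • w, ?_⟩
  rw [hb, h]
  ext ψ
  change _ = Lp.toTemperedDistributionCLM ℂ volume 2 _ ψ
  rw [map_add, map_smul]
  simp
end

section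
open scoped FourierTransform SchwartzMap Laplacian LineDeriv ContDiff ENNReal
open TemperedDistribution

/-- directional derivative along a unit vector -/
def dd (k : Fin 2) (f : Pt 2 → ℂ) (x : Pt 2) : ℂ := fderiv ℝ f x (ee k)

/-- distribution attached to an `L²` function -/
abbrev tD (f : Pt 2 → ℂ) (hf : MemLp f 2) : 𝓢'(Pt 2, ℂ) := ((hf.toLp f : Lp ℂ 2 (volume : Measure (Pt 2))) : 𝓢'(Pt 2, ℂ))

theorem tD_apply (f : Pt 2 → ℂ) (hf : MemLp f 2) (ψ : 𝓢(Pt 2, ℂ)) :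
    tD f hf ψ = ∫ x, f x * ψ x := by
  rw [tD, Lp.toTemperedDistribution_apply]
  apply integral_congr_ae
  filter_upwards [hf.coeFn_toLp] with x hx
  rw [hx, smul_eq_mul, mul_comm]

theorem dd_schwartz (k : Fin 2) (ψ : 𝓢(Pt 2, ℂ)) (x : Pt 2) : (∂_{ee k} ψ) x = dd k ψ x := by
  rw [SchwartzMap.lineDerivOp_apply_eq_fderiv]; rfl

theorem dd_schwartz' (k : Fin 2) (ψ : 𝓢(Pt 2, ℂ)) : ((∂_{ee k} ψ : 𝓢(Pt 2, ℂ)) : Pt 2 → ℂ) = dd k ψ := by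
  ext x; exact dd_schwartz k ψ x

/-- the Laplacian as a sum of second derivatives -/
def Lap (f : Pt 2 → ℂ) (x : Pt 2) : ℂ := ∑ k, dd k (dd k f) x

theorem lap_schwartz (ψ : 𝓢(Pt 2, ℂ)) : ((Δ ψ : 𝓢(Pt 2, ℂ)) : Pt 2 → ℂ) = Lap ψ := by
  ext x
  rw [SchwartzMap.laplacian_eq_sum (EuclideanSpace.basisFun (Fin 2) ℝ)]
  simp only [Fin.sum_univ_two, add_apply, Lap]
  congr 1 <;> (rw [EuclideanSpace.basisFun_apply]; rw [dd_schwartz, dd_schwartz'])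

theorem lap_eq (u w : Pt 2 → ℂ) (hu : MemLp u 2) (hw : MemLp w 2)
    (h : ∀ ψ : 𝓢(Pt 2, ℂ), ∫ x, u x * Lap ψ x = ∫ x, w x * ψ x) :
    Δ (tD u hu) = tD w hw := by
  ext ψ
  rw [laplacian_apply_apply, tD_apply, tD_apply, ← h ψ, lap_schwartz]

theorem dd_comm (k l : Fin 2) (f : Pt 2 → ℂ) (hf : ContDiff ℝ ∞ f) (x : Pt 2) :
    dd k (dd l f) x = dd l (dd k f) x := by
  have h2 : Differentiable ℝ (fderiv ℝ f) := ((contDiff_infty.1 hf 2).fderiv_right (m := 1) (by norm_num)).differentiable (by simp)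
  have h : ∀ a b : Fin 2, dd a (dd b f) x = fderiv ℝ (fderiv ℝ f) x (ee a) (ee b) := by
    intro a b
    change fderiv ℝ (fun y => fderiv ℝ f y (ee b)) x (ee a) = _
    rw [fderiv_clm_apply (h2 x) (differentiableAt_const _)]
    simp
  rw [h, h]
  exact ((contDiff_infty.1 hf 2).contDiffAt.isSymmSndFDerivAt (by simp)) _ _

theorem sch_comm (k l : Fin 2) (ψ : 𝓢(Pt 2, ℂ)) : (∂_{ee k} (∂_{ee l} ψ) : 𝓢(Pt 2, ℂ)) = ∂_{ee l} (∂_{ee k} ψ) := by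
  ext x
  rw [dd_schwartz, dd_schwartz, dd_schwartz', dd_schwartz']
  exact dd_comm k l ψ ψ.smooth' x

theorem tD_comm (k l : Fin 2) (T : 𝓢'(Pt 2, ℂ)) : (∂_{ee k} (∂_{ee l} T) : 𝓢'(Pt 2, ℂ)) = ∂_{ee l} (∂_{ee k} T) := by
  ext ψ
  simp only [TemperedDistribution.lineDerivOp_apply_apply, map_neg, LineDeriv.lineDerivOp_neg]
  rw [sch_comm]

theorem tD_deriv_eq (k : Fin 2) (u w : Pt 2 → ℂ) (hu : MemLp u 2) (hw : MemLp w 2)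
    (h : ∀ ψ : 𝓢(Pt 2, ℂ), ∫ x, u x * dd k ψ x = - ∫ x, w x * ψ x) :
    ∂_{ee k} (tD u hu) = tD w hw := by
  ext ψ
  rw [TemperedDistribution.lineDerivOp_apply_apply, map_neg, tD_apply, tD_apply, dd_schwartz', h ψ, neg_neg]

theorem exists_tD (f : Lp ℂ 2 (volume : Measure (Pt 2))) :
    ∃ (g : Pt 2 → ℂ) (hg : MemLp g 2), (f : 𝓢'(Pt 2, ℂ)) = tD g hg :=
  ⟨f, Lp.memLp f, by rw [tD, Lp.toLp_coeFn]⟩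

theorem reg2 (u w : Pt 2 → ℂ) (hu : MemLp u 2) (hw : MemLp w 2)
    (h : ∀ ψ : 𝓢(Pt 2, ℂ), ∫ x, u x * Lap ψ x = ∫ x, w x * ψ x) :
    (∃ C : ℝ, ∀ᵐ x, ‖u x‖ ≤ C) ∧ 
    (∀ k l : Fin 2, ∃ v : Pt 2 → ℂ, MemLp v 2 ∧ ∀ ψ : 𝓢(Pt 2, ℂ),
      ∫ x, u x * dd k (dd l ψ) x = ∫ x, v x * ψ x) := by
  have hS := r1_memSobolev_two _ _ (lap_eq u w hu hw h)
  constructor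
  · obtain ⟨C, hC⟩ := r1_bounded _ hS
    refine ⟨C, ?_⟩
    filter_upwards [hC, hu.coeFn_toLp] with x h1 h2
    rw [← h2]; exact h1
  · intro k l
    have h2 := (hS.lineDerivOp (m := ee k)).lineDerivOp (m := ee l)
    rw [show (2 : ℝ) - 1 - 1 = 0 by norm_num, memSobolev_zero_iff] at h2
    obtain ⟨f, hf⟩ := h2
    obtain ⟨v, hv, hfv⟩ := exists_tD f
    refine ⟨v, hv, fun ψ => ?_⟩
    rw [← tD_apply v hv, ← hfv, ← hf]
    rw [TemperedDistribution.lineDerivOp_apply_apply, TemperedDistribution.lineDerivOp_apply_apply]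
    rw [← dd_schwartz', ← dd_schwartz', ← tD_apply u hu]
    simp

/-- global H¹ -/
def H1' (f : Pt 2 → ℂ) : Prop := MemLp f 2 ∧ ∀ k, ∃ w : Pt 2 → ℂ, MemLp w 2 ∧
  ∀ ψ : 𝓢(Pt 2, ℂ), ∫ x, f x * dd k ψ x = - ∫ x, w x * ψ x

theorem reg3 (u w : Pt 2 → ℂ) (hu : MemLp u 2) (hw : H1' w)
    (h : ∀ ψ : 𝓢(Pt 2, ℂ), ∫ x, u x * Lap ψ x = ∫ x, w x * ψ x) :
    ∃ f : Pt 2 → ℂ, ContDiff ℝ 1 f ∧ u =ᵐ[volume] f := by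
  have hL := lap_eq u w hu hw.1 h
  have hS := r1_memSobolev_two _ _ hL
  obtain ⟨f, hf, huf⟩ := r1_smooth _ hS (by
    intro k
    have h1 := (hS.lineDerivOp (m := ee k)).mono (s' := 0) (by norm_num)
    rw [memSobolev_zero_iff] at h1
    obtain ⟨v, hv⟩ := h1
    rw [hv]
    obtain ⟨wk, hwk, hw2⟩ := hw.2 k
    have h3 := tD_deriv_eq k w wk hw.1 hwk hw2
    apply r1_memSobolev_two _ (hwk.toLp wk)
    rw [← hv]
    change Δ (∂_{ee k} (tD u hu)) = tD wk hwk
    rw [← h3, ← hL]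
    rw [laplacian_eq_sum (EuclideanSpace.basisFun (Fin 2) ℝ), laplacian_eq_sum (EuclideanSpace.basisFun (Fin 2) ℝ)]
    simp only [Fin.sum_univ_two]
    rw [LineDeriv.lineDerivOp_add]
    congr 1 <;> (simp only [EuclideanSpace.basisFun_apply]; rw [tD_comm k, tD_comm k]))
  exact ⟨f, hf, hu.coeFn_toLp.symm.trans huf⟩
end

section
open scoped FourierTransform SchwartzMap Laplacian LineDeriv ContDiff ENNReal
open TemperedDistribution

/-- test functions -/
def Tst (ψ : Pt 2 → ℂ) : Prop := ContDiff ℝ ∞ ψ ∧ HasCompactSupport ψ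

/-- weak derivative -/
def WD (k : Fin 2) (f g : Pt 2 → ℂ) : Prop := ∀ ψ, Tst ψ → ∫ x, f x * dd k ψ x = - ∫ x, g x * ψ x

def LH1 (f : Pt 2 → ℂ) : Prop := ∀ η, Tst η → H1' (fun x => η x * f x)

theorem smooth_dd {f : Pt 2 → ℂ} (hf : ContDiff ℝ ∞ f) (k : Fin 2) : ContDiff ℝ ∞ (dd k f) :=
  (hf.fderiv_right (m := ∞) (by simp)).clm_apply contDiff_const

theorem smooth_diff {f : Pt 2 → ℂ} (hf : ContDiff ℝ ∞ f) : Differentiable ℝ f :=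
  hf.differentiable (by simp)

theorem Tst.dd {f : Pt 2 → ℂ} (hf : Tst f) (k : Fin 2) : Tst (dd k f) :=
  ⟨smooth_dd hf.1 k, hf.2.fderiv_apply (𝕜 := ℝ) (ee k)⟩

theorem Tst.mul {f p : Pt 2 → ℂ} (hf : Tst f) (hp : ContDiff ℝ ∞ p) : Tst (fun x => f x * p x) :=
  ⟨hf.1.mul hp, hf.2.mul_right⟩

theorem dd_mul (k : Fin 2) {f g : Pt 2 → ℂ} {x : Pt 2} (hf : DifferentiableAt ℝ f x) (hg : DifferentiableAt ℝ g x) :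
    dd k (fun y => f y * g y) x = dd k f x * g x + f x * dd k g x := by
  unfold dd
  rw [fderiv_fun_mul hf hg]
  simp
  ring

theorem dd_add (k : Fin 2) {f g : Pt 2 → ℂ} {x : Pt 2} (hf : DifferentiableAt ℝ f x) (hg : DifferentiableAt ℝ g x) :
    dd k (fun y => f y + g y) x = dd k f x + dd k g x := by
  unfold dd
  rw [fderiv_fun_add hf hg]
  simp

theorem Tst.bdd {η : Pt 2 → ℂ} (h : Tst η) : ∃ C : ℝ, ∀ x, ‖η x‖ ≤ C :=
  h.2.exists_bound_of_continuous h.1.continuous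

theorem Tst.memLp_mul {η f : Pt 2 → ℂ} (h : Tst η) (hf : MemLp f 2) : MemLp (fun x => η x * f x) 2 := by
  obtain ⟨C, hC⟩ := h.bdd
  refine hf.of_le_mul (c := C) (h.1.continuous.aestronglyMeasurable.mul hf.1) ?_
  filter_upwards with x
  rw [norm_mul]
  gcongr
  exact hC x

theorem sch_int {f : Pt 2 → ℂ} (hf : MemLp f 2) (ψ : 𝓢(Pt 2, ℂ)) : Integrable (fun x => f x * ψ x) :=
  hf.integrable_mul (ψ.memLp 2)

theorem sch_int' {f : Pt 2 → ℂ} (hf : MemLp f 2) (k : Fin 2) (ψ : 𝓢(Pt 2, ℂ)) :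
    Integrable (fun x => f x * dd k ψ x) := by
  rw [← dd_schwartz']; exact sch_int hf _

theorem sch_int'' {f : Pt 2 → ℂ} (hf : MemLp f 2) (k l : Fin 2) (ψ : 𝓢(Pt 2, ℂ)) :
    Integrable (fun x => f x * dd k (dd l ψ) x) := by
  rw [← dd_schwartz' l]; exact sch_int' hf k _

theorem H1'.add {f g : Pt 2 → ℂ} (hf : H1' f) (hg : H1' g) : H1' (fun x => f x + g x) := by
  refine ⟨hf.1.add hg.1, fun k => ?_⟩
  obtain ⟨w, hw, h1⟩ := hf.2 k
  obtain ⟨v, hv, h2⟩ := hg.2 k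
  refine ⟨fun x => w x + v x, hw.add hv, fun ψ => ?_⟩
  simp only [add_mul]
  rw [integral_add (sch_int' hf.1 k ψ) (sch_int' hg.1 k ψ), integral_add (sch_int hw ψ) (sch_int hv ψ), h1, h2]
  ring

theorem LH1.add {f g : Pt 2 → ℂ} (hf : LH1 f) (hg : LH1 g) : LH1 (fun x => f x + g x) := by
  intro η h
  simp only [mul_add]
  exact (hf η h).add (hg η h)

theorem LH1.zero : LH1 (fun _ => 0) := by
  intro η h
  simp only [mul_zero]
  exact ⟨MemLp.zero, fun k => ⟨fun _ => 0, MemLp.zero, fun ψ => by simp⟩⟩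

theorem LH1.sum {ι : Type*} (s : Finset ι) (f : ι → Pt 2 → ℂ) (h : ∀ i, LH1 (f i)) :
    LH1 (fun x => ∑ i ∈ s, f i x) := by
  classical
  induction s using Finset.induction_on with
  | empty => simpa using LH1.zero
  | insert a s ha ih =>
    simp only [Finset.sum_insert ha]
    exact (h a).add ih

theorem LH1.smooth {f p : Pt 2 → ℂ} (hf : LH1 f) (hp : ContDiff ℝ ∞ p) : LH1 (fun x => p x * f x) := by
  intro η h
  have := hf _ (h.mul hp)
  simpa only [mul_assoc] using this

theorem tst_sch {η : Pt 2 → ℂ} (h : Tst η) (ψ : 𝓢(Pt 2, ℂ)) : Tst (fun x => η x * ψ x) := h.mul ψ.smooth'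

theorem LH1_of_WD {f : Pt 2 → ℂ} (hf : ∀ η, Tst η → MemLp (fun x => η x * f x) 2)
    (hs : ∀ k, ∃ s, WD k f s ∧ ∀ η, Tst η → MemLp (fun x => η x * s x) 2) : LH1 f := by
  intro η h
  refine ⟨hf η h, fun k => ?_⟩
  obtain ⟨s, hw, hsl⟩ := hs k
  refine ⟨fun x => dd k η x * f x + η x * s x, (hf _ (h.dd k)).add (hsl η h), fun ψ => ?_⟩
  have key := hw _ (tst_sch h ψ)
  have e : ∀ x, f x * dd k (fun y => η y * ψ y) x = (dd k η x * f x) * ψ x + (η x * f x) * dd k ψ x := by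
    intro x
    rw [dd_mul k (smooth_diff h.1 x) (ψ.differentiableAt)]
    ring
  simp only [e] at key
  rw [integral_add (sch_int (hf _ (h.dd k)) ψ) (sch_int' (hf η h) k ψ)] at key
  simp only [add_mul]
  rw [integral_add (sch_int (hf _ (h.dd k)) ψ) (sch_int (hsl η h) ψ)]
  have e2 : ∫ x, s x * (η x * ψ x) = ∫ x, η x * s x * ψ x := by congr 1; ext x; ring
  rw [e2] at key
  linear_combination key

/-- localized equation -/
theorem loc_eq {φ h : Pt 2 → ℂ} {g : Fin 2 → Pt 2 → ℂ} (hφ : MemLp φ 2) (hg : ∀ k, MemLp (g k) 2)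
    (hwd : ∀ k, WD k φ (g k)) (hh : ∀ η, Tst η → MemLp (fun x => η x * h x) 2)
    (heq : ∀ ψ, Tst ψ → ∫ x, φ x * Lap ψ x = ∫ x, h x * ψ x) (η : Pt 2 → ℂ) (hη : Tst η) (ψ : 𝓢(Pt 2, ℂ)) :
    ∫ x, (η x * φ x) * Lap ψ x = ∫ x, (η x * h x + ∑ k, 2 * dd k η x * g k x + ∑ k, dd k (dd k η) x * φ x) * ψ x := by
  have hηd := smooth_diff hη.1
  have hψd : Differentiable ℝ ψ := ψ.differentiable
  have hψs : ContDiff ℝ ∞ ψ := ψ.smooth'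
  have key := heq _ (tst_sch hη ψ)
  have e1 : ∀ k, (dd k fun y => η y * ψ y) = fun x => dd k η x * ψ x + η x * dd k ψ x := by
    intro k; ext x; exact dd_mul k (hηd x) (hψd x)
  have e2 : ∀ k x, dd k (dd k fun y => η y * ψ y) x = dd k (dd k η) x * ψ x + 2 * (dd k η x * dd k ψ x) + η x * dd k (dd k ψ) x := by
    intro k x
    have d1 := smooth_diff (smooth_dd hη.1 k)
    have d2 := smooth_diff (smooth_dd hψs k)
    rw [e1, dd_add k ((d1.fun_mul hψd) x) ((hηd.fun_mul d2) x), dd_mul k (d1 x) (hψd x), dd_mul k (hηd x) (d2 x)]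
    ring
  have m0 : ∀ θ, Tst θ → MemLp (fun x => θ x * φ x) 2 := fun θ hθ => hθ.memLp_mul hφ
  have key1 : ∀ k, ∫ x, (dd k η x * φ x) * dd k ψ x = - (∫ x, (dd k (dd k η) x * φ x) * ψ x) - ∫ x, (dd k η x * g k x) * ψ x := by
    intro k
    have := hwd k _ (tst_sch (hη.dd k) ψ)
    have e : ∀ x, φ x * dd k (fun y => dd k η y * ψ y) x = (dd k (dd k η) x * φ x) * ψ x + (dd k η x * φ x) * dd k ψ x := by
      intro x
      rw [dd_mul k (smooth_diff (smooth_dd hη.1 k) x) (hψd x)]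
      ring
    simp only [e] at this
    rw [integral_add (sch_int (m0 _ ((hη.dd k).dd k)) ψ) (sch_int' (m0 _ (hη.dd k)) k ψ)] at this
    have e2 : ∫ x, g k x * (dd k η x * ψ x) = ∫ x, dd k η x * g k x * ψ x := by congr 1; ext x; ring
    rw [e2] at this
    linear_combination this
  have i1 := fun k => sch_int (m0 _ ((hη.dd k).dd k)) ψ
  have i2 := fun k => sch_int' (m0 _ (hη.dd k)) k ψ
  have i3 := fun k => sch_int'' (m0 _ hη) k k ψ
  have i4 := fun k => sch_int ((hη.dd k).memLp_mul (hg k)) ψ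
  have i5 := sch_int (hh η hη) ψ
  have l1 : ∫ x, φ x * Lap (fun x => η x * ψ x) x = ∑ k, (∫ x, (dd k (dd k η) x * φ x) * ψ x) + 2 * ∑ k, (∫ x, (dd k η x * φ x) * dd k ψ x) + ∫ x, (η x * φ x) * Lap ψ x := by
    have : ∀ x, φ x * Lap (fun x => η x * ψ x) x = ((dd 0 (dd 0 η) x * φ x) * ψ x + (dd 1 (dd 1 η) x * φ x) * ψ x)
        + (2 * ((dd 0 η x * φ x) * dd 0 ψ x) + 2 * ((dd 1 η x * φ x) * dd 1 ψ x)) + (η x * φ x) * Lap ψ x := by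
      intro x
      simp only [Lap, Fin.sum_univ_two, e2]
      ring
    simp only [this]
    have i6 : Integrable (fun x => (η x * φ x) * Lap ψ x) := by
      simp only [Lap, Fin.sum_univ_two, mul_add]
      exact (i3 0).add (i3 1)
    rw [integral_add ?_ i6, integral_add ?_ ?_, integral_add (i1 0) (i1 1), integral_add ?_ ?_]
    · simp only [Fin.sum_univ_two, integral_const_mul]; ring
    · exact (i2 0).const_mul 2
    · exact (i2 1).const_mul 2
    · exact (i1 0).add (i1 1)
    · exact ((i2 0).const_mul 2).add ((i2 1).const_mul 2)
    · exact ((i1 0).add (i1 1)).add (((i2 0).const_mul 2).add ((i2 1).const_mul 2))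
  have l2 : ∫ x, (η x * h x + ∑ k, 2 * dd k η x * g k x + ∑ k, dd k (dd k η) x * φ x) * ψ x =
      (∫ x, η x * h x * ψ x) + 2 * ∑ k, (∫ x, (dd k η x * g k x) * ψ x) + ∑ k, (∫ x, (dd k (dd k η) x * φ x) * ψ x) := by
    have : ∀ x, (η x * h x + ∑ k, 2 * dd k η x * g k x + ∑ k, dd k (dd k η) x * φ x) * ψ x = η x * h x * ψ x + (2 * ((dd 0 η x * g 0 x) * ψ x) + 2 * ((dd 1 η x * g 1 x) * ψ x)) + ((dd 0 (dd 0 η) x * φ x) * ψ x + (dd 1 (dd 1 η) x * φ x) * ψ x) := by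
      intro x
      simp only [Fin.sum_univ_two]; ring
    simp only [this]
    have j1 := (i1 0).add (i1 1)
    have j2 := ((i4 0).const_mul 2).add ((i4 1).const_mul 2)
    rw [integral_add (by exact i5.add j2) (by exact j1), integral_add i5 (by exact j2), integral_add (i1 0) (i1 1), integral_add ((i4 0).const_mul 2) ((i4 1).const_mul 2)]
    simp only [Fin.sum_univ_two, integral_const_mul]; ring
  have l3 : ∫ x, h x * (η x * ψ x) = ∫ x, η x * h x * ψ x := by congr 1; ext x; ring
  rw [l1, l3] at key
  rw [l2]
  simp only [key1, Fin.sum_univ_two] at key ⊢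
  linear_combination key
end

section
open scoped FourierTransform SchwartzMap Laplacian LineDeriv ContDiff ENNReal
open TemperedDistribution

def L2l (f : Pt 2 → ℂ) : Prop := ∀ η, Tst η → MemLp (fun x => η x * f x) 2

theorem L2l.of_memLp {f : Pt 2 → ℂ} (hf : MemLp f 2) : L2l f := fun _ h => h.memLp_mul hf

theorem L2l.add {f g : Pt 2 → ℂ} (hf : L2l f) (hg : L2l g) : L2l (fun x => f x + g x) := by
  intro η h
  simp only [mul_add]
  exact (hf η h).add (hg η h)

theorem L2l.sum {ι : Type*} (s : Finset ι) (f : ι → Pt 2 → ℂ) (h : ∀ i, L2l (f i)) :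
    L2l (fun x => ∑ i ∈ s, f i x) := by
  intro η hη
  simp only [Finset.mul_sum]
  exact memLp_finsetSum s (fun i _ => h i η hη)

theorem L2l.smooth {f p : Pt 2 → ℂ} (hf : L2l f) (hp : ContDiff ℝ ∞ p) : L2l (fun x => p x * f x) := by
  intro η h
  have := hf _ (h.mul hp)
  simpa only [mul_assoc] using this

theorem exists_cutoff (R : ℝ) (hR : 0 < R) : ∃ θ : Pt 2 → ℂ, Tst θ ∧ ∀ x, ‖x‖ ≤ R → θ x = 1 := by
  let b : ContDiffBump (0 : Pt 2) := ⟨R, R + 1, hR, by linarith⟩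
  refine ⟨fun x => ((b x : ℝ) : ℂ), ⟨Complex.ofRealCLM.contDiff.comp b.contDiff, b.hasCompactSupport.comp_left (g := fun t : ℝ => (t : ℂ)) (by simp)⟩, fun x hx => ?_⟩
  have : b x = 1 := b.one_of_mem_closedBall (by simpa using hx)
  simp [this]

theorem Tst.supp_ball {η : Pt 2 → ℂ} (h : Tst η) : ∃ R : ℝ, 0 < R ∧ ∀ x, R < ‖x‖ → η x = 0 := by
  obtain ⟨R, hR⟩ := h.2.isCompact.isBounded.subset_closedBall 0
  refine ⟨max R 1, by positivity, fun x hx => ?_⟩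
  by_contra hne
  have h1 := hR (subset_tsupport _ hne)
  simp at h1
  linarith [le_max_left R 1]

theorem patch (u : Pt 2 → ℂ) (h : ∀ η, Tst η → ∃ f : Pt 2 → ℂ, ContDiff ℝ 1 f ∧ (fun x => η x * u x) =ᵐ[volume] f) :
    ∃ f : Pt 2 → ℂ, ContDiff ℝ 1 f ∧ u =ᵐ[volume] f := by
  have h1 : ∀ n : ℕ, ∃ f : Pt 2 → ℂ, ContDiff ℝ 1 f ∧ ∀ᵐ x, ‖x‖ ≤ (n : ℝ) + 1 → u x = f x := by
    intro n
    obtain ⟨θ, hθ, h1⟩ := exists_cutoff ((n : ℝ) + 1) (by positivity)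
    obtain ⟨f, hf, hu⟩ := h θ hθ
    refine ⟨f, hf, ?_⟩
    filter_upwards [hu] with x hx hn
    rw [← hx, h1 x hn, one_mul]
  choose F hF hFu using h1
  have hcons : ∀ n m : ℕ, n ≤ m → ∀ x, ‖x‖ < (n : ℝ) + 1 → F n x = F m x := by
    intro n m hnm x hx
    have hae : F n =ᵐ[volume.restrict (Metric.ball (0 : Pt 2) (n + 1))] F m := by
      rw [Filter.EventuallyEq, ae_restrict_iff' measurableSet_ball]
      filter_upwards [hFu n, hFu m] with y h1 h2 hy
      simp only [Metric.mem_ball, dist_zero_right] at hy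
      rw [← h1 hy.le, ← h2 (hy.le.trans (by gcongr))]
    exact Measure.eqOn_open_of_ae_eq hae Metric.isOpen_ball (hF n).continuous.continuousOn (hF m).continuous.continuousOn (by simpa using hx)
  have hN : ∀ x : Pt 2, ‖x‖ < (⌈‖x‖⌉₊ : ℝ) + 1 := fun x => by linarith [Nat.le_ceil ‖x‖]
  refine ⟨fun x => F ⌈‖x‖⌉₊ x, contDiff_iff_contDiffAt.2 fun x => ?_, ?_⟩
  · have hloc : (fun y => F ⌈‖y‖⌉₊ y) =ᶠ[nhds x] F (⌈‖x‖⌉₊) := by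
      have : Metric.ball (0 : Pt 2) (⌈‖x‖⌉₊ + 1) ∈ nhds x := Metric.isOpen_ball.mem_nhds (by simpa using hN x)
      filter_upwards [this] with y hy
      simp only [Metric.mem_ball, dist_zero_right] at hy
      rcases le_total ⌈‖y‖⌉₊ ⌈‖x‖⌉₊ with h1 | h1
      · exact hcons _ _ h1 y (hN y)
      · exact (hcons _ _ h1 y hy).symm
    exact (hF _).contDiffAt.congr_of_eventuallyEq hloc
  · have := ae_all_iff.2 hFu
    filter_upwards [this] with x hx
    exact hx _ (hN x).le

theorem reg_main (φ : Fin 3 → Pt 2 → ℂ) (g : Fin 3 → Fin 2 → Pt 2 → ℂ)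
    (hφ : ∀ j, MemLp (φ j) 2) (hg : ∀ j k, MemLp (g j k) 2) (hwd : ∀ j k, WD k (φ j) (g j k))
    (T : Fin 3 → Pt 2 → ℂ) (hT : ∀ j, MemLp (T j) 2) (S : Fin 3 → Fin 2 → Pt 2 → ℂ)
    (hS : ∀ j k, WD k (T j) (S j k)) (hSm : ∀ j k, AEStronglyMeasurable (S j k))
    (C : ℝ) (hSb : ∀ j k, ∀ᵐ x, ‖S j k x‖ ≤ C * (∑ i, ‖φ i x‖) ^ 2 * (∑ i, ∑ l, ‖g i l x‖))
    (p : Fin 3 → Fin 3 → Pt 2 → ℂ) (hp : ∀ j i, ContDiff ℝ ∞ (p j i))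
    (q : Fin 3 → Fin 3 → Fin 2 → Pt 2 → ℂ) (hq : ∀ j i k, ContDiff ℝ ∞ (q j i k))
    (heq : ∀ j ψ, Tst ψ → ∫ x, φ j x * Lap ψ x =
      ∫ x, (∑ i, p j i x * φ i x + ∑ i, ∑ k, q j i k x * g i k x + T j x) * ψ x) :
    ∀ j, ∃ f : Pt 2 → ℂ, ContDiff ℝ 1 f ∧ φ j =ᵐ[volume] f := by
  have hh : ∀ j, L2l (fun x => ∑ i, p j i x * φ i x + ∑ i, ∑ k, q j i k x * g i k x + T j x) := by
    intro j
    refine L2l.add (L2l.add ?_ ?_) (.of_memLp (hT j))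
    · exact L2l.sum _ _ fun i => (L2l.of_memLp (hφ i)).smooth (hp j i)
    · exact L2l.sum _ _ fun i => L2l.sum _ _ fun k => (L2l.of_memLp (hg i k)).smooth (hq j i k)
  have hloc : ∀ j η, Tst η → ∀ ψ : 𝓢(Pt 2, ℂ), _ := fun j η hη ψ => loc_eq (hφ j) (hg j) (hwd j) (hh j) (heq j) η hη ψ
  have hw : ∀ j η, Tst η → MemLp (fun x => η x * (∑ i, p j i x * φ i x + ∑ i, ∑ k, q j i k x * g i k x + T j x) + ∑ k, 2 * dd k η x * g j k x + ∑ k, dd k (dd k η) x * φ j x) 2 := by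
    intro j η hη
    refine ((hh j η hη).add ?_).add ?_
    · refine memLp_finsetSum _ (fun k _ => ?_)
      have : Tst (fun x => 2 * dd k η x) := by
        simpa [mul_comm] using (hη.dd k).mul (p := fun _ => 2) contDiff_const
      exact this.memLp_mul (hg j k)
    · exact memLp_finsetSum _ (fun k _ => ((hη.dd k).dd k).memLp_mul (hφ j))
  have h2 := fun j η (hη : Tst η) => reg2 _ _ (hη.memLp_mul (hφ j)) (hw j η hη) (hloc j η hη)
  -- local bounds
  have hbd : ∀ R : ℝ, 0 < R → ∃ B : ℝ, 0 ≤ B ∧ ∀ᵐ x, ‖x‖ ≤ R → ∑ i, ‖φ i x‖ ≤ B := by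
    intro R hR
    obtain ⟨θ, hθ, h1⟩ := exists_cutoff R hR
    choose B hB using fun j => (h2 j θ hθ).1
    refine ⟨∑ j, |B j|, by positivity, ?_⟩
    filter_upwards [ae_all_iff.2 hB] with x hx hxR
    refine Finset.sum_le_sum fun i _ => ?_
    have := hx i
    rw [h1 x hxR, one_mul] at this
    exact this.trans (le_abs_self _)
  have hφL : ∀ j, LH1 (φ j) := fun j => LH1_of_WD (L2l.of_memLp (hφ j))
    fun k => ⟨g j k, hwd j k, L2l.of_memLp (hg j k)⟩
  have hgL : ∀ j k, LH1 (g j k) := by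
    intro j k η hη
    refine ⟨hη.memLp_mul (hg j k), fun l => ?_⟩
    obtain ⟨v, hv, hv2⟩ := (h2 j η hη).2 k l
    obtain ⟨w, hw, hw2⟩ := (hφL j _ (hη.dd k)).2 l
    refine ⟨fun x => v x - w x, hv.sub hw, fun ψ => ?_⟩
    have key := hwd j k _ (tst_sch hη (∂_{ee l} ψ))
    rw [dd_schwartz'] at key
    have e : ∀ x, φ j x * dd k (fun y => η y * dd l ψ y) x = (dd k η x * φ j x) * dd l ψ x + (η x * φ j x) * dd k (dd l ψ) x := by
      intro x
      rw [dd_mul k (smooth_diff hη.1 x) (smooth_diff (smooth_dd (f := ⇑ψ) ψ.smooth' l) x)]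
      ring
    simp only [e] at key
    rw [integral_add (sch_int' (hη.dd k |>.memLp_mul (hφ j)) l ψ) (sch_int'' (hη.memLp_mul (hφ j)) k l ψ), hv2, hw2] at key
    simp only [sub_mul]
    rw [integral_sub (sch_int hv ψ) (sch_int hw ψ)]
    have e2 : ∫ x, g j k x * (η x * dd l ψ x) = ∫ x, η x * g j k x * dd l ψ x := by congr 1; ext x; ring
    rw [e2] at key
    linear_combination key
  have hTL : ∀ j, LH1 (T j) := fun j => LH1_of_WD (L2l.of_memLp (hT j)) fun k => ⟨S j k, hS j k, by
    intro η hη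
    obtain ⟨R, hR, hη0⟩ := hη.supp_ball
    obtain ⟨B, hB0, hB⟩ := hbd R hR
    obtain ⟨D, hD⟩ := hη.bdd
    have hm : MemLp (fun x => ∑ i, ∑ l, ‖g i l x‖) 2 := 
      memLp_finsetSum _ fun i _ => memLp_finsetSum _ fun l _ => (hg i l).norm
    refine hm.of_le_mul (c := D * (|C| * B ^ 2)) (hη.1.continuous.aestronglyMeasurable.mul (hSm j k)) ?_
    filter_upwards [hB, hSb j k] with x h1 h2
    have hG : 0 ≤ ∑ i, ∑ l, ‖g i l x‖ := by positivity
    have hD0 : 0 ≤ D := (norm_nonneg _).trans (hD x)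
    rw [Real.norm_of_nonneg hG, norm_mul]
    by_cases hx : ‖x‖ ≤ R
    · have h3 := h1 hx
      calc ‖η x‖ * ‖S j k x‖ ≤ D * (C * (∑ i, ‖φ i x‖) ^ 2 * (∑ i, ∑ l, ‖g i l x‖)) := by gcongr; exact hD x
        _ ≤ D * (|C| * B ^ 2 * (∑ i, ∑ l, ‖g i l x‖)) := by gcongr; exact le_abs_self C
        _ = _ := by ring
    · rw [hη0 x (not_le.1 hx)]
      simp only [norm_zero, zero_mul]
      positivity⟩
  have hhL : ∀ j, LH1 (fun x => ∑ i, p j i x * φ i x + ∑ i, ∑ k, q j i k x * g i k x + T j x) := by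
    intro j
    refine LH1.add (LH1.add ?_ ?_) (hTL j)
    · exact LH1.sum _ _ fun i => (hφL i).smooth (hp j i)
    · exact LH1.sum _ _ fun i => LH1.sum _ _ fun k => (hgL i k).smooth (hq j i k)
  have hwH : ∀ j η, Tst η → H1' (fun x => η x * (∑ i, p j i x * φ i x + ∑ i, ∑ k, q j i k x * g i k x + T j x) + ∑ k, 2 * dd k η x * g j k x + ∑ k, dd k (dd k η) x * φ j x) := by
    intro j η hη
    simp only [Fin.sum_univ_two (f := fun k => 2 * dd k η _ * g j k _), Fin.sum_univ_two (f := fun k => dd k (dd k η) _ * _)]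
    have ht : ∀ k, Tst (fun x => 2 * dd k η x) := fun k => by
        simpa [mul_comm] using (hη.dd k).mul (p := fun _ => 2) contDiff_const
    refine ((hhL j η hη).add ?_).add ?_
    · exact (hgL j 0 _ (ht 0)).add (hgL j 1 _ (ht 1))
    · exact (hφL j _ ((hη.dd 0).dd 0)).add (hφL j _ ((hη.dd 1).dd 1))
  intro j
  exact patch _ fun η hη => reg3 _ _ (hη.memLp_mul (hφ j)) (hwH j η hη) (hloc j η hη)
end

section
open scoped ContDiff ENNReal

def mk2 (p : ℝ × ℝ) : Pt 2 := !₂[p.1, p.2]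

theorem mk2_mp : MeasurePreserving mk2 := by
  have h1 := (EuclideanSpace.volume_preserving_symm_measurableEquiv_toLp (Fin 2)).symm
  have h2 := (MeasureTheory.volume_preserving_finTwoArrow ℝ).symm
  have h3 := h1.comp h2
  have : mk2 = (⇑((MeasurableEquiv.toLp 2 (Fin 2 → ℝ)).symm.symm) ∘ ⇑(MeasurableEquiv.finTwoArrow (α := ℝ)).symm) := by
    ext p i
    fin_cases i <;> rfl
  rw [this]; exact h3

theorem mk2_emb : MeasurableEmbedding mk2 := by
  have : mk2 = (⇑((MeasurableEquiv.toLp 2 (Fin 2 → ℝ)).symm.symm) ∘ ⇑(MeasurableEquiv.finTwoArrow (α := ℝ)).symm) := by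
    ext p i
    fin_cases i <;> rfl
  rw [this]; exact (MeasurableEquiv.measurableEmbedding _).comp (MeasurableEquiv.measurableEmbedding _)

theorem one_dim (f f' : ℝ → ℂ) (hd : ∀ x, HasDerivAt f (f' x) x) (hf : Integrable f) (hf' : Integrable f') (x : ℝ) :
    ‖f x‖ₑ ≤ ∫⁻ t, ‖f' t‖ₑ := by
  have ht := tendsto_zero_of_hasDerivAt_of_integrableOn_Iic (a := x) (fun y _ => hd y) hf'.integrableOn hf.integrableOn
  have h := integral_Iic_of_hasDerivAt_of_tendsto' (a := x) (fun y _ => hd y) hf'.integrableOn ht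
  rw [sub_zero] at h
  rw [← h]
  exact (enorm_integral_le_lintegral_enorm _).trans (lintegral_mono' Measure.restrict_le_self le_rfl)

theorem hasDeriv_mk2_fst (u : Pt 2 → ℂ) (hu : Differentiable ℝ u) (x y : ℝ) :
    HasDerivAt (fun s => u (mk2 (s, y))) (dd 0 u (mk2 (x, y))) x := by
  have h : HasDerivAt (fun s : ℝ => mk2 (s, y)) (ee 0) x := by
    have : (fun s : ℝ => mk2 (s, y)) = fun s : ℝ => s • ee 0 + y • ee 1 := by
      ext s i; fin_cases i <;> simp [mk2]
    rw [this]
    simpa using ((hasDerivAt_id x).smul_const (ee 0)).add_const (y • ee 1)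
  exact (hu (mk2 (x, y))).hasFDerivAt.comp_hasDerivAt x h

theorem hasDeriv_mk2_snd (u : Pt 2 → ℂ) (hu : Differentiable ℝ u) (x y : ℝ) :
    HasDerivAt (fun s => u (mk2 (x, s))) (dd 1 u (mk2 (x, y))) y := by
  have h : HasDerivAt (fun s : ℝ => mk2 (x, s)) (ee 1) y := by
    have : (fun s : ℝ => mk2 (x, s)) = fun s : ℝ => x • ee 0 + s • ee 1 := by
      ext s i; fin_cases i <;> simp [mk2]
    rw [this]
    simpa using ((hasDerivAt_id y).smul_const (ee 1)).const_add (x • ee 0)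
  exact (hu (mk2 (x, y))).hasFDerivAt.comp_hasDerivAt y h

theorem lady_l (u : Pt 2 → ℂ) (hd : Differentiable ℝ u) (hu : Integrable u)
    (h0 : Integrable (dd 0 u)) (h1 : Integrable (dd 1 u)) :
    ∫⁻ x, ‖u x‖ₑ ^ 2 ≤ (∫⁻ x, ‖dd 0 u x‖ₑ) * ∫⁻ x, ‖dd 1 u x‖ₑ := by
  have key : ∀ F : Pt 2 → ℂ, ∀ G : ℂ → ℝ≥0∞, ∫⁻ x, G (F x) = ∫⁻ p : ℝ × ℝ, G (F (mk2 p)) := fun F G =>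
    (mk2_mp.lintegral_comp_emb mk2_emb (fun x => G (F x))).symm
  have cu : Integrable (fun p : ℝ × ℝ => u (mk2 p)) (volume.prod volume) := (mk2_mp.integrable_comp_emb mk2_emb).2 hu
  have c0 : Integrable (fun p : ℝ × ℝ => dd 0 u (mk2 p)) (volume.prod volume) := (mk2_mp.integrable_comp_emb mk2_emb).2 h0
  have c1 : Integrable (fun p : ℝ × ℝ => dd 1 u (mk2 p)) (volume.prod volume) := (mk2_mp.integrable_comp_emb mk2_emb).2 h1
  have a0 : ∀ᵐ y : ℝ, ∀ x : ℝ, ‖u (mk2 (x, y))‖ₑ ≤ ∫⁻ t, ‖dd 0 u (mk2 (t, y))‖ₑ := by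
    filter_upwards [cu.prod_left_ae, c0.prod_left_ae] with y e1 e2 x
    exact one_dim _ _ (fun s => hasDeriv_mk2_fst u hd s y) e1 e2 x
  have a1 : ∀ᵐ x : ℝ, ∀ y : ℝ, ‖u (mk2 (x, y))‖ₑ ≤ ∫⁻ t, ‖dd 1 u (mk2 (x, t))‖ₑ := by
    filter_upwards [cu.prod_right_ae, c1.prod_right_ae] with x e1 e2 y
    exact one_dim _ _ (fun s => hasDeriv_mk2_snd u hd x s) e1 e2 y
  rw [key u (fun z => ‖z‖ₑ ^ 2), key (dd 0 u) (fun z => ‖z‖ₑ), key (dd 1 u) (fun z => ‖z‖ₑ)]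
  change ∫⁻ p : ℝ × ℝ, _ ∂(volume.prod volume) ≤ (∫⁻ p : ℝ × ℝ, _ ∂(volume.prod volume)) * ∫⁻ p : ℝ × ℝ, _ ∂(volume.prod volume)
  rw [lintegral_prod _ (cu.1.enorm.pow_const 2), lintegral_prod_symm _ c0.1.enorm, lintegral_prod _ c1.1.enorm]
  calc ∫⁻ x : ℝ, ∫⁻ y : ℝ, ‖u (mk2 (x, y))‖ₑ ^ 2
      ≤ ∫⁻ x : ℝ, ∫⁻ y : ℝ, (∫⁻ t, ‖dd 0 u (mk2 (t, y))‖ₑ) * (∫⁻ t, ‖dd 1 u (mk2 (x, t))‖ₑ) := by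
        apply lintegral_mono_ae
        filter_upwards [a1] with x hx
        apply lintegral_mono_ae
        filter_upwards [a0] with y hy
        rw [pow_two]
        exact mul_le_mul' (hy x) (hx y)
    _ = ∫⁻ x : ℝ, (∫⁻ y : ℝ, (∫⁻ t, ‖dd 0 u (mk2 (t, y))‖ₑ)) * (∫⁻ t, ‖dd 1 u (mk2 (x, t))‖ₑ) := by
        congr 1; ext x
        rw [lintegral_mul_const'']
        exact c0.1.enorm.lintegral_prod_left'
    _ = _ := by
        rw [lintegral_const_mul'']
        exact c1.1.enorm.lintegral_prod_right'

theorem lady (u : Pt 2 → ℂ) (hd : Differentiable ℝ u) (hu : Integrable u)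
    (h0 : Integrable (dd 0 u)) (h1 : Integrable (dd 1 u)) :
    Integrable (fun x => ‖u x‖ ^ 2) ∧ ∫ x, ‖u x‖ ^ 2 ≤ (∫ x, ‖dd 0 u x‖) * ∫ x, ‖dd 1 u x‖ := by
  have h := lady_l u hd hu h0 h1
  have hfin : (∫⁻ x, ‖dd 0 u x‖ₑ) * ∫⁻ x, ‖dd 1 u x‖ₑ ≠ ⊤ := ENNReal.mul_ne_top h0.2.ne h1.2.ne
  have e : ∀ x, ‖‖u x‖ ^ 2‖ₑ = ‖u x‖ₑ ^ 2 := fun x => by simp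
  have hi : Integrable (fun x => ‖u x‖ ^ 2) := by
    refine ⟨hu.1.norm.pow 2, ?_⟩
    rw [HasFiniteIntegral]
    simp only [e]
    exact h.trans_lt hfin.lt_top
  refine ⟨hi, ?_⟩
  rw [← ofReal_integral_norm_eq_lintegral_enorm h0, ← ofReal_integral_norm_eq_lintegral_enorm h1, ← ENNReal.ofReal_mul (by positivity)] at h
  have e2 : ∫⁻ x, ‖u x‖ₑ ^ 2 = ENNReal.ofReal (∫ x, ‖u x‖ ^ 2) := by
    rw [← show ∫ x, ‖‖u x‖ ^ 2‖ = ∫ x, ‖u x‖ ^ 2 by simp, ofReal_integral_norm_eq_lintegral_enorm hi]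
    simp only [e]
  rw [e2] at h
  exact (ENNReal.ofReal_le_ofReal_iff (by positivity)).1 h
end

section
open scoped ContDiff ENNReal

theorem cs_int {f g : Pt 2 → ℝ} (hf : MemLp f 2) (hg : MemLp g 2) :
    (∫ x, ‖f x‖ * ‖g x‖) ^ 2 ≤ (∫ x, ‖f x‖ ^ 2) * ∫ x, ‖g x‖ ^ 2 := by
  have h := integral_mul_le_Lp_mul_Lq_of_nonneg (μ := (volume : Measure (Pt 2))) (f := fun x => ‖f x‖) (g := fun x => ‖g x‖) (p := 2) (q := 2) (by constructor <;> norm_num)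
    (by filter_upwards with x; positivity) (by filter_upwards with x; positivity) (by simpa using hf.norm) (by simpa using hg.norm)
  simp only [Real.rpow_two, ← Real.sqrt_eq_rpow] at h
  have h0 : 0 ≤ ∫ x, ‖f x‖ * ‖g x‖ := by positivity
  calc (∫ x, ‖f x‖ * ‖g x‖) ^ 2 ≤ (√(∫ x, ‖f x‖ ^ 2) * √(∫ x, ‖g x‖ ^ 2)) ^ 2 := by gcongr
    _ = _ := by rw [mul_pow, Real.sq_sqrt (by positivity), Real.sq_sqrt (by positivity)]

theorem sq_int {f : Pt 2 → ℂ} (hf : MemLp f 2) : Integrable (fun x => ‖f x‖ ^ 2) := hf.integrable_norm_pow (by norm_num)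

theorem memLp_two_of {f : Pt 2 → ℂ} (hm : AEStronglyMeasurable f) (h : Integrable (fun x => ‖f x‖ ^ 2)) : MemLp f 2 :=
  (memLp_two_iff_integrable_sq_norm hm).2 h

theorem dd_pow (k : Fin 2) {f : Pt 2 → ℂ} (n : ℕ) {x : Pt 2} (hf : DifferentiableAt ℝ f x) :
    dd k (fun y => f y ^ (n + 1)) x = (n + 1) * f x ^ n * dd k f x := by
  unfold dd
  rw [(hf.hasFDerivAt.pow (n + 1)).fderiv]
  simp

/-- general step: `u = f·v`-type bound -/
theorem lady_pow (n : ℕ) (f : Pt 2 → ℂ) (hd : Differentiable ℝ f) (hf : MemLp f 2)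
    (hn : MemLp (fun x => f x ^ n) 2) (hk : ∀ k, MemLp (dd k f) 2) :
    MemLp (fun x => f x ^ (n + 1)) 2 ∧
    ∫ x, ‖f x ^ (n + 1)‖ ^ 2 ≤ (n + 1) ^ 2 * (∫ x, ‖f x ^ n‖ ^ 2) * (∫ x, ‖dd 0 f x‖ ^ 2 + ‖dd 1 f x‖ ^ 2) := by
  have hdp : Differentiable ℝ (fun x => f x ^ (n + 1)) := hd.pow _
  have e : ∀ k, dd k (fun x => f x ^ (n + 1)) = fun x => (n + 1) * (f x ^ n * dd k f x) := by
    intro k; ext x; rw [dd_pow k n (hd x), mul_assoc]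
  have i : ∀ k, Integrable (fun x => f x ^ n * dd k f x) := fun k => hn.integrable_mul (hk k)
  have i' : ∀ k, Integrable (dd k (fun x => f x ^ (n + 1))) := fun k => by rw [e]; exact (i k).const_mul _
  have iu : Integrable (fun x => f x ^ (n + 1)) := by
    simp only [pow_succ]; exact hn.integrable_mul hf
  obtain ⟨h1, h2⟩ := lady _ hdp iu (i' 0) (i' 1)
  refine ⟨memLp_two_of hdp.continuous.aestronglyMeasurable h1, h2.trans ?_⟩
  have ek : ∀ k, ∫ x, ‖dd k (fun x => f x ^ (n + 1)) x‖ = (n + 1) * ∫ x, ‖f x ^ n‖ * ‖dd k f x‖ := by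
    intro k
    rw [e, ← integral_const_mul]
    congr 1; ext x
    rw [norm_mul, norm_mul]
    congr 1
    have : ((n : ℂ) + 1) = ((n + 1 : ℕ) : ℂ) := by push_cast; rfl
    rw [this, Complex.norm_natCast]; push_cast; rfl
  rw [ek, ek, integral_add (sq_int (hk 0)) (sq_int (hk 1))]
  have c := fun k => cs_int hn.norm (hk k).norm
  simp only [norm_norm] at c
  have hb : ∀ k, 0 ≤ ∫ x, ‖dd k f x‖ ^ 2 := fun k => by positivity
  have ha : 0 ≤ ∫ x, ‖f x ^ n‖ ^ 2 := by positivity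
  have hc : ∀ k, 0 ≤ ∫ x, ‖f x ^ n‖ * ‖dd k f x‖ := fun k => by positivity
  generalize (∫ x, ‖f x ^ n‖ ^ 2) = a at *
  have c0 := c 0
  have c1 := c 1
  have b0 := hb 0
  have b1 := hb 1
  have d0 := hc 0
  have d1 := hc 1
  generalize (∫ x, ‖dd 0 f x‖ ^ 2) = p at *
  generalize (∫ x, ‖dd 1 f x‖ ^ 2) = q at *
  generalize (∫ x, ‖f x ^ n‖ * ‖dd 0 f x‖) = s at *
  generalize (∫ x, ‖f x ^ n‖ * ‖dd 1 f x‖) = t at *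
  have : s * t ≤ a * (p + q) := by nlinarith [sq_nonneg (s - t)]
  calc (n + 1) * s * ((n + 1) * t) = (n + 1) ^ 2 * (s * t) := by ring
    _ ≤ (n + 1) ^ 2 * (a * (p + q)) := by gcongr
    _ = _ := by ring

theorem lady4 (f : Pt 2 → ℂ) (hd : Differentiable ℝ f) (hf : MemLp f 2) (hk : ∀ k, MemLp (dd k f) 2) :
    Integrable (fun x => ‖f x‖ ^ 4) ∧
    ∫ x, ‖f x‖ ^ 4 ≤ 4 * (∫ x, ‖f x‖ ^ 2) * (∫ x, ‖dd 0 f x‖ ^ 2 + ‖dd 1 f x‖ ^ 2) := by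
  obtain ⟨h1, h2⟩ := lady_pow 1 f hd hf (by simpa using hf) hk
  have e : ∀ x, ‖f x ^ (1 + 1)‖ ^ 2 = ‖f x‖ ^ 4 := fun x => by rw [norm_pow, ← pow_mul]
  have := sq_int h1
  simp only [e] at this h2
  refine ⟨this, h2.trans (le_of_eq ?_)⟩
  norm_num

theorem lady6 (f : Pt 2 → ℂ) (hd : Differentiable ℝ f) (hf : MemLp f 2) (hk : ∀ k, MemLp (dd k f) 2) :
    Integrable (fun x => ‖f x‖ ^ 6) ∧
    ∫ x, ‖f x‖ ^ 6 ≤ 9 * (∫ x, ‖f x‖ ^ 4) * (∫ x, ‖dd 0 f x‖ ^ 2 + ‖dd 1 f x‖ ^ 2) := by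
  obtain ⟨h1, h2⟩ := lady_pow 1 f hd hf (by simpa using hf) hk
  obtain ⟨h3, h4⟩ := lady_pow 2 f hd hf h1 hk
  have e : ∀ x, ‖f x ^ (2 + 1)‖ ^ 2 = ‖f x‖ ^ 6 := fun x => by rw [norm_pow, ← pow_mul]
  have e' : ∀ x, ‖f x ^ 2‖ ^ 2 = ‖f x‖ ^ 4 := fun x => by rw [norm_pow, ← pow_mul]
  have := sq_int h3
  simp only [e, e'] at this h4
  refine ⟨this, h4.trans (le_of_eq ?_)⟩
  norm_num
end

section
open scoped ContDiff ENNReal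

/-- Jensen/Cauchy–Schwarz for a probability measure -/
theorem jensen_sq {α : Type*} [MeasurableSpace α] (μ : Measure α) [IsProbabilityMeasure μ] (f : α → ℂ)
    (hf : AEStronglyMeasurable f μ) : ‖∫ x, f x ∂μ‖ₑ ^ 2 ≤ ∫⁻ x, ‖f x‖ₑ ^ 2 ∂μ := by
  have h1 := enorm_integral_le_lintegral_enorm (μ := μ) f
  have h2 := eLpNorm_le_eLpNorm_of_exponent_le (p := 1) (q := 2) (by norm_num) hf
  rw [eLpNorm_one_eq_lintegral_enorm] at h2
  have h3 : eLpNorm f 2 μ ^ 2 = ∫⁻ x, ‖f x‖ₑ ^ 2 ∂μ := by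
    have := eLpNorm_nnreal_pow_eq_lintegral (f := f) (μ := μ) (p := 2) (by norm_num)
    simpa using this
  rw [← h3]
  gcongr
  exact h1.trans h2

theorem one_dim2 (g g' : ℝ → ℂ) (hd : ∀ x, HasDerivAt g (g' x) x) (hm : Measurable g') :
    ‖g 1 - g 0‖ₑ ^ 2 ≤ ∫⁻ t in Set.Ioc (0 : ℝ) 1, ‖g' t‖ₑ ^ 2 := by
  by_cases hfin : ∫⁻ t in Set.Ioc (0 : ℝ) 1, ‖g' t‖ₑ ^ 2 = ⊤
  · rw [hfin]; exact le_top
  have : IsProbabilityMeasure (volume.restrict (Set.Ioc (0 : ℝ) 1)) := ⟨by simp⟩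
  have hmem : MemLp g' 2 (volume.restrict (Set.Ioc (0 : ℝ) 1)) := by
    refine ⟨hm.aestronglyMeasurable, ?_⟩
    have h3 : eLpNorm g' 2 (volume.restrict (Set.Ioc (0 : ℝ) 1)) ^ 2 = ∫⁻ t in Set.Ioc (0 : ℝ) 1, ‖g' t‖ₑ ^ 2 := by
      have := eLpNorm_nnreal_pow_eq_lintegral (f := g') (μ := volume.restrict (Set.Ioc (0 : ℝ) 1)) (p := 2) (by norm_num)
      simpa using this
    rw [← h3] at hfin
    rw [lt_top_iff_ne_top]
    intro h; rw [h] at hfin; simp at hfin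
  have hintg : IntervalIntegrable g' volume 0 1 := by
    rw [intervalIntegrable_iff_integrableOn_Ioc_of_le zero_le_one]
    exact hmem.integrable (by norm_num)
  have h := intervalIntegral.integral_eq_sub_of_hasDerivAt (fun x _ => hd x) hintg
  rw [← h, intervalIntegral.integral_of_le zero_le_one]
  exact jensen_sq _ _ hm.aestronglyMeasurable

def GG (f : Pt 2 → ℂ) (x : Pt 2) : ℝ≥0∞ := ‖dd 0 f x‖ₑ ^ 2 + ‖dd 1 f x‖ₑ ^ 2

theorem dir_bound (f : Pt 2 → ℂ) (x s : Pt 2) : ‖fderiv ℝ f x s‖ₑ ^ 2 ≤ ‖s‖ₑ ^ 2 * GG f x := by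
  have h1 : fderiv ℝ f x s = s 0 * dd 0 f x + s 1 * dd 1 f x := by
    have : s = s 0 • ee 0 + s 1 • ee 1 := by ext i; fin_cases i <;> simp
    conv_lhs => rw [this]
    simp [dd]
  have h2 : ‖fderiv ℝ f x s‖ ^ 2 ≤ ‖s‖ ^ 2 * (‖dd 0 f x‖ ^ 2 + ‖dd 1 f x‖ ^ 2) := by
    have hn : ‖fderiv ℝ f x s‖ ≤ |s 0| * ‖dd 0 f x‖ + |s 1| * ‖dd 1 f x‖ := by
      rw [h1]
      refine (norm_add_le _ _).trans ?_
      simp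
    have hs : ‖s‖ ^ 2 = |s 0| ^ 2 + |s 1| ^ 2 := by
      rw [EuclideanSpace.norm_sq_eq]; simp
    rw [hs]
    calc _ ≤ (|s 0| * ‖dd 0 f x‖ + |s 1| * ‖dd 1 f x‖) ^ 2 := by gcongr
      _ ≤ _ := by nlinarith [sq_nonneg (|s 0| * ‖dd 1 f x‖ - |s 1| * ‖dd 0 f x‖)]
  unfold GG
  have e : ∀ r : ℝ, 0 ≤ r → ENNReal.ofReal r ^ 2 = ENNReal.ofReal (r ^ 2) := fun r hr => (ENNReal.ofReal_pow hr 2).symm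
  simp only [← ofReal_norm, e _ (norm_nonneg _)]
  rw [← ENNReal.ofReal_add (by positivity) (by positivity), ← ENNReal.ofReal_mul (by positivity)]
  exact ENNReal.ofReal_le_ofReal h2

theorem translate_bd (f : Pt 2 → ℂ) (hd : Differentiable ℝ f) (s : Pt 2) :
    ∫⁻ x, ‖f (x + s) - f x‖ₑ ^ 2 ≤ ‖s‖ₑ ^ 2 * ∫⁻ x, GG f x := by
  have hm : Measurable (fun x => fderiv ℝ f x s) := measurable_fderiv_apply_const ℝ f s
  have h1 : ∀ x, ‖f (x + s) - f x‖ₑ ^ 2 ≤ ∫⁻ t in Set.Ioc (0 : ℝ) 1, ‖fderiv ℝ f (x + t • s) s‖ₑ ^ 2 := by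
    intro x
    have := one_dim2 (fun t : ℝ => f (x + t • s)) (fun t => fderiv ℝ f (x + t • s) s) (fun t => by
      have hl : HasDerivAt (fun t : ℝ => x + t • s) s t := by
        simpa using ((hasDerivAt_id t).smul_const s).const_add x
      exact (hd (x + t • s)).hasFDerivAt.comp_hasDerivAt t hl) (hm.comp (by fun_prop))
    simpa using this
  calc _ ≤ ∫⁻ x, ∫⁻ t in Set.Ioc (0 : ℝ) 1, ‖fderiv ℝ f (x + t • s) s‖ₑ ^ 2 := lintegral_mono h1
    _ = ∫⁻ t in Set.Ioc (0 : ℝ) 1, ∫⁻ x, ‖fderiv ℝ f (x + t • s) s‖ₑ ^ 2 := by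
      rw [lintegral_lintegral_swap]
      exact ((hm.comp (g := fun x => fderiv ℝ f x s) (by fun_prop : Measurable (fun p : Pt 2 × ℝ => p.1 + p.2 • s))).enorm.pow_const 2).aemeasurable
    _ = ∫⁻ t in Set.Ioc (0 : ℝ) 1, ∫⁻ x, ‖fderiv ℝ f x s‖ₑ ^ 2 := by
      congr 1; ext t
      exact lintegral_add_right_eq_self (fun x => ‖fderiv ℝ f x s‖ₑ ^ 2) (t • s)
    _ = ∫⁻ x, ‖fderiv ℝ f x s‖ₑ ^ 2 := by simp
    _ ≤ ∫⁻ x, ‖s‖ₑ ^ 2 * GG f x := lintegral_mono fun x => dir_bound f x s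
    _ = _ := lintegral_const_mul' _ _ (by simp)

/-- uniform probability measure on a ball -/
def pb (h : ℝ) : Measure (Pt 2) := ProbabilityTheory.cond volume (Metric.ball (0 : Pt 2) h)

theorem pb_prob {h : ℝ} (hh : 0 < h) : IsProbabilityMeasure (pb h) :=
  ProbabilityTheory.cond_isProbabilityMeasure_of_finite (Metric.measure_ball_pos _ _ hh).ne' measure_ball_lt_top.ne

theorem avg_bound (f : Pt 2 → ℂ) (hd : Differentiable ℝ f) {h : ℝ} (hh : 0 < h) :
    ∫⁻ x, ‖(∫ s, f (x + s) ∂(pb h)) - f x‖ₑ ^ 2 ≤ ENNReal.ofReal h ^ 2 * ∫⁻ x, GG f x := by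
  have := pb_prob hh
  have hc := hd.continuous
  have hintg : ∀ x, Integrable (fun s => f (x + s)) (pb h) := by
    intro x
    have : IntegrableOn (fun s => f (x + s)) (Metric.ball (0 : Pt 2) h) volume :=
      ((by fun_prop : Continuous (fun s => f (x + s))).continuousOn.integrableOn_compact
        (isCompact_closedBall (0 : Pt 2) h)).mono_set Metric.ball_subset_closedBall
    exact this.smul_measure (by simpa using (Metric.measure_ball_pos volume (0 : Pt 2) hh).ne')
  have h1 : ∀ x, ‖(∫ s, f (x + s) ∂(pb h)) - f x‖ₑ ^ 2 ≤ ∫⁻ s, ‖f (x + s) - f x‖ₑ ^ 2 ∂(pb h) := by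
    intro x
    have : (∫ s, f (x + s) ∂(pb h)) - f x = ∫ s, (f (x + s) - f x) ∂(pb h) := by
      rw [integral_sub (hintg x) (integrable_const _)]; simp
    rw [this]
    exact jensen_sq _ _ (by fun_prop : Continuous (fun s => f (x + s) - f x)).aestronglyMeasurable
  calc _ ≤ ∫⁻ x, ∫⁻ s, ‖f (x + s) - f x‖ₑ ^ 2 ∂(pb h) := lintegral_mono h1
    _ = ∫⁻ s, ∫⁻ x, ‖f (x + s) - f x‖ₑ ^ 2 ∂volume ∂(pb h) := by
      rw [lintegral_lintegral_swap]
      exact (by fun_prop : Continuous (fun p : Pt 2 × Pt 2 => f (p.1 + p.2) - f p.1)).measurable.enorm.pow_const 2 |>.aemeasurable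
    _ ≤ ∫⁻ _s : Pt 2, (ENNReal.ofReal h ^ 2 * ∫⁻ x, GG f x ∂volume) ∂(pb h) := by
      apply lintegral_mono_ae
      have : ∀ᵐ s ∂(pb h), s ∈ Metric.ball (0 : Pt 2) h := ProbabilityTheory.ae_cond_mem measurableSet_ball
      filter_upwards [this] with s hs
      refine (translate_bd f hd s).trans ?_
      gcongr
      rw [← ofReal_norm]
      apply ENNReal.ofReal_le_ofReal
      exact (mem_ball_zero_iff.1 hs).le
    _ = _ := by simp
end

section
open scoped ContDiff ENNReal

/-- weak compactness: integrals over balls converge along a subsequence -/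
theorem weak_sub (f : ℕ → Pt 2 → ℂ) (hf : ∀ n, MemLp (f n) 2) (K : ℝ) (hK : ∀ n, ‖(hf n).toLp (f n)‖ ≤ K) :
    ∃ σ : ℕ → ℕ, StrictMono σ ∧ ∀ (s : Set (Pt 2)), MeasurableSet s → volume s ≠ ⊤ →
      ∃ l : ℂ, Filter.Tendsto (fun n => ∫ x in s, f (σ n) x) Filter.atTop (nhds l) := by
  have : Fact ((2 : ℝ≥0∞) ≠ (⊤ : ℝ≥0∞)) := ⟨by norm_num⟩
  let E := Lp ℂ 2 (volume : Measure (Pt 2))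
  let L : ℕ → WeakDual ℂ E := fun n => StrongDual.toWeakDual (InnerProductSpace.toDual ℂ E ((hf n).toLp (f n)))
  have hc := WeakDual.isSeqCompact_closedBall ℂ E 0 K
  obtain ⟨a, ha, σ, hσ, hlim⟩ := hc (x := L) (by
    intro n
    simp only [Set.mem_preimage, Metric.mem_closedBall, dist_zero_right]
    have : ‖InnerProductSpace.toDual ℂ E ((hf n).toLp (f n))‖ ≤ K := by
      rw [LinearIsometryEquiv.norm_map]; exact hK n
    exact this)
  refine ⟨σ, hσ, fun s hs hμ => ?_⟩
  have h1 := (WeakDual.eval_continuous (indicatorConstLp 2 hs hμ (1 : ℂ) : E)).tendsto a |>.comp hlim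
  refine ⟨starRingEnd ℂ (a (indicatorConstLp 2 hs hμ (1 : ℂ) : E)), ?_⟩
  have h2 := (Complex.continuous_conj.tendsto _).comp h1
  refine h2.congr fun n => ?_
  simp only [Function.comp, L]
  change starRingEnd ℂ (inner ℂ ((hf (σ n)).toLp (f (σ n))) (indicatorConstLp 2 hs hμ (1 : ℂ))) = _
  rw [inner_conj_symm, L2.inner_indicatorConstLp_one]
  exact integral_congr_ae (ae_restrict_of_ae (hf (σ n)).coeFn_toLp)

theorem pb_integral (f : Pt 2 → ℂ) (h : ℝ) (x : Pt 2) :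
    ∫ s, f (x + s) ∂(pb h) = ((volume (Metric.ball (0 : Pt 2) h))⁻¹).toReal • ∫ y in Metric.ball x h, f y := by
  unfold pb ProbabilityTheory.cond
  rw [integral_smul_measure]
  congr 1
  have hp : MeasurePreserving (fun s : Pt 2 => x + s) := measurePreserving_add_left volume x
  have he : MeasurableEmbedding (fun s : Pt 2 => x + s) := measurableEmbedding_addLeft x
  have := hp.setIntegral_preimage_emb he f (Metric.ball x h)
  rw [← this]
  congr 2
  ext s; simp [dist_eq_norm]
end

section
open scoped ContDiff ENNReal

theorem enorm_sq_add_le (a b : ℂ) : ‖a + b‖ₑ ^ 2 ≤ 2 * (‖a‖ₑ ^ 2 + ‖b‖ₑ ^ 2) := by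
  have h1 : ‖a + b‖ₑ ^ 2 ≤ (‖a‖ₑ + ‖b‖ₑ) ^ 2 := by gcongr; exact enorm_add_le a b
  refine h1.trans ?_
  simp only [← ofReal_norm, ← ENNReal.ofReal_add (norm_nonneg _) (norm_nonneg _),
    ← ENNReal.ofReal_pow (norm_nonneg _), ← ENNReal.ofReal_pow (add_nonneg (norm_nonneg _) (norm_nonneg _)),
    ← ENNReal.ofReal_add (sq_nonneg _) (sq_nonneg _)]
  rw [show (2 : ℝ≥0∞) = ENNReal.ofReal 2 by simp, ← ENNReal.ofReal_mul (by norm_num)]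
  apply ENNReal.ofReal_le_ofReal
  nlinarith [sq_nonneg (‖a‖ - ‖b‖)]

theorem enorm_sq_sub_le (a b : ℂ) : ‖a - b‖ₑ ^ 2 ≤ 2 * (‖a‖ₑ ^ 2 + ‖b‖ₑ ^ 2) := by
  have := enorm_sq_add_le a (-b)
  simpa [sub_eq_add_neg] using this

theorem avg_conv (f : ℕ → Pt 2 → ℂ) (hd : ∀ n, Differentiable ℝ (f n)) (hf : ∀ n, MemLp (f n) 2)
    (K : ℝ≥0∞) (hK : K ≠ ⊤) (h1 : ∀ n, ∫⁻ x, ‖f n x‖ₑ ^ 2 ≤ K)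
    (hs : ∀ (s : Set (Pt 2)), MeasurableSet s → volume s ≠ ⊤ →
      ∃ l : ℂ, Filter.Tendsto (fun n => ∫ x in s, f n x) Filter.atTop (nhds l)) (h R : ℝ) (hh : 0 < h) :
    ∀ ε : ℝ≥0∞, ε ≠ 0 → ∃ N, ∀ n ≥ N, ∀ m ≥ N,
     ∫⁻ x in Metric.ball (0 : Pt 2) R, ‖(∫ s, f n (x + s) ∂(pb h)) - ∫ s, f m (x + s) ∂(pb h)‖ₑ ^ 2 ≤ ε := by
  intro ε hε
  have hP := pb_prob hh
  set A : ℕ → Pt 2 → ℂ := fun n x => ∫ s, f n (x + s) ∂(pb h) with hA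
  have hAm : ∀ n, StronglyMeasurable (A n) := fun n => by
    have : StronglyMeasurable (fun p : Pt 2 × Pt 2 => f n (p.1 + p.2)) := by
      have := (hd n).continuous
      exact (by fun_prop : Continuous (fun p : Pt 2 × Pt 2 => f n (p.1 + p.2))).stronglyMeasurable
    exact this.integral_prod_right
  have hlim : ∀ x, ∃ l, Filter.Tendsto (fun n => A n x) Filter.atTop (nhds l) := by
    intro x
    obtain ⟨l, hl⟩ := hs (Metric.ball x h) measurableSet_ball measure_ball_lt_top.ne
    refine ⟨((volume (Metric.ball (0 : Pt 2) h))⁻¹).toReal • l, ?_⟩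
    simp only [hA, pb_integral]
    exact hl.const_smul _
  choose a ha using hlim
  have ham : StronglyMeasurable a := stronglyMeasurable_of_tendsto Filter.atTop hAm (tendsto_pi_nhds.2 ha)
  set c := (volume (Metric.ball (0 : Pt 2) h))⁻¹
  have hc : c ≠ ⊤ := by simpa [c] using (Metric.measure_ball_pos volume (0 : Pt 2) hh).ne'
  have hb : ∀ n x, ‖A n x‖ₑ ^ 2 ≤ c * K := by
    intro n x
    refine (jensen_sq _ _ (by have := (hd n).continuous; exact (by fun_prop : Continuous (fun s => f n (x + s))).aestronglyMeasurable)).trans ?_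
    unfold pb ProbabilityTheory.cond
    rw [lintegral_smul_measure]
    simp only [smul_eq_mul]
    gcongr
    refine (setLIntegral_le_lintegral _ _).trans ?_
    rw [lintegral_add_left_eq_self (fun y => ‖f n y‖ₑ ^ 2) x]
    exact h1 n
  have hba : ∀ x, ‖a x‖ₑ ^ 2 ≤ c * K := by
    intro x
    refine le_of_tendsto' (((ENNReal.continuous_pow 2).tendsto _).comp (ha x).enorm) (fun n => hb n x)
  have hdc : Filter.Tendsto (fun n => ∫⁻ x in Metric.ball (0 : Pt 2) R, ‖A n x - a x‖ₑ ^ 2) Filter.atTop (nhds 0) := by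
    have := tendsto_lintegral_of_dominated_convergence (μ := volume.restrict (Metric.ball (0 : Pt 2) R))
      (F := fun n x => ‖A n x - a x‖ₑ ^ 2) (f := fun _ => 0) (fun _ => 2 * (c * K + c * K))
      (fun n => ((hAm n).sub ham).measurable.enorm.pow_const 2)
      (fun n => Filter.Eventually.of_forall fun x => (enorm_sq_sub_le _ _).trans (mul_le_mul_right (add_le_add (hb n x) (hba x)) 2))
      (by
        rw [lintegral_const]
        simp only [Measure.restrict_apply_univ]
        refine ENNReal.mul_ne_top (ENNReal.mul_ne_top (by simp) ?_) measure_ball_lt_top.ne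
        simp [ENNReal.mul_ne_top hc hK])
      (Filter.Eventually.of_forall fun x => by
        have h3 : Filter.Tendsto (fun n => A n x - a x) Filter.atTop (nhds 0) := by
          simpa using (ha x).sub_const (a x)
        have := ((ENNReal.continuous_pow 2).tendsto _).comp h3.enorm
        simpa [Function.comp_def] using this)
    simpa using this
  have hε4 : 0 < ε / 4 := ENNReal.div_pos hε (by norm_num)
  have := (hdc.eventually (ge_mem_nhds hε4))
  obtain ⟨N, hN⟩ := Filter.eventually_atTop.1 this
  refine ⟨N, fun n hn m hm => ?_⟩
  calc _ ≤ ∫⁻ x in Metric.ball (0 : Pt 2) R, 2 * (‖A n x - a x‖ₑ ^ 2 + ‖A m x - a x‖ₑ ^ 2) := by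
        apply lintegral_mono; intro x
        have := enorm_sq_sub_le (A n x - a x) (A m x - a x)
        simpa using this
    _ = 2 * ((∫⁻ x in Metric.ball (0 : Pt 2) R, ‖A n x - a x‖ₑ ^ 2) + ∫⁻ x in Metric.ball (0 : Pt 2) R, ‖A m x - a x‖ₑ ^ 2) := by
        rw [lintegral_const_mul' _ _ (by simp), lintegral_add_left (f := fun x => ‖A n x - a x‖ₑ ^ 2) (((hAm n).measurable.sub ham.measurable).enorm.pow_const 2)]
    _ ≤ 2 * (ε / 4 + ε / 4) := by gcongr; exact hN n hn; exact hN m hm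
    _ ≤ ε := by
      rw [← two_mul, ← mul_assoc]; norm_num
      rw [ENNReal.mul_div_cancel (by norm_num) (by norm_num)]

theorem compactness (f : ℕ → Pt 2 → ℂ) (hd : ∀ n, Differentiable ℝ (f n)) (hf : ∀ n, MemLp (f n) 2)
    (K : ℝ) (h1 : ∀ n, ∫⁻ x, ‖f n x‖ₑ ^ 2 ≤ ENNReal.ofReal K)
    (h2 : ∀ n, ∫⁻ x, GG (f n) x ≤ ENNReal.ofReal K)
    (h3 : ∀ n, ∫⁻ x, ‖x‖ₑ ^ 2 * ‖f n x‖ₑ ^ 2 ≤ ENNReal.ofReal K) :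
    ∃ σ : ℕ → ℕ, StrictMono σ ∧ ∀ ε : ℝ≥0∞, ε ≠ 0 → ∃ N, ∀ n ≥ N, ∀ m ≥ N,
      ∫⁻ x, ‖f (σ n) x - f (σ m) x‖ₑ ^ 2 ≤ ε := by
  obtain ⟨σ, hσ, hs⟩ := weak_sub f hf (ENNReal.ofReal K ^ (1/2 : ℝ)).toReal (by
    intro n
    rw [Lp.norm_toLp]
    apply ENNReal.toReal_mono (by simp)
    rw [eLpNorm_eq_lintegral_rpow_enorm_toReal (by norm_num) (by norm_num)]
    simp only [ENNReal.toReal_ofNat]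
    gcongr
    simpa using h1 n)
  refine ⟨σ, hσ, fun ε hε => ?_⟩
  wlog hεt : ε ≠ ⊤ generalizing ε
  · obtain ⟨N, hN⟩ := this 1 (by simp) (by simp)
    exact ⟨N, fun n hn m hm => (hN n hn m hm).trans (by simp at hεt; simp [hεt])⟩
  obtain ⟨e, he, rfl⟩ : ∃ e : ℝ, 0 < e ∧ ε = ENNReal.ofReal e :=
    ⟨ε.toReal, ENNReal.toReal_pos hε hεt, (ENNReal.ofReal_toReal hεt).symm⟩
  set K' := max K 1 with hK'
  have hK0 : 0 < K' := by positivity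
  have hKK : ENNReal.ofReal K ≤ ENNReal.ofReal K' := ENNReal.ofReal_le_ofReal (le_max_left _ _)
  obtain ⟨h, hh, hhe⟩ : ∃ h : ℝ, 0 < h ∧ 8 * (h ^ 2 * K') ≤ e / 4 := by
    refine ⟨√(e / (32 * K')), by positivity, ?_⟩
    rw [Real.sq_sqrt (by positivity)]; field_simp; norm_num
  obtain ⟨R, hR, hRe⟩ : ∃ R : ℝ, 0 < R ∧ 4 * K' / R ^ 2 ≤ e / 4 := by
    refine ⟨√(16 * K' / e), by positivity, ?_⟩
    rw [Real.sq_sqrt (by positivity)]; field_simp; norm_num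
  obtain ⟨N, hN⟩ := avg_conv (fun n => f (σ n)) (fun n => hd _) (fun n => hf _) _ (by simp : ENNReal.ofReal K ≠ ⊤)
    (fun n => h1 _) hs h R hh (ENNReal.ofReal (e / 4 / 2)) (by simp; positivity)
  refine ⟨N, fun n hn m hm => ?_⟩
  have hN := hN n hn m hm
  have hP := pb_prob hh
  set A : ℕ → Pt 2 → ℂ := fun n x => ∫ s, f (σ n) (x + s) ∂(pb h) with hA
  have hAm : ∀ n, StronglyMeasurable (A n) := fun n => by
    have : StronglyMeasurable (fun p : Pt 2 × Pt 2 => f (σ n) (p.1 + p.2)) := by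
      have := (hd (σ n)).continuous
      exact (by fun_prop : Continuous (fun p : Pt 2 × Pt 2 => f (σ n) (p.1 + p.2))).stronglyMeasurable
    exact this.integral_prod_right
  have hfm : ∀ n, Measurable (f n) := fun n => (hd n).continuous.measurable
  have hav : ∀ n, ∫⁻ x, ‖A n x - f (σ n) x‖ₑ ^ 2 ≤ ENNReal.ofReal (h ^ 2 * K') := fun n => by
    refine (avg_bound _ (hd (σ n)) hh).trans ?_
    rw [ENNReal.ofReal_mul (by positivity), ENNReal.ofReal_pow hh.le]
    gcongr
    exact (h2 _).trans hKK
  rw [← lintegral_add_compl _ (measurableSet_ball : MeasurableSet (Metric.ball (0 : Pt 2) R))]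
  have hin : ∫⁻ x in Metric.ball (0 : Pt 2) R, ‖f (σ n) x - f (σ m) x‖ₑ ^ 2 ≤
      2 * (ENNReal.ofReal (e / 4 / 2) + 2 * (ENNReal.ofReal (h ^ 2 * K') + ENNReal.ofReal (h ^ 2 * K'))) := by
    calc _ ≤ ∫⁻ x in Metric.ball (0 : Pt 2) R, 2 * (‖A n x - A m x‖ₑ ^ 2 + 2 * (‖A n x - f (σ n) x‖ₑ ^ 2 + ‖A m x - f (σ m) x‖ₑ ^ 2)) := by
          apply lintegral_mono; intro x
          have a1 := enorm_sq_sub_le (A n x - A m x) ((A n x - f (σ n) x) - (A m x - f (σ m) x))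
          have a2 := enorm_sq_sub_le (A n x - f (σ n) x) (A m x - f (σ m) x)
          have a3 : (A n x - A m x) - ((A n x - f (σ n) x) - (A m x - f (σ m) x)) = f (σ n) x - f (σ m) x := by ring
          rw [a3] at a1
          exact a1.trans (mul_le_mul_right (add_le_add le_rfl a2) 2)
      _ = 2 * ((∫⁻ x in Metric.ball (0 : Pt 2) R, ‖A n x - A m x‖ₑ ^ 2) + 2 * ((∫⁻ x in Metric.ball (0 : Pt 2) R, ‖A n x - f (σ n) x‖ₑ ^ 2) + ∫⁻ x in Metric.ball (0 : Pt 2) R, ‖A m x - f (σ m) x‖ₑ ^ 2)) := by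
          rw [lintegral_const_mul' _ _ (by simp), lintegral_add_left (f := fun x => ‖A n x - A m x‖ₑ ^ 2) (((hAm n).measurable.sub (hAm m).measurable).enorm.pow_const 2),
            lintegral_const_mul' _ _ (by simp), lintegral_add_left (f := fun x => ‖A n x - f (σ n) x‖ₑ ^ 2) (((hAm n).measurable.sub (hfm _)).enorm.pow_const 2)]
      _ ≤ _ := by
          gcongr
          · exact (setLIntegral_le_lintegral _ _).trans (hav n)
          · exact (setLIntegral_le_lintegral _ _).trans (hav m)
  have hout : ∫⁻ x in (Metric.ball (0 : Pt 2) R)ᶜ, ‖f (σ n) x - f (σ m) x‖ₑ ^ 2 ≤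
      ENNReal.ofReal (2 / R ^ 2) * (ENNReal.ofReal K' + ENNReal.ofReal K') := by
    calc _ ≤ ∫⁻ x in (Metric.ball (0 : Pt 2) R)ᶜ, ENNReal.ofReal (2 / R ^ 2) * (‖x‖ₑ ^ 2 * ‖f (σ n) x‖ₑ ^ 2 + ‖x‖ₑ ^ 2 * ‖f (σ m) x‖ₑ ^ 2) := by
          apply setLIntegral_mono' measurableSet_ball.compl
          intro x hx
          refine (enorm_sq_sub_le _ _).trans ?_
          rw [← mul_add, ← mul_assoc]
          gcongr
          rw [← ofReal_norm, ← ENNReal.ofReal_pow (norm_nonneg _), ← ENNReal.ofReal_mul (by positivity)]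
          refine le_trans (le_of_eq (by simp : (2 : ℝ≥0∞) = ENNReal.ofReal 2)) ?_
          apply ENNReal.ofReal_le_ofReal
          have : R ≤ ‖x‖ := by simpa using hx
          have : R ^ 2 ≤ ‖x‖ ^ 2 := by gcongr
          rw [div_mul_eq_mul_div, le_div_iff₀ (by positivity)]
          linarith
      _ ≤ ∫⁻ x, ENNReal.ofReal (2 / R ^ 2) * (‖x‖ₑ ^ 2 * ‖f (σ n) x‖ₑ ^ 2 + ‖x‖ₑ ^ 2 * ‖f (σ m) x‖ₑ ^ 2) := setLIntegral_le_lintegral _ _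
      _ = ENNReal.ofReal (2 / R ^ 2) * ((∫⁻ x, ‖x‖ₑ ^ 2 * ‖f (σ n) x‖ₑ ^ 2) + ∫⁻ x, ‖x‖ₑ ^ 2 * ‖f (σ m) x‖ₑ ^ 2) := by
          have := hfm (σ n)
          rw [lintegral_const_mul' _ _ (by simp), lintegral_add_left (by fun_prop)]
      _ ≤ _ := by
          gcongr
          · exact (h3 _).trans hKK
          · exact (h3 _).trans hKK
  refine (add_le_add hin hout).trans ?_
  rw [show (2 : ℝ≥0∞) = ENNReal.ofReal 2 by simp]
  have hp : 0 ≤ h ^ 2 * K' := by positivity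
  rw [← ENNReal.ofReal_add hp hp, ← ENNReal.ofReal_mul (by positivity), ← ENNReal.ofReal_add (by positivity) (by positivity),
    ← ENNReal.ofReal_mul (by positivity), ← ENNReal.ofReal_add hK0.le hK0.le, ← ENNReal.ofReal_mul (by positivity), ← ENNReal.ofReal_add (by positivity) (by positivity)]
  apply ENNReal.ofReal_le_ofReal
  have : 2 / R ^ 2 * (K' + K') = 4 * K' / R ^ 2 := by ring
  rw [this]
  linarith
end

section
open scoped ContDiff ENNReal

abbrev Z3 := Fin 3 → ℂ
abbrev W5 := Fin 5 → Fin 3 → ℂ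

/-- Hermitian inner product on `Z3` -/
def ip (a b : Z3) : ℂ := ∑ j, (starRingEnd ℂ) (a j) * b j

theorem ip_add_left (a b c : Z3) : ip (a + b) c = ip a c + ip b c := by
  simp [ip, add_mul, Finset.sum_add_distrib]
theorem ip_add_right (a b c : Z3) : ip a (b + c) = ip a b + ip a c := by
  simp [ip, mul_add, Finset.sum_add_distrib]
theorem ip_smul_left (t : ℝ) (a b : Z3) : ip (t • a) b = t * ip a b := by
  simp [ip, Finset.mul_sum, mul_assoc]
theorem ip_smul_right (t : ℝ) (a b : Z3) : ip a (t • b) = t * ip a b := by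
  simp [ip, Finset.mul_sum, mul_left_comm]
theorem ip_csmul_left (t : ℂ) (a b : Z3) : ip (t • a) b = (starRingEnd ℂ) t * ip a b := by
  simp [ip, Finset.mul_sum, mul_assoc]
theorem ip_csmul_right (t : ℂ) (a b : Z3) : ip a (t • b) = t * ip a b := by
  simp [ip, Finset.mul_sum, mul_left_comm]
theorem ip_conj (a b : Z3) : (starRingEnd ℂ) (ip a b) = ip b a := by
  simp [ip, mul_comm]
theorem ip_self (a : Z3) : ip a a = ((∑ j, ‖a j‖ ^ 2 : ℝ) : ℂ) := by
  simp [ip, conj_mul']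
theorem ip_re_comm (a b : Z3) : (ip a b).re = (ip b a).re := by
  rw [← ip_conj, conj_re]

def nsq (z : Z3) : ℝ := ∑ j, ‖z j‖ ^ 2

theorem ip_self_re (a : Z3) : (ip a a).re = nsq a := by rw [ip_self]; exact ofReal_re _
theorem nsq_nonneg (a : Z3) : 0 ≤ nsq a := by unfold nsq; positivity

theorem nsq_add (a b : Z3) : nsq (a + b) = nsq a + 2 * (ip a b).re + nsq b := by
  rw [← ip_self_re, ← ip_self_re, ← ip_self_re, ip_add_left, ip_add_right, ip_add_right]
  simp only [add_re, ip_re_comm b a]; ring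

theorem nsq_smul (t : ℝ) (a : Z3) : nsq (t • a) = t ^ 2 * nsq a := by
  simp [nsq, Finset.mul_sum, mul_pow]

/-- the Hermitian matrices for `1, Fx, Fy, Fz` (unnormalised) acting on vectors -/
def PP : Fin 4 → Z3 →ₗ[ℂ] Z3 := ![LinearMap.id,
  Matrix.toLin' !![0, 1, 0; 1, 0, 1; 0, 1, 0],
  Matrix.toLin' !![0, -I, 0; I, 0, -I; 0, I, 0],
  Matrix.toLin' !![1, 0, 0; 0, 0, 0; 0, 0, -1]]

def pk (k : Fin 4) (z : Z3) : ℝ := (ip z (PP k z)).re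

def cc (c0 c1 : ℝ) : Fin 4 → ℝ := ![c0 / 2, c1 / 4, c1 / 4, c1 / 2]

def nn (c0 c1 : ℝ) (z : Z3) : ℝ := ∑ k, cc c0 c1 k * (pk k z) ^ 2

theorem PP_symm (k : Fin 4) (a b : Z3) : ip a (PP k b) = ip (PP k a) b := by
  fin_cases k <;> simp [PP, ip, Fin.sum_univ_three, Matrix.vecHead, Matrix.vecTail] <;> ring

theorem pk_add (k : Fin 4) (a b : Z3) : pk k (a + b) = pk k a + 2 * (ip b (PP k a)).re + pk k b := by
  unfold pk
  rw [map_add, ip_add_left, ip_add_right, ip_add_right]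
  have : (ip a (PP k b)).re = (ip b (PP k a)).re := by rw [PP_symm, ip_re_comm]
  simp only [add_re, this]; ring

theorem pk_smul (k : Fin 4) (t : ℝ) (a : Z3) : pk k (t • a) = t ^ 2 * pk k a := by
  unfold pk
  have : PP k (t • a) = t • PP k a := by
    have := (PP k).map_smul (t : ℂ) a
    simpa using this
  rw [this, ip_smul_left, ip_smul_right, ← mul_assoc, ← ofReal_mul, re_ofReal_mul]; ring

theorem nn_smul (c0 c1 t : ℝ) (a : Z3) : nn c0 c1 (t • a) = t ^ 4 * nn c0 c1 a := by
  simp only [nn, pk_smul, Finset.mul_sum]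
  refine Finset.sum_congr rfl fun _ _ => by ring

theorem pk_zero_eq (z : Z3) : pk 0 z = nsq z := by
  rw [← ip_self_re]; rfl

/-- the density is the one in the problem -/
theorem nn_eq (c0 c1 : ℝ) (φ1 φ0 φm1 : Pt 2 → ℂ) (x : Pt 2) :
    nn c0 c1 ![φ1 x, φ0 x, φm1 x] = c0 / 2 * (rho 2 φ1 φ0 φm1 x) ^ 2 + c1 / 2 * Fsq 2 φ1 φ0 φm1 x := by
  simp only [nn, Fin.sum_univ_four, cc, pk_zero_eq, rho, Fsq, nsq, Fin.sum_univ_three]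
  simp [pk, PP, ip, Fin.sum_univ_three, Matrix.vecHead, Matrix.vecTail, ← normSq_eq_norm_sq, normSq_apply]
  ring

theorem Fsq_le (φ1 φ0 φm1 : Pt 2 → ℂ) (x : Pt 2) :
    Fsq 2 φ1 φ0 φm1 x ≤ (rho 2 φ1 φ0 φm1 x) ^ 2 := by
  simp [rho, Fsq, ← normSq_eq_norm_sq, normSq_apply]
  generalize (φ1 x).re = a, (φ1 x).im = a', (φ0 x).re = b, (φ0 x).im = b', (φm1 x).re = c, (φm1 x).im = c'
  -- ρ² - |F|² = |2 φ1 φm1 - φ0²|²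
  nlinarith [sq_nonneg (2 * (a * c - a' * c') - (b * b - b' * b')), sq_nonneg (2 * (a * c' + a' * c) - 2 * b * b')]

def M1 : Z3 →ₗ[ℂ] Z3 := Matrix.toLin' !![0, I, 0; I, 0, I; 0, I, 0]
def M2 : Z3 →ₗ[ℂ] Z3 := Matrix.toLin' !![0, 1, 0; -1, 0, 1; 0, -1, 0]

theorem M1_anti (a b : Z3) : ip a (M1 b) = - ip (M1 a) b := by
  simp [M1, ip, Fin.sum_univ_three, Matrix.vecHead, Matrix.vecTail]; ring
theorem M2_anti (a b : Z3) : ip a (M2 b) = - ip (M2 a) b := by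
  simp [M2, ip, Fin.sum_univ_three, Matrix.vecHead, Matrix.vecTail]; ring

/-- connection terms -/
def W1 (Ω γ : ℝ) (w : W5) : Z3 := (γ : ℂ) • M1 (w 0) + (I * Ω) • w 4
def W2 (Ω γ : ℝ) (w : W5) : Z3 := (γ : ℂ) • M2 (w 0) - (I * Ω) • w 3

theorem W1_add (Ω γ : ℝ) (v w : W5) : W1 Ω γ (v + w) = W1 Ω γ v + W1 Ω γ w := by
  simp only [W1, Pi.add_apply, map_add, smul_add]; abel
theorem W2_add (Ω γ : ℝ) (v w : W5) : W2 Ω γ (v + w) = W2 Ω γ v + W2 Ω γ w := by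
  simp only [W2, Pi.add_apply, map_add, smul_add]; abel
theorem W1_smul (Ω γ : ℝ) (t : ℝ) (w : W5) : W1 Ω γ (t • w) = t • W1 Ω γ w := by
  have h : M1 ((t • w) 0) = (t : ℂ) • M1 (w 0) := by rw [← M1.map_smul]; congr 1
  rw [W1, h, W1]; ext j; simp; ring
theorem W2_smul (Ω γ : ℝ) (t : ℝ) (w : W5) : W2 Ω γ (t • w) = t • W2 Ω γ w := by
  have h : M2 ((t • w) 0) = (t : ℂ) • M2 (w 0) := by rw [← M2.map_smul]; congr 1
  rw [W2, h, W2]; ext j; simp; ring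

/-- Hermitian form of the quadratic part of the energy -/
def sH (Ω γ γx γy : ℝ) (v w : W5) : ℂ :=
  1 / 2 * (ip (v 1) (w 1) + ip (v 2) (w 2))
  + 1 / 2 * (ip (v 1) (W1 Ω γ w) + ip (W1 Ω γ v) (w 1) + ip (v 2) (W2 Ω γ w) + ip (W2 Ω γ v) (w 2))
  + 1 / 2 * (γx ^ 2 * ip (v 3) (w 3) + γy ^ 2 * ip (v 4) (w 4))

def qq (Ω γ γx γy : ℝ) (w : W5) : ℝ := (sH Ω γ γx γy w w).re

theorem sH_conj (Ω γ γx γy : ℝ) (v w : W5) : (starRingEnd ℂ) (sH Ω γ γx γy v w) = sH Ω γ γx γy w v := by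
  simp only [sH, map_add, map_mul, ip_conj, map_div₀, map_one, map_ofNat, map_pow, conj_ofReal]; ring

theorem sH_add_left (Ω γ γx γy : ℝ) (u v w : W5) :
    sH Ω γ γx γy (u + v) w = sH Ω γ γx γy u w + sH Ω γ γx γy v w := by
  simp only [sH, W1_add, W2_add, Pi.add_apply, ip_add_left]; ring
theorem sH_add_right (Ω γ γx γy : ℝ) (u v w : W5) :
    sH Ω γ γx γy u (v + w) = sH Ω γ γx γy u v + sH Ω γ γx γy u w := by
  simp only [sH, W1_add, W2_add, Pi.add_apply, ip_add_right]; ring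
theorem sH_smul_left (Ω γ γx γy : ℝ) (t : ℝ) (v w : W5) :
    sH Ω γ γx γy (t • v) w = t * sH Ω γ γx γy v w := by
  simp only [sH, W1_smul, W2_smul, Pi.smul_apply, ip_smul_left]; ring
theorem sH_smul_right (Ω γ γx γy : ℝ) (t : ℝ) (v w : W5) :
    sH Ω γ γx γy v (t • w) = t * sH Ω γ γx γy v w := by
  simp only [sH, W1_smul, W2_smul, Pi.smul_apply, ip_smul_right]; ring

theorem qq_add (Ω γ γx γy : ℝ) (v w : W5) :
    qq Ω γ γx γy (v + w) = qq Ω γ γx γy v + 2 * (sH Ω γ γx γy w v).re + qq Ω γ γx γy w := by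
  unfold qq
  rw [sH_add_left, sH_add_right, sH_add_right]
  have : (sH Ω γ γx γy v w).re = (sH Ω γ γx γy w v).re := by rw [← sH_conj, conj_re]
  simp only [add_re, this]; ring
theorem qq_smul (Ω γ γx γy t : ℝ) (w : W5) : qq Ω γ γx γy (t • w) = t ^ 2 * qq Ω γ γx γy w := by
  unfold qq
  rw [sH_smul_left, sH_smul_right, ← mul_assoc, ← ofReal_mul, re_ofReal_mul]; ring

/-- completing the square -/
theorem qq_square (Ω γ γx γy : ℝ) (w : W5) :
    qq Ω γ γx γy w = 1 / 2 * (nsq (w 1 + W1 Ω γ w) + nsq (w 2 + W2 Ω γ w))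
      - 1 / 2 * (nsq (W1 Ω γ w) + nsq (W2 Ω γ w)) + 1 / 2 * (γx ^ 2 * nsq (w 3) + γy ^ 2 * nsq (w 4)) := by
  rw [nsq_add, nsq_add]
  simp only [qq, sH, ip_self]
  rw [show (1 / 2 : ℂ) = ((1 / 2 : ℝ) : ℂ) by simp]
  simp only [← ofReal_pow, add_re, re_ofReal_mul, ofReal_re, ip_re_comm (W1 Ω γ w) (w 1), ip_re_comm (W2 Ω γ w) (w 2), nsq]
  ring
end

section
open scoped ContDiff ENNReal

theorem hom_bound {E F : Type*} [NormedAddCommGroup E] [NormedSpace ℝ E] [ProperSpace E]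
    [NormedAddCommGroup F] [NormedSpace ℝ F] (G : E → F) (hc : Continuous G) (p : ℕ)
    (h : ∀ (t : ℝ) z, G (t • z) = t ^ p • G z) : ∃ C : ℝ, 0 ≤ C ∧ ∀ z, ‖G z‖ ≤ C * ‖z‖ ^ p := by
  obtain ⟨C, hC⟩ := (isCompact_closedBall (0 : E) 1).exists_bound_of_continuousOn hc.continuousOn
  have hC0 : 0 ≤ C := (norm_nonneg _).trans (hC 0 (by simp))
  refine ⟨C, hC0, fun z => ?_⟩
  by_cases hz : z = 0
  · subst hz
    rcases Nat.eq_zero_or_pos p with rfl | hp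
    · simpa using hC 0 (by simp)
    · have := h 0 0
      simp [hp.ne'] at this
      simp [this, hp.ne']
  · have h0 : ‖z‖ ≠ 0 := norm_ne_zero_iff.2 hz
    have : z = ‖z‖ • (‖z‖⁻¹ • z) := by rw [smul_smul, mul_inv_cancel₀ h0, one_smul]
    conv_lhs => rw [this, h, norm_smul]
    rw [norm_pow, norm_norm, mul_comm]
    gcongr
    apply hC
    simp [norm_smul, h0]

theorem ip_cont {X : Type*} [TopologicalSpace X] {f g : X → Z3} (hf : Continuous f) (hg : Continuous g) :
    Continuous (fun x => ip (f x) (g x)) := by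
  unfold ip
  refine continuous_finsetSum _ fun j _ => ?_
  exact (continuous_conj.comp ((continuous_apply j).comp hf)).mul ((continuous_apply j).comp hg)

theorem nsq_cont : Continuous nsq := by unfold nsq; fun_prop
theorem M1_cont : Continuous M1 := M1.continuous_of_finiteDimensional
theorem M2_cont : Continuous M2 := M2.continuous_of_finiteDimensional
theorem PP_cont (k : Fin 4) : Continuous (PP k) := (PP k).continuous_of_finiteDimensional
theorem pk_cont (k : Fin 4) : Continuous (pk k) := continuous_re.comp (ip_cont continuous_id (PP_cont k))
theorem nn_cont (c0 c1 : ℝ) : Continuous (nn c0 c1) := by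
  unfold nn; have := pk_cont; fun_prop
theorem ev_cont (k : Fin 5) : Continuous (fun w : W5 => w k) := continuous_apply k
theorem W1_cont (Ω γ : ℝ) : Continuous (W1 Ω γ) := by
  unfold W1
  exact ((M1_cont.comp (ev_cont 0)).const_smul (γ : ℂ)).add ((ev_cont 4).const_smul (I * (Ω : ℂ)))
theorem W2_cont (Ω γ : ℝ) : Continuous (W2 Ω γ) := by
  unfold W2
  exact ((M2_cont.comp (ev_cont 0)).const_smul (γ : ℂ)).sub ((ev_cont 3).const_smul (I * (Ω : ℂ)))
theorem sH_cont (Ω γ γx γy : ℝ) : Continuous (fun p : W5 × W5 => sH Ω γ γx γy p.1 p.2) := by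
  unfold sH
  have h1 := W1_cont Ω γ
  have h2 := W2_cont Ω γ
  have e : ∀ k : Fin 5, Continuous (fun p : W5 × W5 => p.1 k) := fun k => (ev_cont k).comp continuous_fst
  have e' : ∀ k : Fin 5, Continuous (fun p : W5 × W5 => p.2 k) := fun k => (ev_cont k).comp continuous_snd
  have a1 := h1.comp (continuous_fst (X := W5) (Y := W5))
  have a2 := h1.comp (continuous_snd (X := W5) (Y := W5))
  have b1 := h2.comp (continuous_fst (X := W5) (Y := W5))
  have b2 := h2.comp (continuous_snd (X := W5) (Y := W5))
  refine ((continuous_const.mul ((ip_cont (e 1) (e' 1)).add (ip_cont (e 2) (e' 2)))).add (continuous_const.mul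
    ((((ip_cont (e 1) a2).add (ip_cont a1 (e' 1))).add (ip_cont (e 2) b2)).add (ip_cont b1 (e' 2))))).add
    (continuous_const.mul ((continuous_const.mul (ip_cont (e 3) (e' 3))).add (continuous_const.mul (ip_cont (e 4) (e' 4)))))
theorem qq_cont (Ω γ γx γy : ℝ) : Continuous (qq Ω γ γx γy) := by
  have h : Continuous (fun w : W5 => ((w, w) : W5 × W5)) := by fun_prop
  have h2 := (sH_cont Ω γ γx γy).comp h
  exact continuous_re.comp h2

/-- the jet of a triple -/
def jet (Φ : Fin 3 → Pt 2 → ℂ) (x : Pt 2) : W5 :=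
  ![fun j => Φ j x, fun j => dd 0 (Φ j) x, fun j => dd 1 (Φ j) x,
    fun j => (x 0 : ℂ) * Φ j x, fun j => (x 1 : ℂ) * Φ j x]

def Cl (Φ : Fin 3 → Pt 2 → ℂ) : Prop := (∀ j, Differentiable ℝ (Φ j)) ∧ MemLp (jet Φ) 2

def vv (Φ : Fin 3 → Pt 2 → ℂ) (x : Pt 2) : Z3 := fun j => Φ j x

@[simp] theorem jet0 (Φ : Fin 3 → Pt 2 → ℂ) (x : Pt 2) : jet Φ x 0 = vv Φ x := rfl

theorem memLp_W5 {Ψ : Pt 2 → W5} {p : ℝ≥0∞} : MemLp Ψ p ↔ ∀ k j, MemLp (fun x => Ψ x k j) p := by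
  rw [memLp_pi_iff]
  refine forall_congr' fun k => ?_
  rw [memLp_pi_iff]

theorem Cl.memLp {Φ : Fin 3 → Pt 2 → ℂ} (h : Cl Φ) (j : Fin 3) : MemLp (Φ j) 2 := memLp_W5.1 h.2 0 j
theorem Cl.memLp_dd {Φ : Fin 3 → Pt 2 → ℂ} (h : Cl Φ) (j : Fin 3) (k : Fin 2) : MemLp (dd k (Φ j)) 2 := by
  fin_cases k
  · exact memLp_W5.1 h.2 1 j
  · exact memLp_W5.1 h.2 2 j
theorem Cl.memLp_x {Φ : Fin 3 → Pt 2 → ℂ} (h : Cl Φ) (j : Fin 3) (k : Fin 2) : MemLp (fun x => (x k : ℂ) * Φ j x) 2 := by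
  fin_cases k
  · exact memLp_W5.1 h.2 3 j
  · exact memLp_W5.1 h.2 4 j

theorem Cl.mk' {Φ : Fin 3 → Pt 2 → ℂ} (h : ∀ j, Differentiable ℝ (Φ j)) (h1 : ∀ j, MemLp (Φ j) 2)
    (h2 : ∀ j k, MemLp (dd k (Φ j)) 2) (h3 : ∀ j (k : Fin 2), MemLp (fun x => (x k : ℂ) * Φ j x) 2) : Cl Φ := by
  refine ⟨h, memLp_W5.2 fun k j => ?_⟩
  fin_cases k
  · exact h1 j
  · exact h2 j 0
  · exact h2 j 1
  · exact h3 j 0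
  · exact h3 j 1

theorem jet_add {Φ Ψ : Fin 3 → Pt 2 → ℂ} (h : ∀ j, Differentiable ℝ (Φ j)) (h' : ∀ j, Differentiable ℝ (Ψ j)) :
    jet (fun j x => Φ j x + Ψ j x) = fun x => jet Φ x + jet Ψ x := by
  ext x k j
  fin_cases k
  · rfl
  · exact dd_add 0 (h j x) (h' j x)
  · exact dd_add 1 (h j x) (h' j x)
  · exact mul_add _ _ _
  · exact mul_add _ _ _

theorem dd_smul (k : Fin 2) (t : ℝ) (f : Pt 2 → ℂ) (x : Pt 2) : dd k (fun y => (t : ℂ) * f y) x = t * dd k f x := by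
  unfold dd
  have e : (fun y => (t : ℂ) * f y) = t • f := by ext y; simp
  rw [e, fderiv_const_smul_field]; simp

theorem jet_smul (t : ℝ) (Φ : Fin 3 → Pt 2 → ℂ) :
    jet (fun j x => (t : ℂ) * Φ j x) = fun x => t • jet Φ x := by
  ext x k j
  fin_cases k
  · simp [jet]
  · simp [jet, dd_smul]
  · simp [jet, dd_smul]
  · simp [jet]; ring
  · simp [jet]; ring

theorem Cl.add {Φ Ψ : Fin 3 → Pt 2 → ℂ} (h : Cl Φ) (h' : Cl Ψ) : Cl (fun j x => Φ j x + Ψ j x) := by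
  refine ⟨fun j => (h.1 j).add (h'.1 j), ?_⟩
  rw [jet_add h.1 h'.1]
  exact h.2.add h'.2

theorem Cl.smul {Φ : Fin 3 → Pt 2 → ℂ} (h : Cl Φ) (t : ℝ) : Cl (fun j x => (t : ℂ) * Φ j x) := by
  refine ⟨fun j => (h.1 j).const_mul _, ?_⟩
  rw [jet_smul]
  exact h.2.const_smul t

theorem int_hom {E : Type*} [NormedAddCommGroup E] [NormedSpace ℝ E] [ProperSpace E]
    {F : Type*} [NormedAddCommGroup F] [NormedSpace ℝ F] [SecondCountableTopology F] {Ψ : Pt 2 → E} (p : ℕ) (hp : p ≠ 0) (hΨ : MemLp Ψ p) (G : E → F) (hc : Continuous G)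
    (h : ∀ (t : ℝ) z, G (t • z) = t ^ p • G z) : Integrable (fun x => G (Ψ x)) := by
  obtain ⟨C, hC0, hC⟩ := hom_bound G hc p h
  refine ((hΨ.integrable_norm_pow hp).const_mul C).mono' (hc.comp_aestronglyMeasurable hΨ.1) ?_
  filter_upwards with x using hC _

theorem Cl.memLp4 {Φ : Fin 3 → Pt 2 → ℂ} (h : Cl Φ) : MemLp (vv Φ) 4 := by
  rw [memLp_pi_iff]
  intro j
  have := (lady4 (Φ j) (h.1 j) (h.memLp j) (h.memLp_dd j)).1
  have h4 := (integrable_norm_rpow_iff (p := 4) (h.memLp j).1 (by norm_num) (by norm_num)).1 (by simpa using this)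
  exact h4

theorem Cl.memLp6 {Φ : Fin 3 → Pt 2 → ℂ} (h : Cl Φ) : MemLp (vv Φ) 6 := by
  rw [memLp_pi_iff]
  intro j
  have := (lady6 (Φ j) (h.1 j) (h.memLp j) (h.memLp_dd j)).1
  have h4 := (integrable_norm_rpow_iff (p := 6) (h.memLp j).1 (by norm_num) (by norm_num)).1 (by simpa using this)
  exact h4

theorem Cl.memLp2 {Φ : Fin 3 → Pt 2 → ℂ} (h : Cl Φ) : MemLp (vv Φ) 2 := by
  rw [memLp_pi_iff]; exact h.memLp
end

section
open scoped ContDiff ENNReal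

def G2 (w : W5) : ℝ := nsq (w 1) + nsq (w 2)
def G3 (γx γy : ℝ) (w : W5) : ℝ := 1 / 2 * (γx ^ 2 * nsq (w 3) + γy ^ 2 * nsq (w 4))
def G4 (w : W5) : ℝ := (-I * ip (w 3) (w 2) + I * ip (w 4) (w 1)).re
def G5 (w : W5) : ℝ := (ip (w 0) (M1 (w 1) + M2 (w 2))).re

theorem nsq_ev_cont (k : Fin 5) : Continuous (fun w : W5 => nsq (w k)) := nsq_cont.comp (ev_cont k)
theorem G2_cont : Continuous G2 := (nsq_ev_cont 1).add (nsq_ev_cont 2)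
theorem G3_cont (γx γy : ℝ) : Continuous (G3 γx γy) := by
  have := nsq_ev_cont 3
  have := nsq_ev_cont 4
  unfold G3; fun_prop
theorem G4_cont : Continuous G4 :=
  continuous_re.comp ((continuous_const.mul (ip_cont (ev_cont 3) (ev_cont 2))).add (continuous_const.mul (ip_cont (ev_cont 4) (ev_cont 1))))
theorem G5_cont : Continuous G5 :=
  continuous_re.comp (ip_cont (ev_cont 0) ((M1_cont.comp (ev_cont 1)).add (M2_cont.comp (ev_cont 2))))

theorem M1_rsmul (t : ℝ) (z : Z3) : M1 (t • z) = t • M1 z := by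
  simp
theorem M2_rsmul (t : ℝ) (z : Z3) : M2 (t • z) = t • M2 z := by
  simp

theorem G2_smul (t : ℝ) (w : W5) : G2 (t • w) = t ^ 2 • G2 w := by
  simp only [G2, Pi.smul_apply, nsq_smul, smul_eq_mul]; ring
theorem G3_smul (γx γy t : ℝ) (w : W5) : G3 γx γy (t • w) = t ^ 2 • G3 γx γy w := by
  simp only [G3, Pi.smul_apply, nsq_smul, smul_eq_mul]; ring
theorem G4_smul (t : ℝ) (w : W5) : G4 (t • w) = t ^ 2 • G4 w := by
  simp only [G4, Pi.smul_apply, ip_smul_left, ip_smul_right, smul_eq_mul]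
  rw [← re_ofReal_mul]; congr 1; push_cast; ring
theorem G5_smul (t : ℝ) (w : W5) : G5 (t • w) = t ^ 2 • G5 w := by
  simp only [G5, Pi.smul_apply, M1_rsmul, M2_rsmul, ← smul_add, ip_smul_left, ip_smul_right, smul_eq_mul]
  rw [← re_ofReal_mul]; congr 1; push_cast; ring

theorem qq_eq (Ω γ γx γy : ℝ) (w : W5) :
    qq Ω γ γx γy w = 1 / 2 * G2 w + G3 γx γy w - Ω * G4 w - γ * G5 w := by
  have e1 : (ip (w 1) (W1 Ω γ w)).re = γ * (ip (M1 (w 0)) (w 1)).re + Ω * (I * ip (w 1) (w 4)).re := by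
    rw [W1, ip_add_right, ip_csmul_right, ip_csmul_right, add_re, re_ofReal_mul, ip_re_comm]
    rw [show I * (Ω : ℂ) * ip (w 1) (w 4) = (Ω : ℂ) * (I * ip (w 1) (w 4)) by ring, re_ofReal_mul]
  have e2 : (ip (w 2) (W2 Ω γ w)).re = γ * (ip (M2 (w 0)) (w 2)).re - Ω * (I * ip (w 2) (w 3)).re := by
    rw [W2, sub_eq_add_neg, ip_add_right, ← neg_smul, ip_csmul_right, ip_csmul_right, add_re, re_ofReal_mul, ip_re_comm]
    rw [show -(I * (Ω : ℂ)) * ip (w 2) (w 3) = -((Ω : ℂ) * (I * ip (w 2) (w 3))) by ring, neg_re, re_ofReal_mul]; ring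
  have e3 : (ip (w 0) (M1 (w 1))).re = - (ip (M1 (w 0)) (w 1)).re := by rw [M1_anti, neg_re]
  have e4 : (ip (w 0) (M2 (w 2))).re = - (ip (M2 (w 0)) (w 2)).re := by rw [M2_anti, neg_re]
  have e5 : (I * ip (w 4) (w 1)).re = - (I * ip (w 1) (w 4)).re := by
    rw [← ip_conj (w 1) (w 4)]; simp
  have e6 : (-I * ip (w 3) (w 2)).re = (I * ip (w 2) (w 3)).re := by
    rw [← ip_conj (w 2) (w 3)]; simp
  rw [qq_square, nsq_add, nsq_add]
  simp only [G2, G3, G4, G5, ip_add_right, add_re, e1, e2, e3, e4, e5, e6]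
  ring

def mass (Ψ : Pt 2 → Z3) : ℝ := ∫ x, nsq (Ψ x)

theorem pd0 (f : Pt 2 → ℂ) (x : Pt 2) : pdC 2 f 0 x = dd 0 f x := by
  simp [pdC, dd, ee]
theorem pd1 (f : Pt 2 → ℂ) (x : Pt 2) : pdC 2 f 1 x = dd 1 f x := by
  simp [pdC, dd, ee]

theorem grad_eq (f : Pt 2 → ℂ) (x : Pt 2) : gradsq 2 f x = ‖dd 0 f x‖ ^ 2 + ‖dd 1 f x‖ ^ 2 := by
  simp [gradsq, Fin.sum_univ_two, pd0, pd1]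

theorem e_rho (φ1 φ0 φm1 : Pt 2 → ℂ) (x : Pt 2) : rho 2 φ1 φ0 φm1 x = nsq (vv ![φ1, φ0, φm1] x) := by
  simp [rho, nsq, vv, Fin.sum_univ_three]
theorem e_vv (φ1 φ0 φm1 : Pt 2 → ℂ) (x : Pt 2) : vv ![φ1, φ0, φm1] x = ![φ1 x, φ0 x, φm1 x] := by
  ext j; fin_cases j <;> rfl
theorem e_G2 (φ1 φ0 φm1 : Pt 2 → ℂ) (x : Pt 2) :
    gradsq 2 φ1 x + gradsq 2 φ0 x + gradsq 2 φm1 x = G2 (jet ![φ1, φ0, φm1] x) := by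
  simp [grad_eq, G2, nsq, jet, Fin.sum_univ_three]; ring
theorem e_G3 (γx γy : ℝ) (V : Pt 2 → ℝ) (hV : ∀ x : Pt 2, V x = 1 / 2 * (γx ^ 2 * (x 0) ^ 2 + γy ^ 2 * (x 1) ^ 2))
    (φ1 φ0 φm1 : Pt 2 → ℂ) (x : Pt 2) :
    V x * rho 2 φ1 φ0 φm1 x = G3 γx γy (jet ![φ1, φ0, φm1] x) := by
  simp [hV, rho, G3, nsq, jet, Fin.sum_univ_three, mul_pow]; ring
theorem e_G4 (φ1 φ0 φm1 : Pt 2 → ℂ) (x : Pt 2) :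
    rotDen 2 φ1 x + rotDen 2 φ0 x + rotDen 2 φm1 x = G4 (jet ![φ1, φ0, φm1] x) := by
  simp only [rotDen, Lzop, ← add_re, G4, ip, Fin.sum_univ_three, jet, pd0, pd1]
  congr 1
  simp [nthC]; ring
theorem e_G5 (φ1 φ0 φm1 : Pt 2 → ℂ) (x : Pt 2) :
    socDen 2 φ1 φ0 φm1 x = G5 (jet ![φ1, φ0, φm1] x) := by
  simp only [socDen, L0op, L1op, G5, ip, Fin.sum_univ_three, jet, pd0, pd1]
  congr 1
  simp [M1, M2, Matrix.vecHead, Matrix.vecTail]; ring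

theorem Cl.i2 {Φ : Fin 3 → Pt 2 → ℂ} (h : Cl Φ) {G : W5 → ℝ} (hc : Continuous G) (hs : ∀ (t : ℝ) w, G (t • w) = t ^ 2 • G w) :
    Integrable (fun x => G (jet Φ x)) := int_hom 2 (by norm_num) (by exact_mod_cast h.2) G hc hs

theorem Cl.mass_int {Φ : Fin 3 → Pt 2 → ℂ} (h : Cl Φ) : Integrable (fun x => nsq (vv Φ x)) :=
  int_hom 2 (by norm_num) (by exact_mod_cast h.memLp2) nsq nsq_cont (fun t z => by simp [nsq_smul])

theorem Cl.i4 {Φ : Fin 3 → Pt 2 → ℂ} (h : Cl Φ) {G : Z3 → ℝ} (hc : Continuous G) (hs : ∀ (t : ℝ) w, G (t • w) = t ^ 4 • G w) :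
    Integrable (fun x => G (vv Φ x)) := int_hom 4 (by norm_num) (by exact_mod_cast h.memLp4) G hc hs

theorem InM_of_Cl (γx γy : ℝ) (V : Pt 2 → ℝ) (hV : ∀ x : Pt 2, V x = 1 / 2 * (γx ^ 2 * (x 0) ^ 2 + γy ^ 2 * (x 1) ^ 2))
    (φ1 φ0 φm1 : Pt 2 → ℂ) (h : Cl ![φ1, φ0, φm1]) (hm : mass (vv ![φ1, φ0, φm1]) = 1) : InM 2 V φ1 φ0 φm1 := by
  refine ⟨h.1 0, h.1 1, h.1 2, ?_, ?_, ?_, ?_, ?_, ?_, ?_, ?_⟩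
  · simp only [e_rho]; exact h.mass_int
  · simp only [e_G2]; exact h.i2 G2_cont G2_smul
  · simp only [e_G3 γx γy V hV]; exact h.i2 (G3_cont _ _) (G3_smul _ _)
  · simp only [e_rho]
    exact h.i4 (G := fun z => nsq z ^ 2) (nsq_cont.pow 2) (fun t z => by simp only [nsq_smul, smul_eq_mul]; ring)
  · have : ∀ x, Fsq 2 φ1 φ0 φm1 x = nn 0 2 (vv ![φ1, φ0, φm1] x) := fun x => by rw [e_vv, nn_eq]; ring
    simp only [this]
    exact h.i4 (nn_cont 0 2) (fun t z => by simp only [nn_smul, smul_eq_mul])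
  · simp only [e_G4]; exact h.i2 G4_cont G4_smul
  · simp only [e_G5]; exact h.i2 G5_cont G5_smul
  · simp only [e_rho]; exact hm

theorem Etot_eq (c0 c1 Ω γ γx γy : ℝ) (V : Pt 2 → ℝ) (hV : ∀ x : Pt 2, V x = 1 / 2 * (γx ^ 2 * (x 0) ^ 2 + γy ^ 2 * (x 1) ^ 2))
    (φ1 φ0 φm1 : Pt 2 → ℂ) (h : Cl ![φ1, φ0, φm1]) : Etot 2 V c0 c1 Ω γ φ1 φ0 φm1 =
    (∫ x, qq Ω γ γx γy (jet ![φ1, φ0, φm1] x)) + ∫ x, nn c0 c1 (vv ![φ1, φ0, φm1] x) := by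
  have i2 := h.i2 G2_cont G2_smul
  have i3 := h.i2 (G3_cont γx γy) (G3_smul γx γy)
  have i4 := h.i2 G4_cont G4_smul
  have i5 := h.i2 G5_cont G5_smul
  simp only [Etot, Ekin, Epot, Espin, Erot, Esoc, e_G2, e_G3 γx γy V hV, e_G4, e_G5, qq_eq, e_vv, nn_eq]
  have j1 : Integrable (fun x => 1 / 2 * G2 (jet ![φ1, φ0, φm1] x) + G3 γx γy (jet ![φ1, φ0, φm1] x)) := (i2.const_mul _).add i3
  have j2 : Integrable (fun x => 1 / 2 * G2 (jet ![φ1, φ0, φm1] x) + G3 γx γy (jet ![φ1, φ0, φm1] x) - Ω * G4 (jet ![φ1, φ0, φm1] x)) := j1.sub (i4.const_mul _)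
  rw [integral_sub j2 (i5.const_mul _), integral_sub j1 (i4.const_mul _), integral_add (i2.const_mul _) i3]
  simp only [integral_const_mul]
  ring

theorem dd_meas (k : Fin 2) (f : Pt 2 → ℂ) : Measurable (dd k f) := measurable_fderiv_apply_const ℝ f (ee k)

theorem Cl_of_InM (γx γy : ℝ) (hγx : 0 < γx) (hγy : 0 < γy) (V : Pt 2 → ℝ) (hV : ∀ x : Pt 2, V x = 1 / 2 * (γx ^ 2 * (x 0) ^ 2 + γy ^ 2 * (x 1) ^ 2))
    (φ1 φ0 φm1 : Pt 2 → ℂ) (h : InM 2 V φ1 φ0 φm1) : Cl ![φ1, φ0, φm1] ∧ mass (vv ![φ1, φ0, φm1]) = 1 := by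
  obtain ⟨d1, d0, dm, i1, i2, i3, -, -, -, -, hm⟩ := h
  simp only [e_rho] at hm i1
  simp only [e_G2] at i2
  simp only [e_G3 γx γy V hV] at i3
  have hd : ∀ j, Differentiable ℝ ((![φ1, φ0, φm1] : Fin 3 → Pt 2 → ℂ) j) := by
    intro j; fin_cases j; exacts [d1, d0, dm]
  refine ⟨?_, hm⟩
  generalize (![φ1, φ0, φm1] : Fin 3 → Pt 2 → ℂ) = Φ at *
  have key : ∀ (w : Z3) j, ‖w j‖ ^ 2 ≤ nsq w := fun w j =>
    Finset.single_le_sum (f := fun j => ‖w j‖ ^ 2) (fun i _ => by positivity) (Finset.mem_univ j)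
  refine Cl.mk' hd (fun j => ?_) (fun j k => ?_) (fun j k => ?_)
  · have hmeas : AEStronglyMeasurable (Φ j) := (hd j).continuous.aestronglyMeasurable
    refine memLp_two_of hmeas (i1.mono' (hmeas.norm.pow 2) ?_)
    filter_upwards with x
    rw [Real.norm_of_nonneg (by positivity)]
    exact key (vv Φ x) j
  · have hmeas : AEStronglyMeasurable (dd k (Φ j)) := (dd_meas k _).aestronglyMeasurable
    refine memLp_two_of hmeas (i2.mono' (hmeas.norm.pow 2) ?_)
    filter_upwards with x
    rw [Real.norm_of_nonneg (by positivity)]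
    have h1 := key (jet Φ x 1) j
    have h2 := key (jet Φ x 2) j
    have n1 := nsq_nonneg (jet Φ x 1)
    have n2 := nsq_nonneg (jet Φ x 2)
    unfold G2
    fin_cases k
    · exact h1.trans (by linarith)
    · exact h2.trans (by linarith)
  · have hmeas : AEStronglyMeasurable (fun x : Pt 2 => (x k : ℂ) * Φ j x) := by
      have := (hd j).continuous
      exact (by fun_prop : Continuous (fun x : Pt 2 => (x k : ℂ) * Φ j x)).aestronglyMeasurable
    refine memLp_two_of hmeas ((i3.const_mul (2 / γx ^ 2 + 2 / γy ^ 2)).mono' (hmeas.norm.pow 2) ?_)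
    filter_upwards with x
    rw [Real.norm_of_nonneg (by positivity)]
    have h1 := key (jet Φ x 3) j
    have h2 := key (jet Φ x 4) j
    have n1 := nsq_nonneg (jet Φ x 3)
    have n2 := nsq_nonneg (jet Φ x 4)
    unfold G3
    have e : (2 / γx ^ 2 + 2 / γy ^ 2) * (1 / 2 * (γx ^ 2 * nsq (jet Φ x 3) + γy ^ 2 * nsq (jet Φ x 4)))
      = nsq (jet Φ x 3) + nsq (jet Φ x 4) + γy ^ 2 / γx ^ 2 * nsq (jet Φ x 4) + γx ^ 2 / γy ^ 2 * nsq (jet Φ x 3) := by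
      field_simp; ring
    rw [e]
    have p1 : 0 ≤ γy ^ 2 / γx ^ 2 * nsq (jet Φ x 4) := by positivity
    have p2 : 0 ≤ γx ^ 2 / γy ^ 2 * nsq (jet Φ x 3) := by positivity
    fin_cases k
    · exact h1.trans (by linarith)
    · exact h2.trans (by linarith)
end

section
open scoped ContDiff ENNReal

theorem nsq_csmul (t : ℂ) (a : Z3) : nsq (t • a) = ‖t‖ ^ 2 * nsq a := by
  simp [nsq, Finset.mul_sum, mul_pow]

theorem nsq_M1 (z : Z3) : nsq (M1 z) ≤ 2 * nsq z := by
  simp [nsq, M1, Fin.sum_univ_three, Matrix.vecHead, Matrix.vecTail, ← normSq_eq_norm_sq, normSq_apply]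
  nlinarith [sq_nonneg ((z 0).re - (z 2).re), sq_nonneg ((z 0).im - (z 2).im)]
theorem nsq_M2 (z : Z3) : nsq (M2 z) ≤ 2 * nsq z := by
  simp [nsq, M2, Fin.sum_univ_three, Matrix.vecHead, Matrix.vecTail, ← normSq_eq_norm_sq, normSq_apply]
  nlinarith [sq_nonneg ((z 0).re + (z 2).re), sq_nonneg ((z 0).im + (z 2).im)]

theorem nsq_sub (a b : Z3) : nsq (a - b) = nsq a - 2 * (ip a b).re + nsq b := by
  have := nsq_add a ((-1 : ℝ) • b)
  rw [nsq_smul, ip_smul_right, re_ofReal_mul] at this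
  rw [sub_eq_add_neg, show -b = (-1 : ℝ) • b by simp, this]; ring

theorem nsq_add_le (e : ℝ) (he : 0 < e) (a b : Z3) : nsq (a + b) ≤ (1 + 1 / e) * nsq a + (1 + e) * nsq b := by
  have h1 := nsq_nonneg (a - e • b)
  rw [nsq_sub, ip_smul_right, nsq_smul, re_ofReal_mul] at h1
  rw [nsq_add]
  have : 2 * (ip a b).re ≤ 1 / e * nsq a + e * nsq b := by
    rw [← sub_nonneg]
    have : 1 / e * nsq a + e * nsq b - 2 * (ip a b).re = (1 / e) * (nsq a - 2 * (e * (ip a b).re) + e ^ 2 * nsq b) := by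
      field_simp
      try ring
    rw [this]; positivity
  linarith

theorem nsq_W1 (Ω γ e : ℝ) (he : 0 < e) (w : W5) :
    nsq (W1 Ω γ w) ≤ (1 + 1 / e) * (2 * γ ^ 2) * nsq (w 0) + (1 + e) * Ω ^ 2 * nsq (w 4) := by
  have h := nsq_add_le e he ((γ : ℂ) • M1 (w 0)) ((I * Ω) • w 4)
  rw [nsq_csmul, nsq_csmul] at h
  simp only [norm_mul, norm_I, one_mul, norm_real, Real.norm_eq_abs, sq_abs] at h
  refine h.trans ?_
  have := nsq_M1 (w 0)
  have : (1 + 1 / e) * (γ ^ 2 * nsq (M1 (w 0))) ≤ (1 + 1 / e) * (γ ^ 2 * (2 * nsq (w 0))) := by gcongr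
  linarith

theorem nsq_W2 (Ω γ e : ℝ) (he : 0 < e) (w : W5) :
    nsq (W2 Ω γ w) ≤ (1 + 1 / e) * (2 * γ ^ 2) * nsq (w 0) + (1 + e) * Ω ^ 2 * nsq (w 3) := by
  have h := nsq_add_le e he ((γ : ℂ) • M2 (w 0)) ((-(I * Ω)) • w 3)
  rw [nsq_csmul, nsq_csmul] at h
  simp only [norm_mul, norm_I, one_mul, norm_real, Real.norm_eq_abs, sq_abs, norm_neg] at h
  rw [W2, sub_eq_add_neg, ← neg_smul]
  refine h.trans ?_
  have := nsq_M2 (w 0)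
  have : (1 + 1 / e) * (γ ^ 2 * nsq (M2 (w 0))) ≤ (1 + 1 / e) * (γ ^ 2 * (2 * nsq (w 0))) := by gcongr
  linarith

/-- covariant gradient squared -/
def DD (Ω γ : ℝ) (w : W5) : ℝ := nsq (w 1 + W1 Ω γ w) + nsq (w 2 + W2 Ω γ w)

theorem qq_lower (Ω γ γx γy : ℝ) (hγx : 0 < γx) (hγy : 0 < γy) (hΩ : |Ω| < min γx γy) :
    ∃ δ C : ℝ, 0 < δ ∧ 0 ≤ C ∧ ∀ w, 1 / 2 * DD Ω γ w + δ * (nsq (w 3) + nsq (w 4)) - C * nsq (w 0) ≤ qq Ω γ γx γy w := by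
  have hx : Ω ^ 2 < γx ^ 2 := by
    rw [← sq_abs Ω]; have := lt_of_lt_of_le hΩ (min_le_left _ _); gcongr
  have hy : Ω ^ 2 < γy ^ 2 := by
    rw [← sq_abs Ω]; have := lt_of_lt_of_le hΩ (min_le_right _ _); gcongr
  obtain ⟨s, hs0, hsx, hsy⟩ : ∃ s : ℝ, 0 < s ∧ Ω ^ 2 + 2 * s ≤ γx ^ 2 ∧ Ω ^ 2 + 2 * s ≤ γy ^ 2 := by
    have hpos : 0 < min (γx ^ 2 - Ω ^ 2) (γy ^ 2 - Ω ^ 2) := lt_min (by linarith) (by linarith)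
    refine ⟨min (γx ^ 2 - Ω ^ 2) (γy ^ 2 - Ω ^ 2) / 2, half_pos hpos, ?_, ?_⟩
    · have := min_le_left (γx ^ 2 - Ω ^ 2) (γy ^ 2 - Ω ^ 2); linarith
    · have := min_le_right (γx ^ 2 - Ω ^ 2) (γy ^ 2 - Ω ^ 2); linarith
  set e := s / (Ω ^ 2 + 1) with he
  have he0 : 0 < e := by positivity
  have hes : e * Ω ^ 2 ≤ s := by
    rw [he, div_mul_eq_mul_div, div_le_iff₀ (by positivity)]; nlinarith
  refine ⟨s / 2, (1 + 1 / e) * (2 * γ ^ 2), by positivity, by positivity, fun w => ?_⟩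
  rw [qq_square, DD]
  have h1 := nsq_W1 Ω γ e he0 w
  have h2 := nsq_W2 Ω γ e he0 w
  have n3 := nsq_nonneg (w 3)
  have n4 := nsq_nonneg (w 4)
  have a3 : (1 + e) * Ω ^ 2 * nsq (w 3) ≤ (γx ^ 2 - s) * nsq (w 3) := by gcongr; linarith
  have a4 : (1 + e) * Ω ^ 2 * nsq (w 4) ≤ (γy ^ 2 - s) * nsq (w 4) := by gcongr; linarith
  linarith

def tot (w : W5) : ℝ := ∑ k, nsq (w k)

theorem tot_eq (w : W5) : tot w = nsq (w 0) + nsq (w 1) + nsq (w 2) + nsq (w 3) + nsq (w 4) := by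
  simp [tot, Fin.sum_univ_five]

theorem DD_lower (Ω γ κ δ : ℝ) (hκ : 0 < κ) (hδ : 0 < δ) :
    ∃ c C : ℝ, 0 < c ∧ 0 ≤ C ∧ ∀ w, c * tot w - C * nsq (w 0) ≤ κ * DD Ω γ w + δ * (nsq (w 3) + nsq (w 4)) := by
  set A := 4 * γ ^ 2 + 2 * Ω ^ 2 + 1 with hA
  have hA1 : 1 ≤ A := by nlinarith [sq_nonneg γ, sq_nonneg Ω]
  set c := min (κ / 2) (δ / (2 * A)) with hc
  have hc0 : 0 < c := by positivity
  have hcκ : 2 * c ≤ κ := by have := min_le_left (κ / 2) (δ / (2 * A)); linarith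
  have hcδ : 2 * A * c ≤ δ := by
    have := min_le_right (κ / 2) (δ / (2 * A))
    rw [le_div_iff₀ (by positivity)] at this; linarith
  refine ⟨c, 4 * A * c + c, hc0, by positivity, fun w => ?_⟩
  have h1 := nsq_W1 Ω γ 1 one_pos w
  have h2 := nsq_W2 Ω γ 1 one_pos w
  have n0 := nsq_nonneg (w 0)
  have n3 := nsq_nonneg (w 3)
  have n4 := nsq_nonneg (w 4)
  have m1 : nsq (w 1) ≤ 2 * nsq (w 1 + W1 Ω γ w) + 2 * nsq (W1 Ω γ w) := by
    have := nsq_nonneg (w 1 + W1 Ω γ w + W1 Ω γ w)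
    rw [nsq_add] at this
    have e : nsq (w 1) = nsq ((w 1 + W1 Ω γ w) - W1 Ω γ w) := by simp
    rw [e, nsq_sub]; linarith
  have m2 : nsq (w 2) ≤ 2 * nsq (w 2 + W2 Ω γ w) + 2 * nsq (W2 Ω γ w) := by
    have := nsq_nonneg (w 2 + W2 Ω γ w + W2 Ω γ w)
    rw [nsq_add] at this
    have e : nsq (w 2) = nsq ((w 2 + W2 Ω γ w) - W2 Ω γ w) := by simp
    rw [e, nsq_sub]; linarith
  have hD : 0 ≤ DD Ω γ w := add_nonneg (nsq_nonneg _) (nsq_nonneg _)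
  have k1 : 2 * c * DD Ω γ w ≤ κ * DD Ω γ w := by gcongr
  have k2 : 2 * A * c * (nsq (w 3) + nsq (w 4)) ≤ δ * (nsq (w 3) + nsq (w 4)) := by gcongr
  have k3 : c * (nsq (w 1) + nsq (w 2)) ≤ c * (2 * DD Ω γ w + 2 * (8 * γ ^ 2 * nsq (w 0) + 2 * Ω ^ 2 * (nsq (w 3) + nsq (w 4)))) := by
    unfold DD
    norm_num at h1 h2
    exact mul_le_mul_of_nonneg_left (by linarith) hc0.le
  rw [tot_eq]
  have e1 : c * γ ^ 2 * nsq (w 0) ≥ 0 := by positivity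
  have e2 : c * Ω ^ 2 * nsq (w 0) ≥ 0 := by positivity
  have e3 : c * γ ^ 2 * nsq (w 3) ≥ 0 := by positivity
  have e4 : c * γ ^ 2 * nsq (w 4) ≥ 0 := by positivity
  have e5 : c * nsq (w 3) ≥ 0 := by positivity
  have e6 : c * nsq (w 4) ≥ 0 := by positivity
  have e7 : c * nsq (w 0) ≥ 0 := by positivity
  have e8 : c * Ω ^ 2 * nsq (w 3) ≥ 0 := by positivity
  have e9 : c * Ω ^ 2 * nsq (w 4) ≥ 0 := by positivity
  rw [hA] at k2 ⊢
  nlinarith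

theorem qq_coer (Ω γ γx γy : ℝ) (hγx : 0 < γx) (hγy : 0 < γy) (hΩ : |Ω| < min γx γy) :
    ∃ c C : ℝ, 0 < c ∧ 0 ≤ C ∧ ∀ w, c * tot w ≤ qq Ω γ γx γy w + C * nsq (w 0) := by
  obtain ⟨δ, C, hδ, hC, h⟩ := qq_lower Ω γ γx γy hγx hγy hΩ
  obtain ⟨c, C', hc, hC', h'⟩ := DD_lower Ω γ (1 / 2) δ (by norm_num) hδ
  exact ⟨c, C + C', hc, by positivity, fun w => by have := h w; have := h' w; linarith⟩
end

section
open scoped ContDiff ENNReal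

theorem Cb_nonneg : 0 ≤ Cb := by
  apply Real.sInf_nonneg
  rintro t ⟨f, -, -, rfl⟩
  have h1 : 0 ≤ ∫ x, gradsq 2 f x := integral_nonneg fun x => by unfold gradsq; positivity
  have h2 : 0 ≤ ∫ x, ‖f x‖ ^ 2 := integral_nonneg fun x => by positivity
  have h3 : 0 ≤ ∫ x, ‖f x‖ ^ 4 := integral_nonneg fun x => by positivity
  positivity

theorem GN_scalar (f : Pt 2 → ℂ) (hf : InH1 f) :
    Cb * ∫ x, ‖f x‖ ^ 4 ≤ (∫ x, gradsq 2 f x) * (∫ x, ‖f x‖ ^ 2) := by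
  have h1 : 0 ≤ ∫ x, gradsq 2 f x := integral_nonneg fun x => by unfold gradsq; positivity
  have h2 : 0 ≤ ∫ x, ‖f x‖ ^ 2 := integral_nonneg fun x => by positivity
  have h3 : 0 ≤ ∫ x, ‖f x‖ ^ 4 := integral_nonneg fun x => by positivity
  by_cases h0 : f =ᵐ[volume] 0
  · have : ∫ x, ‖f x‖ ^ 4 = 0 := by
      rw [integral_eq_zero_of_ae]
      filter_upwards [h0] with x hx
      simp [hx]
    rw [this]; simp; positivity
  · rcases h3.eq_or_lt with h4 | h4
    · rw [← h4]; simp; positivity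
    · have : Cb ≤ (∫ x, gradsq 2 f x) * (∫ x, ‖f x‖ ^ 2) / ∫ x, ‖f x‖ ^ 4 := by
        refine csInf_le ⟨0, ?_⟩ ⟨f, hf, h0, rfl⟩
        rintro t ⟨f, -, -, rfl⟩
        have h1 : 0 ≤ ∫ x, gradsq 2 f x := integral_nonneg fun x => by unfold gradsq; positivity
        have h2 : 0 ≤ ∫ x, ‖f x‖ ^ 2 := integral_nonneg fun x => by positivity
        have h3 : 0 ≤ ∫ x, ‖f x‖ ^ 4 := integral_nonneg fun x => by positivity
        positivity
      rwa [le_div_iff₀ h4] at this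

theorem ip_cs (a b : Z3) : (ip a b).re ^ 2 ≤ nsq a * nsq b := by
  have ha := nsq_nonneg a
  have hb := nsq_nonneg b
  set t := (ip a b).re with ht
  rcases hb.eq_or_lt with h | h
  · have hb0 : ∀ j, b j = 0 := fun j => by
      have := (Finset.sum_eq_zero_iff_of_nonneg (s := Finset.univ) (f := fun j => ‖b j‖ ^ 2) (fun j _ => by positivity)).1 h.symm j (Finset.mem_univ j)
      simpa using this
    have : t = 0 := by rw [ht, ip]; simp [hb0]
    rw [this, ← h]; simp
  · have h1 := nsq_nonneg (nsq b • a - t • b)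
    rw [nsq_sub, nsq_smul, nsq_smul, ip_smul_left, ip_smul_right, re_ofReal_mul, re_ofReal_mul, ← ht] at h1
    have : 0 ≤ nsq b * (nsq a * nsq b - t ^ 2) := by nlinarith
    have := nonneg_of_mul_nonneg_right this h
    linarith

theorem ip_M1_re (a : Z3) : (ip a (M1 a)).re = 0 := by
  have h := M1_anti a a
  have h2 := ip_re_comm a (M1 a)
  rw [h, neg_re] at h2
  rw [h, neg_re]; linarith
theorem ip_M2_re (a : Z3) : (ip a (M2 a)).re = 0 := by
  have h := M2_anti a a
  have h2 := ip_re_comm a (M2 a)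
  rw [h, neg_re] at h2
  rw [h, neg_re]; linarith

theorem ip_W1_re (Ω γ : ℝ) (Φ : Fin 3 → Pt 2 → ℂ) (x : Pt 2) : (ip (vv Φ x) (W1 Ω γ (jet Φ x))).re = 0 := by
  have e : jet Φ x 4 = ((x 1 : ℝ)) • vv Φ x := by ext j; simp [jet, vv]
  rw [W1, e, ip_add_right, ip_csmul_right, ip_csmul_right, ip_smul_right, jet0, add_re, re_ofReal_mul, ip_M1_re, ip_self]
  generalize (∑ j, ‖vv Φ x j‖ ^ 2) = s
  simp
theorem ip_W2_re (Ω γ : ℝ) (Φ : Fin 3 → Pt 2 → ℂ) (x : Pt 2) : (ip (vv Φ x) (W2 Ω γ (jet Φ x))).re = 0 := by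
  have e : jet Φ x 3 = ((x 0 : ℝ)) • vv Φ x := by ext j; simp [jet, vv]
  rw [W2, e, sub_eq_add_neg, ← neg_smul, ip_add_right, ip_csmul_right, ip_csmul_right, ip_smul_right, jet0, add_re, re_ofReal_mul, ip_M2_re, ip_self]
  generalize (∑ j, ‖vv Φ x j‖ ^ 2) = s
  simp

/-- regularised modulus -/
def fe (e : ℝ) (Φ : Fin 3 → Pt 2 → ℂ) (x : Pt 2) : ℝ := Real.sqrt (nsq (vv Φ x) + e ^ 2) - e

theorem fe_nonneg {e : ℝ} (he : 0 < e) (Φ : Fin 3 → Pt 2 → ℂ) (x : Pt 2) : 0 ≤ fe e Φ x := by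
  unfold fe
  have := nsq_nonneg (vv Φ x)
  have : Real.sqrt (e ^ 2) ≤ Real.sqrt (nsq (vv Φ x) + e ^ 2) := Real.sqrt_le_sqrt (by linarith)
  rw [Real.sqrt_sq he.le] at this
  linarith

theorem fe_sq_le {e : ℝ} (he : 0 < e) (Φ : Fin 3 → Pt 2 → ℂ) (x : Pt 2) : fe e Φ x ^ 2 ≤ nsq (vv Φ x) := by
  have h := fe_nonneg he Φ x
  have h0 := nsq_nonneg (vv Φ x)
  have h2 : (fe e Φ x + e) ^ 2 = nsq (vv Φ x) + e ^ 2 := by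
    unfold fe; rw [sub_add_cancel, Real.sq_sqrt (by positivity)]
  nlinarith

theorem fe_fderiv {e : ℝ} (he : 0 < e) (Φ : Fin 3 → Pt 2 → ℂ) (hΦ : ∀ j, Differentiable ℝ (Φ j)) (x : Pt 2) :
    ∃ L : Pt 2 →L[ℝ] ℝ, HasFDerivAt (fe e Φ) L x ∧ ∀ k : Fin 2, L (ee k) = (ip (vv Φ x) (fun j => dd k (Φ j) x)).re / Real.sqrt (nsq (vv Φ x) + e ^ 2) := by
  have h0 := nsq_nonneg (vv Φ x)
  have hj : ∀ j ∈ Finset.univ, HasFDerivAt (fun y => ‖Φ j y‖ ^ 2) (2 • (innerSL ℝ (Φ j x)).comp (fderiv ℝ (Φ j) x)) x := fun j _ => (hΦ j x).hasFDerivAt.norm_sq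
  have hs := HasFDerivAt.fun_sum hj
  have hs2 := ((hs.add_const (e ^ 2)).sqrt (by have : (∑ j, ‖Φ j x‖ ^ 2) = nsq (vv Φ x) := rfl
                                               rw [this]; positivity)).sub_const e
  refine ⟨_, hs2, fun k => ?_⟩
  have : (∑ j, ‖Φ j x‖ ^ 2) = nsq (vv Φ x) := rfl
  rw [this]
  have e2 : (ip (vv Φ x) (fun j => dd k (Φ j) x)).re = ∑ j, inner ℝ (Φ j x) (fderiv ℝ (Φ j) x (ee k)) := by
    simp only [ip, re_sum]
    refine Finset.sum_congr rfl fun j _ => ?_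
    rw [Complex.inner, dd, vv, mul_comm]
    try rfl
  rw [e2]
  simp only [smul_apply, sum_apply, smul_eq_mul, ContinuousLinearMap.comp_apply, innerSL_apply_apply, nsmul_eq_mul, ← Finset.mul_sum]
  have : 0 < Real.sqrt (nsq (vv Φ x) + e ^ 2) := Real.sqrt_pos.2 (by positivity)
  push_cast
  field_simp

theorem fe_dd {e : ℝ} (he : 0 < e) (Φ : Fin 3 → Pt 2 → ℂ) (hΦ : ∀ j, Differentiable ℝ (Φ j)) (x : Pt 2) :
    ∀ k : Fin 2, dd k (fun y => (fe e Φ y : ℂ)) x = (((ip (vv Φ x) (fun j => dd k (Φ j) x)).re / Real.sqrt (nsq (vv Φ x) + e ^ 2) : ℝ) : ℂ) := by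
  obtain ⟨L, hL, h⟩ := fe_fderiv he Φ hΦ x
  intro k
  have h2 : HasFDerivAt (fun y => (fe e Φ y : ℂ)) (ofRealCLM.comp L) x := ofRealCLM.hasFDerivAt.comp x hL
  rw [dd, h2.fderiv, ← h]; simp

theorem frac_le {t r a e : ℝ} (he : 0 < e) (hr : 0 ≤ r) (ha : 0 ≤ a) (h : t ^ 2 ≤ r * a) : (t / Real.sqrt (r + e ^ 2)) ^ 2 ≤ a := by
  rw [div_pow, Real.sq_sqrt (by positivity), div_le_iff₀ (by positivity)]
  nlinarith [sq_nonneg e, mul_nonneg (sq_nonneg e) ha]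

theorem fe_grad {e : ℝ} (he : 0 < e) (Ω γ : ℝ) (Φ : Fin 3 → Pt 2 → ℂ) (hΦ : ∀ j, Differentiable ℝ (Φ j)) (x : Pt 2) :
    gradsq 2 (fun y => (fe e Φ y : ℂ)) x ≤ DD Ω γ (jet Φ x) := by
  rw [grad_eq, fe_dd he Φ hΦ x, fe_dd he Φ hΦ x, DD]
  simp only [norm_real, Real.norm_eq_abs, sq_abs]
  have e0 : (ip (vv Φ x) (fun j => dd 0 (Φ j) x)).re = (ip (vv Φ x) (jet Φ x 1 + W1 Ω γ (jet Φ x))).re := by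
    rw [ip_add_right, add_re, ip_W1_re, add_zero]; rfl
  have e1 : (ip (vv Φ x) (fun j => dd 1 (Φ j) x)).re = (ip (vv Φ x) (jet Φ x 2 + W2 Ω γ (jet Φ x))).re := by
    rw [ip_add_right, add_re, ip_W2_re, add_zero]; rfl
  rw [e0, e1]
  exact add_le_add (frac_le he (nsq_nonneg _) (nsq_nonneg _) (ip_cs _ _)) (frac_le he (nsq_nonneg _) (nsq_nonneg _) (ip_cs _ _))

theorem DD_cont (Ω γ : ℝ) : Continuous (DD Ω γ) :=
  (nsq_cont.comp ((ev_cont 1).add (W1_cont Ω γ))).add (nsq_cont.comp ((ev_cont 2).add (W2_cont Ω γ)))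
theorem DD_smul (Ω γ t : ℝ) (w : W5) : DD Ω γ (t • w) = t ^ 2 • DD Ω γ w := by
  simp only [DD, W1_smul, W2_smul, Pi.smul_apply, ← smul_add, nsq_smul, smul_eq_mul]; ring
theorem DD_nonneg (Ω γ : ℝ) (w : W5) : 0 ≤ DD Ω γ w := add_nonneg (nsq_nonneg _) (nsq_nonneg _)

theorem nsq_sq_cont : Continuous (fun z => nsq z ^ 2) := nsq_cont.pow 2
theorem nsq_sq_smul (t : ℝ) (z : Z3) : nsq (t • z) ^ 2 = t ^ 4 • nsq z ^ 2 := by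
  simp only [nsq_smul, smul_eq_mul]; ring

theorem GN_vec (Ω γ : ℝ) (Φ : Fin 3 → Pt 2 → ℂ) (h : Cl Φ) (hm : mass (vv Φ) = 1) :
    Cb * ∫ x, nsq (vv Φ x) ^ 2 ≤ ∫ x, DD Ω γ (jet Φ x) := by
  have hi4 : Integrable (fun x => nsq (vv Φ x) ^ 2) := h.i4 nsq_sq_cont nsq_sq_smul
  have hiD : Integrable (fun x => DD Ω γ (jet Φ x)) := h.i2 (DD_cont Ω γ) (DD_smul Ω γ)
  have hvc : Continuous (vv Φ) := continuous_pi fun j => (h.1 j).continuous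
  have hfc : ∀ e, Continuous (fe e Φ) := fun e => by
    have := nsq_cont.comp hvc
    unfold fe; simp only [Function.comp_def] at this; fun_prop
  have b4 : ∀ e > 0, ∀ x, fe e Φ x ^ 4 ≤ nsq (vv Φ x) ^ 2 := fun e he x => by
    have := fe_sq_le he Φ x
    have h2 : (fe e Φ x ^ 2) ^ 2 ≤ nsq (vv Φ x) ^ 2 := by gcongr
    calc _ = (fe e Φ x ^ 2) ^ 2 := by ring
      _ ≤ _ := h2
  have key : ∀ e > 0, Cb * ∫ x, fe e Φ x ^ 4 ≤ ∫ x, DD Ω γ (jet Φ x) := by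
    intro e he
    have hgm : Measurable (fun x => gradsq 2 (fun y => (fe e Φ y : ℂ)) x) := by
      simp only [grad_eq]
      exact ((dd_meas 0 _).norm.pow_const 2).add ((dd_meas 1 _).norm.pow_const 2)
    have i2 : Integrable (fun x => fe e Φ x ^ 2) := by
      refine h.mass_int.mono' ((hfc e).pow 2).aestronglyMeasurable ?_
      filter_upwards with x
      rw [Real.norm_of_nonneg (by positivity)]; exact fe_sq_le he Φ x
    have i4 : Integrable (fun x => fe e Φ x ^ 4) := by
      refine hi4.mono' ((hfc e).pow 4).aestronglyMeasurable ?_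
      filter_upwards with x
      rw [Real.norm_of_nonneg (by positivity)]; exact b4 e he x
    have ig : Integrable (fun x => gradsq 2 (fun y => (fe e Φ y : ℂ)) x) := by
      refine hiD.mono' hgm.aestronglyMeasurable ?_
      filter_upwards with x
      rw [Real.norm_of_nonneg (by unfold gradsq; positivity)]; exact fe_grad he Ω γ Φ h.1 x
    have n2 : ∀ x, ‖(fe e Φ x : ℂ)‖ ^ 2 = fe e Φ x ^ 2 := fun x => by simp
    have n4 : ∀ x, ‖(fe e Φ x : ℂ)‖ ^ 4 = fe e Φ x ^ 4 := fun x => by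
      rw [norm_real, Real.norm_of_nonneg (fe_nonneg he Φ x)]
    have hH : InH1 (fun y => (fe e Φ y : ℂ)) := by
      refine ⟨fun x => ?_, by simpa only [n2] using i2, ig, by simpa only [n4] using i4⟩
      obtain ⟨L, hL, -⟩ := fe_fderiv he Φ h.1 x
      exact (ofRealCLM.hasFDerivAt.comp x hL).differentiableAt
    have g := GN_scalar _ hH
    simp only [n2, n4] at g
    refine g.trans ?_
    have a1 : ∫ x, gradsq 2 (fun y => (fe e Φ y : ℂ)) x ≤ ∫ x, DD Ω γ (jet Φ x) :=
      integral_mono ig hiD fun x => fe_grad he Ω γ Φ h.1 x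
    have a2 : ∫ x, fe e Φ x ^ 2 ≤ 1 := by
      rw [← hm]; exact integral_mono i2 h.mass_int fun x => fe_sq_le he Φ x
    have a3 : 0 ≤ ∫ x, gradsq 2 (fun y => (fe e Φ y : ℂ)) x := integral_nonneg fun x => by unfold gradsq; positivity
    nlinarith
  have lim : Filter.Tendsto (fun n : ℕ => ∫ x, fe (1 / ((n : ℝ) + 1)) Φ x ^ 4) Filter.atTop (nhds (∫ x, nsq (vv Φ x) ^ 2)) := by
    refine tendsto_integral_of_dominated_convergence _ (fun n => ((hfc _).pow 4).aestronglyMeasurable) hi4 (fun n => ?_) ?_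
    · filter_upwards with x
      have := fe_nonneg (e := 1 / ((n : ℝ) + 1)) (by positivity) Φ x
      rw [Real.norm_of_nonneg (by positivity)]; exact b4 _ (by positivity) x
    · filter_upwards with x
      have hc : Continuous (fun e : ℝ => fe e Φ x ^ 4) := by unfold fe; fun_prop
      have := (hc.tendsto 0).comp tendsto_one_div_add_atTop_nhds_zero_nat
      have e0 : fe 0 Φ x ^ 4 = nsq (vv Φ x) ^ 2 := by
        unfold fe
        simp only [ne_eq, OfNat.ofNat_ne_zero, not_false_eq_true, zero_pow, add_zero, sub_zero]
        rw [show (4 : ℕ) = 2 * 2 from rfl, pow_mul, Real.sq_sqrt (nsq_nonneg _)]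
      rw [e0] at this
      exact this
  exact le_of_tendsto (lim.const_mul Cb) (Filter.Eventually.of_forall fun n => key _ (by positivity))
end

section
open scoped ContDiff ENNReal

theorem nn_lower (c0 c1 : ℝ) (z : Z3) : 1 / 2 * min c0 (c0 + c1) * nsq z ^ 2 ≤ nn c0 c1 z := by
  have h := nn_eq c0 c1 (fun _ => z 0) (fun _ => z 1) (fun _ => z 2) 0
  have h2 := Fsq_le (fun _ => z 0) (fun _ => z 1) (fun _ => z 2) 0
  have h3 : 0 ≤ Fsq 2 (fun _ => z 0) (fun _ => z 1) (fun _ => z 2) 0 := by unfold Fsq; positivity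
  have e1 : ![z 0, z 1, z 2] = z := by ext j; fin_cases j <;> rfl
  have e2 : rho 2 (fun _ => z 0) (fun _ => z 1) (fun _ => z 2) 0 = nsq z := by
    simp [rho, nsq, Fin.sum_univ_three]
  rw [e1, e2] at h
  rw [e2] at h2
  rw [h]
  have m1 := min_le_left c0 (c0 + c1)
  have m2 := min_le_right c0 (c0 + c1)
  have n2 := sq_nonneg (nsq z)
  rcases le_total 0 c1 with hc | hc
  · nlinarith [mul_nonneg hc h3]
  · nlinarith

theorem tot_cont : Continuous tot := by
  unfold tot; exact continuous_finsetSum _ fun k _ => nsq_ev_cont k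
theorem tot_smul (t : ℝ) (w : W5) : tot (t • w) = t ^ 2 • tot w := by
  simp only [tot, Pi.smul_apply, nsq_smul, smul_eq_mul, Finset.mul_sum]

theorem coer (c0 c1 Ω γ γx γy : ℝ) (hγx : 0 < γx) (hγy : 0 < γy) (hΩ : |Ω| < min γx γy) (hc0 : -Cb < c0) (hc01 : -Cb < c0 + c1) :
    ∃ c C : ℝ, 0 < c ∧ 0 ≤ C ∧ ∀ Φ, Cl Φ → mass (vv Φ) = 1 →
      c * ∫ x, tot (jet Φ x) ≤ (∫ x, qq Ω γ γx γy (jet Φ x)) + (∫ x, nn c0 c1 (vv Φ x)) + C := by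
  obtain ⟨δ, C, hδ, hC, hq⟩ := qq_lower Ω γ γx γy hγx hγy hΩ
  set μ := min c0 (c0 + c1) with hμ
  have hμ1 : -Cb < μ := lt_min hc0 hc01
  obtain ⟨θ, hθ0, hθ1, hθ⟩ : ∃ θ : ℝ, 0 ≤ θ ∧ θ < 1 ∧ -μ ≤ θ * Cb := by
    rcases le_or_gt 0 μ with h | h
    · exact ⟨0, le_rfl, one_pos, by linarith⟩
    · have hCb : 0 < Cb := by linarith
      refine ⟨-μ / Cb, div_nonneg (by linarith) hCb.le, by rw [div_lt_one hCb]; linarith, ?_⟩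
      rw [div_mul_cancel₀ _ hCb.ne']
  obtain ⟨c, C', hc, hC', hD⟩ := DD_lower Ω γ ((1 - θ) / 2) δ (by linarith) hδ
  refine ⟨c, C + C', hc, by positivity, fun Φ h hm => ?_⟩
  have it := h.i2 tot_cont tot_smul
  have iq := h.i2 (qq_cont Ω γ γx γy) (fun t w => by rw [qq_smul, smul_eq_mul])
  have iN := h.i4 (nn_cont c0 c1) (fun t w => by rw [nn_smul, smul_eq_mul])
  have iD := h.i2 (DD_cont Ω γ) (DD_smul Ω γ)
  have i4 := h.i4 nsq_sq_cont nsq_sq_smul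
  have im := h.mass_int
  have g := GN_vec Ω γ Φ h hm
  have a1 : 1 / 2 * μ * ∫ x, nsq (vv Φ x) ^ 2 ≤ ∫ x, nn c0 c1 (vv Φ x) := by
    rw [← integral_const_mul]; exact integral_mono (i4.const_mul _) iN fun x => nn_lower c0 c1 _
  have p4 : 0 ≤ ∫ x, nsq (vv Φ x) ^ 2 := integral_nonneg fun x => by positivity
  have a2 : c * (∫ x, tot (jet Φ x)) + θ / 2 * (∫ x, DD Ω γ (jet Φ x)) ≤ (∫ x, qq Ω γ γx γy (jet Φ x)) + (C + C') * ∫ x, nsq (vv Φ x) := by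
    rw [← integral_const_mul, ← integral_const_mul, ← integral_const_mul, ← integral_add (it.const_mul _) (iD.const_mul _),
      ← integral_add iq (im.const_mul _)]
    refine integral_mono ((it.const_mul _).add (iD.const_mul _)) (iq.add (im.const_mul _)) fun x => ?_
    have := hD (jet Φ x)
    have := hq (jet Φ x)
    simp only [jet0] at *
    linarith
  have hm' : ∫ x, nsq (vv Φ x) = 1 := hm
  rw [hm'] at a2
  have a3 : θ * (Cb * ∫ x, nsq (vv Φ x) ^ 2) ≤ θ * ∫ x, DD Ω γ (jet Φ x) := by gcongr
  have a4 : -μ * ∫ x, nsq (vv Φ x) ^ 2 ≤ θ * Cb * ∫ x, nsq (vv Φ x) ^ 2 := by gcongr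
  nlinarith
end

section
open scoped ContDiff ENNReal Topology

theorem ae_subseq {W : Type*} [NormedAddCommGroup W] (Ψ : ℕ → Pt 2 → W) (Ψ0 : Pt 2 → W)
    (hi : ∀ n, MemLp (fun x => Ψ n x - Ψ0 x) 2)
    (h2 : Filter.Tendsto (fun n => ∫ x, ‖Ψ n x - Ψ0 x‖ ^ 2) Filter.atTop (𝓝 0)) :
    ∃ ms : ℕ → ℕ, StrictMono ms ∧ ∀ᵐ x, Filter.Tendsto (fun n => Ψ (ms n) x) Filter.atTop (𝓝 (Ψ0 x)) := by
  have hintg : ∀ n, Integrable (fun x => ‖Ψ n x - Ψ0 x‖ ^ 2) := fun n => (hi n).integrable_norm_pow (by norm_num)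
  have hM : TendstoInMeasure volume (fun n x => ‖Ψ n x - Ψ0 x‖ ^ 2) Filter.atTop (fun _ => (0 : ℝ)) := by
    refine tendstoInMeasure_of_tendsto_eLpNorm (p := 1) (by norm_num) (fun n => (hintg n).1) aestronglyMeasurable_const ?_
    have e : ∀ n, eLpNorm ((fun x => ‖Ψ n x - Ψ0 x‖ ^ 2) - fun _ => (0 : ℝ)) 1 volume = ENNReal.ofReal (∫ x, ‖Ψ n x - Ψ0 x‖ ^ 2) := by
      intro n
      rw [eLpNorm_one_eq_lintegral_enorm]
      have := ofReal_integral_norm_eq_lintegral_enorm (hintg n)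
      simp only [Pi.sub_apply, sub_zero]
      rw [← this]; simp
    simp only [e]
    have := ENNReal.tendsto_ofReal h2
    simpa using this
  obtain ⟨ms, hms, hae⟩ := hM.exists_seq_tendsto_ae
  refine ⟨ms, hms, ?_⟩
  filter_upwards [hae] with x hx
  rw [tendsto_iff_norm_sub_tendsto_zero]
  have := hx.sqrt
  simpa using this

theorem conv_L1 {ι : Type*} {l : Filter ι} [l.IsCountablyGenerated] {W Z F : Type*} [NormedAddCommGroup W] [NormedSpace ℝ W]
    [NormedAddCommGroup Z] [NormedSpace ℝ Z] [NormedAddCommGroup F] (π : W →L[ℝ] Z) (Ψ : ι → Pt 2 → W) (Ψ0 : Pt 2 → W)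
    (m2 : ∀ i, MemLp (Ψ i) 2) (m20 : MemLp Ψ0 2) (m4 : ∀ i, MemLp (fun x => π (Ψ i x)) 4) (m40 : MemLp (fun x => π (Ψ0 x)) 4)
    (h2 : Filter.Tendsto (fun i => ∫ x, ‖Ψ i x - Ψ0 x‖ ^ 2) l (𝓝 0))
    (h4 : Filter.Tendsto (fun i => ∫ x, ‖π (Ψ i x) - π (Ψ0 x)‖ ^ 4) l (𝓝 0))
    (G : Pt 2 → W → F) (hGc : ∀ x, Continuous (G x)) (hGm : ∀ i, AEStronglyMeasurable (fun x => G x (Ψ i x)))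
    (hGm0 : AEStronglyMeasurable (fun x => G x (Ψ0 x)))
    (C : ℝ) (hC : 0 ≤ C) (hG : ∀ x w, ‖G x w‖ ≤ C * (‖π w‖ ^ 4 + ‖w‖ ^ 2)) :
    (∀ i, Integrable (fun x => G x (Ψ i x))) ∧ Integrable (fun x => G x (Ψ0 x)) ∧
    Filter.Tendsto (fun i => ∫ x, ‖G x (Ψ i x) - G x (Ψ0 x)‖) l (𝓝 0) := by
  have I4 : ∀ i, Integrable (fun x => ‖π (Ψ i x)‖ ^ 4) := fun i => (m4 i).integrable_norm_pow (by norm_num)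
  have I2 : ∀ i, Integrable (fun x => ‖Ψ i x‖ ^ 2) := fun i => (m2 i).integrable_norm_pow (by norm_num)
  have I40 : Integrable (fun x => ‖π (Ψ0 x)‖ ^ 4) := m40.integrable_norm_pow (by norm_num)
  have I20 : Integrable (fun x => ‖Ψ0 x‖ ^ 2) := m20.integrable_norm_pow (by norm_num)
  have J4 : ∀ i, Integrable (fun x => ‖π (Ψ i x) - π (Ψ0 x)‖ ^ 4) := fun i => ((m4 i).sub m40).integrable_norm_pow (by norm_num)
  have J2 : ∀ i, Integrable (fun x => ‖Ψ i x - Ψ0 x‖ ^ 2) := fun i => ((m2 i).sub m20).integrable_norm_pow (by norm_num)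
  have Ii : ∀ i, Integrable (fun x => G x (Ψ i x)) := fun i =>
    (((I4 i).add (I2 i)).const_mul C).mono' (hGm i) (Filter.Eventually.of_forall fun x => hG x _)
  have I0 : Integrable (fun x => G x (Ψ0 x)) :=
    ((I40.add I20).const_mul C).mono' hGm0 (Filter.Eventually.of_forall fun x => hG x _)
  refine ⟨Ii, I0, ?_⟩
  refine Filter.tendsto_of_subseq_tendsto fun ns hns => ?_
  obtain ⟨ms, hms, hae⟩ := ae_subseq (fun n => Ψ (ns n)) Ψ0 (fun n => (m2 _).sub m20) (h2.comp hns)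
  refine ⟨ms, ?_⟩
  set k : ℕ → ι := fun n => ns (ms n) with hk
  have hkl : Filter.Tendsto k Filter.atTop l := hns.comp hms.tendsto_atTop
  set H : ℕ → Pt 2 → ℝ := fun n x => C * (8 * ‖π (Ψ (k n) x) - π (Ψ0 x)‖ ^ 4 + 2 * ‖Ψ (k n) x - Ψ0 x‖ ^ 2) with hH
  set b : Pt 2 → ℝ := fun x => C * (9 * ‖π (Ψ0 x)‖ ^ 4 + 3 * ‖Ψ0 x‖ ^ 2) with hb
  have Hint : ∀ n, Integrable (H n) := fun n => (((J4 _).const_mul 8).add ((J2 _).const_mul 2)).const_mul C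
  have bint : Integrable b := ((I40.const_mul 9).add (I20.const_mul 3)).const_mul C
  have bd : ∀ n x, ‖G x (Ψ (k n) x) - G x (Ψ0 x)‖ ≤ H n x + b x := by
    intro n x
    have e4 : ‖π (Ψ (k n) x)‖ ^ 4 ≤ 8 * (‖π (Ψ (k n) x) - π (Ψ0 x)‖ ^ 4 + ‖π (Ψ0 x)‖ ^ 4) := by
      have h1 : ‖π (Ψ (k n) x)‖ ≤ ‖π (Ψ (k n) x) - π (Ψ0 x)‖ + ‖π (Ψ0 x)‖ := by
        simpa using norm_add_le (π (Ψ (k n) x) - π (Ψ0 x)) (π (Ψ0 x))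
      calc _ ≤ (‖π (Ψ (k n) x) - π (Ψ0 x)‖ + ‖π (Ψ0 x)‖) ^ 4 := by gcongr
        _ ≤ _ := by have := add_pow_le (norm_nonneg (π (Ψ (k n) x) - π (Ψ0 x))) (norm_nonneg (π (Ψ0 x))) 4; norm_num at this ⊢; exact this
    have e2 : ‖Ψ (k n) x‖ ^ 2 ≤ 2 * (‖Ψ (k n) x - Ψ0 x‖ ^ 2 + ‖Ψ0 x‖ ^ 2) := by
      have h1 : ‖Ψ (k n) x‖ ≤ ‖Ψ (k n) x - Ψ0 x‖ + ‖Ψ0 x‖ := by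
        simpa using norm_add_le (Ψ (k n) x - Ψ0 x) (Ψ0 x)
      calc _ ≤ (‖Ψ (k n) x - Ψ0 x‖ + ‖Ψ0 x‖) ^ 2 := by gcongr
        _ ≤ _ := by have := add_pow_le (norm_nonneg (Ψ (k n) x - Ψ0 x)) (norm_nonneg (Ψ0 x)) 2; norm_num at this ⊢; exact this
    refine (norm_sub_le _ _).trans ((add_le_add (hG _ _) (hG _ _)).trans ?_)
    rw [hH, hb]
    simp only
    rw [← mul_add, ← mul_add]
    refine mul_le_mul_of_nonneg_left ?_ hC
    linarith
  have dint : ∀ n, Integrable (fun x => ‖G x (Ψ (k n) x) - G x (Ψ0 x)‖) := fun n => ((Ii _).sub I0).norm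
  have mint : ∀ n, Integrable (fun x => max (‖G x (Ψ (k n) x) - G x (Ψ0 x)‖ - H n x) 0) := fun n => ((dint n).sub (Hint n)).pos_part
  have L1 : Filter.Tendsto (fun n => ∫ x, max (‖G x (Ψ (k n) x) - G x (Ψ0 x)‖ - H n x) 0) Filter.atTop (𝓝 (∫ x : Pt 2, (0 : ℝ))) := by
    refine tendsto_integral_of_dominated_convergence b (fun n => (mint n).1) bint (fun n => ?_) ?_
    · filter_upwards with x
      rw [Real.norm_of_nonneg (le_max_right _ _)]
      refine max_le ?_ (by rw [hb]; positivity)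
      have := bd n x; linarith
    · filter_upwards [hae] with x hx
      have t1 : Filter.Tendsto (fun n => ‖G x (Ψ (k n) x) - G x (Ψ0 x)‖) Filter.atTop (𝓝 0) := by
        rw [← tendsto_iff_norm_sub_tendsto_zero]
        exact ((hGc x).tendsto _).comp hx
      refine squeeze_zero (fun n => le_max_right _ _) (fun n => max_le ?_ (norm_nonneg _)) t1
      have : 0 ≤ H n x := by rw [hH]; positivity
      linarith
  have L2 : Filter.Tendsto (fun n => ∫ x, H n x) Filter.atTop (𝓝 0) := by
    have : ∀ n, ∫ x, H n x = C * (8 * (∫ x, ‖π (Ψ (k n) x) - π (Ψ0 x)‖ ^ 4) + 2 * ∫ x, ‖Ψ (k n) x - Ψ0 x‖ ^ 2) := by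
      intro n
      rw [hH]; simp only
      rw [integral_const_mul, integral_add ((J4 _).const_mul 8) ((J2 _).const_mul 2), integral_const_mul, integral_const_mul]
    simp only [this]
    have := (((h4.comp hkl).const_mul 8).add ((h2.comp hkl).const_mul 2)).const_mul C
    simpa using this
  have L := L1.add L2
  simp only [integral_zero, add_zero] at L
  refine squeeze_zero (fun n => integral_nonneg fun x => norm_nonneg _) (fun n => ?_) L
  rw [← integral_add (mint n) (Hint n)]
  refine integral_mono (dint n) ((mint n).add (Hint n)) fun x => ?_
  have := le_max_left (‖G x (Ψ (k n) x) - G x (Ψ0 x)‖ - H n x) 0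
  simp only [Pi.add_apply]
  linarith

theorem conv {ι : Type*} {l : Filter ι} [l.IsCountablyGenerated] {W Z F : Type*} [NormedAddCommGroup W] [NormedSpace ℝ W]
    [NormedAddCommGroup Z] [NormedSpace ℝ Z] [NormedAddCommGroup F] [NormedSpace ℝ F] (π : W →L[ℝ] Z) (Ψ : ι → Pt 2 → W) (Ψ0 : Pt 2 → W)
    (m2 : ∀ i, MemLp (Ψ i) 2) (m20 : MemLp Ψ0 2) (m4 : ∀ i, MemLp (fun x => π (Ψ i x)) 4) (m40 : MemLp (fun x => π (Ψ0 x)) 4)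
    (h2 : Filter.Tendsto (fun i => ∫ x, ‖Ψ i x - Ψ0 x‖ ^ 2) l (𝓝 0))
    (h4 : Filter.Tendsto (fun i => ∫ x, ‖π (Ψ i x) - π (Ψ0 x)‖ ^ 4) l (𝓝 0))
    (G : Pt 2 → W → F) (hGc : ∀ x, Continuous (G x)) (hGm : ∀ i, AEStronglyMeasurable (fun x => G x (Ψ i x)))
    (hGm0 : AEStronglyMeasurable (fun x => G x (Ψ0 x)))
    (C : ℝ) (hC : 0 ≤ C) (hG : ∀ x w, ‖G x w‖ ≤ C * (‖π w‖ ^ 4 + ‖w‖ ^ 2)) :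
    (∀ i, Integrable (fun x => G x (Ψ i x))) ∧ Integrable (fun x => G x (Ψ0 x)) ∧
    Filter.Tendsto (fun i => ∫ x, G x (Ψ i x)) l (𝓝 (∫ x, G x (Ψ0 x))) := by
  obtain ⟨a, b, c⟩ := conv_L1 π Ψ Ψ0 m2 m20 m4 m40 h2 h4 G hGc hGm hGm0 C hC hG
  refine ⟨a, b, ?_⟩
  rw [tendsto_iff_norm_sub_tendsto_zero]
  refine squeeze_zero (fun i => norm_nonneg _) (fun i => ?_) c
  rw [← integral_sub (a i) b]
  exact norm_integral_le_integral_norm _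
end

section
open scoped ContDiff ENNReal Topology

theorem int_eLp {E : Type*} [NormedAddCommGroup E] {f : Pt 2 → E} (p : ℕ) (hp : p ≠ 0) (hf : MemLp f p) :
    eLpNorm f p volume = ENNReal.ofReal ((∫ x, ‖f x‖ ^ p) ^ ((p : ℝ)⁻¹)) := by
  rw [hf.eLpNorm_eq_integral_rpow_norm (by exact_mod_cast hp) (ENNReal.natCast_ne_top p)]
  simp

theorem eLp_tend {E : Type*} [NormedAddCommGroup E] {ι : Type*} {l : Filter ι} (f : ι → Pt 2 → E) (p : ℕ) (hp : p ≠ 0) (hf : ∀ i, MemLp (f i) p) :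
    Filter.Tendsto (fun i => eLpNorm (f i) p volume) l (𝓝 0) ↔ Filter.Tendsto (fun i => ∫ x, ‖f i x‖ ^ p) l (𝓝 0) := by
  have hn : ∀ i, 0 ≤ ∫ x, ‖f i x‖ ^ p := fun i => integral_nonneg fun x => by positivity
  have hp' : (p : ℝ) ≠ 0 := by exact_mod_cast hp
  simp only [int_eLp p hp (hf _)]
  constructor
  · intro h
    have h1 := (ENNReal.tendsto_toReal (ENNReal.zero_ne_top)).comp h
    have h2 := h1.pow p
    simp only [Function.comp_def, ENNReal.toReal_zero, zero_pow hp] at h2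
    refine h2.congr fun i => ?_
    rw [ENNReal.toReal_ofReal (Real.rpow_nonneg (hn i) _), ← Real.rpow_natCast, ← Real.rpow_mul (hn i), inv_mul_cancel₀ hp', Real.rpow_one]
  · intro h
    have h1 := h.rpow_const (p := (p : ℝ)⁻¹) (Or.inr (by positivity))
    rw [Real.zero_rpow (inv_ne_zero hp')] at h1
    have := ENNReal.tendsto_ofReal h1
    simpa using this

theorem complete_p {E : Type*} [NormedAddCommGroup E] [CompleteSpace E] (p : ℕ) (hp : p ≠ 0) (f : ℕ → Pt 2 → E) (hf : ∀ n, MemLp (f n) p)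
    (hc : Filter.Tendsto (fun n : ℕ × ℕ => ∫ x, ‖f n.1 x - f n.2 x‖ ^ p) Filter.atTop (𝓝 0)) :
    ∃ g : Pt 2 → E, MemLp g p ∧ Filter.Tendsto (fun n => ∫ x, ‖f n x - g x‖ ^ p) Filter.atTop (𝓝 0) ∧ TendstoInMeasure volume f Filter.atTop g := by
  have : Fact ((1 : ℝ≥0∞) ≤ p) := ⟨by exact_mod_cast Nat.one_le_iff_ne_zero.2 hp⟩
  have hc' := (eLp_tend (fun n : ℕ × ℕ => fun x => f n.1 x - f n.2 x) p hp (fun n => (hf _).sub (hf _))).2 hc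
  have hC : CauchySeq (fun n => (hf n).toLp (f n)) := by
    rw [Lp.cauchySeq_Lp_iff_cauchySeq_eLpNorm]
    refine hc'.congr fun n => eLpNorm_congr_ae ?_
    filter_upwards [(hf n.1).coeFn_toLp, (hf n.2).coeFn_toLp] with x h1 h2
    simp [h1, h2]
  obtain ⟨g, hg⟩ := cauchySeq_tendsto_of_complete hC
  have hg1 := (Lp.tendsto_Lp_iff_tendsto_eLpNorm' _ _).1 hg
  have hg2 : Filter.Tendsto (fun n => eLpNorm (fun x => f n x - g x) p volume) Filter.atTop (𝓝 0) := by
    refine hg1.congr fun n => eLpNorm_congr_ae ?_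
    filter_upwards [(hf n).coeFn_toLp] with x h1
    simp [h1]
  refine ⟨g, Lp.memLp g, (eLp_tend (fun n x => f n x - g x) p hp (fun n => (hf n).sub (Lp.memLp g))).1 hg2, ?_⟩
  exact tendstoInMeasure_of_tendsto_eLpNorm (p := p) (by exact_mod_cast hp) (fun n => (hf n).1) (Lp.memLp g).1 hg2

theorem norm_sq_le_nsq (z : Z3) : ‖z‖ ^ 2 ≤ nsq z := by
  have : ‖z‖ ≤ Real.sqrt (nsq z) := by
    rw [pi_norm_le_iff_of_nonneg (Real.sqrt_nonneg _)]
    intro j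
    apply Real.le_sqrt_of_sq_le
    exact Finset.single_le_sum (f := fun j => ‖z j‖ ^ 2) (fun j _ => by positivity) (Finset.mem_univ j)
  calc _ ≤ Real.sqrt (nsq z) ^ 2 := by gcongr
    _ = _ := Real.sq_sqrt (nsq_nonneg z)

theorem nsq_le_norm_sq (z : Z3) : nsq z ≤ 3 * ‖z‖ ^ 2 := by
  unfold nsq
  calc _ ≤ ∑ j : Fin 3, ‖z‖ ^ 2 := Finset.sum_le_sum fun j _ => by gcongr; exact norm_le_pi_norm z j
    _ = _ := by simp

theorem norm_sq_le_tot (w : W5) : ‖w‖ ^ 2 ≤ tot w := by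
  have : ‖w‖ ≤ Real.sqrt (tot w) := by
    rw [pi_norm_le_iff_of_nonneg (Real.sqrt_nonneg _)]
    intro j
    apply Real.le_sqrt_of_sq_le
    refine (norm_sq_le_nsq _).trans ?_
    exact Finset.single_le_sum (f := fun j => nsq (w j)) (fun j _ => nsq_nonneg _) (Finset.mem_univ j)
  have h0 : 0 ≤ tot w := Finset.sum_nonneg fun j _ => nsq_nonneg _
  calc _ ≤ Real.sqrt (tot w) ^ 2 := by gcongr
    _ = _ := Real.sq_sqrt h0

def EE (c0 c1 Ω γ γx γy : ℝ) (Φ : Fin 3 → Pt 2 → ℂ) : ℝ := (∫ x, qq Ω γ γx γy (jet Φ x)) + ∫ x, nn c0 c1 (vv Φ x)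

def SS (c0 c1 Ω γ γx γy : ℝ) : Set ℝ := {t | ∃ Φ, Cl Φ ∧ mass (vv Φ) = 1 ∧ t = EE c0 c1 Ω γ γx γy Φ}

theorem vv_smul (t : ℝ) (Φ : Fin 3 → Pt 2 → ℂ) (x : Pt 2) : vv (fun j x => (t : ℂ) * Φ j x) x = t • vv Φ x := by
  ext j; simp [vv]
theorem mass_smul (t : ℝ) (Φ : Fin 3 → Pt 2 → ℂ) : mass (vv (fun j x => (t : ℂ) * Φ j x)) = t ^ 2 * mass (vv Φ) := by
  simp only [mass, vv_smul, nsq_smul, integral_const_mul]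
theorem nn_int_smul (c0 c1 t : ℝ) (Φ : Fin 3 → Pt 2 → ℂ) : ∫ x, nn c0 c1 (vv (fun j x => (t : ℂ) * Φ j x) x) = t ^ 4 * ∫ x, nn c0 c1 (vv Φ x) := by
  simp only [vv_smul, nn_smul, integral_const_mul]
theorem jet_smul' (t : ℝ) (Φ : Fin 3 → Pt 2 → ℂ) (x : Pt 2) : jet (fun j x => (t : ℂ) * Φ j x) x = t • jet Φ x := by
  rw [jet_smul]
theorem qq_int_smul (Ω γ γx γy t : ℝ) (Φ : Fin 3 → Pt 2 → ℂ) : ∫ x, qq Ω γ γx γy (jet (fun j x => (t : ℂ) * Φ j x) x) = t ^ 2 * ∫ x, qq Ω γ γx γy (jet Φ x) := by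
  simp only [jet_smul', qq_smul, integral_const_mul]

theorem mass_nonneg (Ψ : Pt 2 → Z3) : 0 ≤ mass Ψ := integral_nonneg fun _ => nsq_nonneg _

theorem nsq_eq_zero {z : Z3} (h : nsq z = 0) : z = 0 := by
  have := norm_sq_le_nsq z
  rw [h] at this
  have h2 : ‖z‖ ^ 2 = 0 := le_antisymm this (by positivity)
  simpa using h2

theorem nn_zero (c0 c1 : ℝ) : nn c0 c1 0 = 0 := by
  have := nn_smul c0 c1 0 0
  simpa using this

theorem scaled (c0 c1 Ω γ γx γy m : ℝ) (hm : ∀ Φ, Cl Φ → mass (vv Φ) = 1 → m ≤ EE c0 c1 Ω γ γx γy Φ)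
    (Φ : Fin 3 → Pt 2 → ℂ) (h : Cl Φ) :
    m * mass (vv Φ) ^ 2 ≤ mass (vv Φ) * (∫ x, qq Ω γ γx γy (jet Φ x)) + ∫ x, nn c0 c1 (vv Φ x) := by
  rcases (mass_nonneg (vv Φ)).eq_or_lt with h0 | h0
  · rw [← h0]
    have : (fun x => nsq (vv Φ x)) =ᵐ[volume] 0 := (integral_eq_zero_iff_of_nonneg (fun x => nsq_nonneg _) h.mass_int).1 h0.symm
    have : ∫ x, nn c0 c1 (vv Φ x) = 0 := by
      apply integral_eq_zero_of_ae
      filter_upwards [this] with x hx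
      rw [nsq_eq_zero hx, nn_zero]; rfl
    rw [this]; simp
  · set a := mass (vv Φ) with ha
    set t := (Real.sqrt a)⁻¹ with ht
    have ht2 : t ^ 2 = a⁻¹ := by rw [ht, inv_pow, Real.sq_sqrt h0.le]
    have ht4 : t ^ 4 = a⁻¹ ^ 2 := by rw [← ht2]; ring
    have := hm _ (h.smul t) (by rw [mass_smul, ht2, ← ha, inv_mul_cancel₀ h0.ne'])
    rw [EE, qq_int_smul, nn_int_smul, ht2, ht4] at this
    have h2 := mul_le_mul_of_nonneg_right this (sq_nonneg a)
    refine h2.trans (le_of_eq ?_)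
    field_simp

theorem Tst_Cl {ψ : Fin 3 → Pt 2 → ℂ} (h : ∀ j, Tst (ψ j)) : Cl ψ := by
  have key : ∀ θ : Pt 2 → ℂ, Tst θ → MemLp θ 2 := fun θ hθ => hθ.1.continuous.memLp_of_hasCompactSupport hθ.2
  refine Cl.mk' (fun j => (h j).1.differentiable (by simp)) (fun j => key _ (h j)) (fun j k => key _ ((h j).dd k)) (fun j k => ?_)
  refine Continuous.memLp_of_hasCompactSupport ?_ (h j).2.mul_left
  have := (h j).1.continuous
  fun_prop

theorem SS_nonempty (c0 c1 Ω γ γx γy : ℝ) : (SS c0 c1 Ω γ γx γy).Nonempty := by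
  obtain ⟨θ, hθ, h1⟩ := exists_cutoff 1 one_pos
  have hC := Tst_Cl (ψ := fun _ => θ) (fun _ => hθ)
  have hpos : 0 < mass (vv fun _ => θ) := by
    rcases (mass_nonneg (vv fun _ => θ)).eq_or_lt with h0 | h0
    · exfalso
      have h2 : (fun x => nsq (vv (fun _ => θ) x)) =ᵐ[volume] 0 := (integral_eq_zero_iff_of_nonneg (fun x => nsq_nonneg _) hC.mass_int).1 h0.symm
      have hc : Continuous (fun x => nsq (vv (fun _ : Fin 3 => θ) x)) :=
        nsq_cont.comp (continuous_pi fun j => hθ.1.continuous)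
      have h3 : _ = (fun _ => (0 : ℝ)) := (Continuous.ae_eq_iff_eq volume hc continuous_const).1 h2
      have := congrFun h3 0
      simp [nsq, vv, h1 0] at this
    · exact h0
  set a := mass (vv fun _ => θ) with ha
  refine ⟨_, fun j x => (((Real.sqrt a)⁻¹ : ℝ) : ℂ) * θ x, hC.smul _, ?_, rfl⟩
  rw [mass_smul _ (fun _ => θ), inv_pow, Real.sq_sqrt hpos.le, ← ha, inv_mul_cancel₀ hpos.ne']
end

section
open scoped ContDiff ENNReal Topology

theorem lint_le {Φ : Fin 3 → Pt 2 → ℂ} (h : Cl Φ) {K : ℝ} (hK : ∫ x, tot (jet Φ x) ≤ K) (g : Pt 2 → ℝ≥0∞)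
    (hg : ∀ x, g x ≤ ENNReal.ofReal (tot (jet Φ x))) : ∫⁻ x, g x ≤ ENNReal.ofReal K := by
  refine (lintegral_mono hg).trans ?_
  rw [← ofReal_integral_eq_lintegral_ofReal (h.i2 tot_cont tot_smul) (Filter.Eventually.of_forall fun x => Finset.sum_nonneg fun j _ => nsq_nonneg _)]
  exact ENNReal.ofReal_le_ofReal hK

theorem sq_le_nsq (z : Z3) (j : Fin 3) : ‖z j‖ ^ 2 ≤ nsq z :=
  Finset.single_le_sum (f := fun j => ‖z j‖ ^ 2) (fun j _ => by positivity) (Finset.mem_univ j)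

theorem enorm_sq (z : ℂ) : ‖z‖ₑ ^ 2 = ENNReal.ofReal (‖z‖ ^ 2) := by
  rw [ENNReal.ofReal_pow (norm_nonneg _), ofReal_norm]

theorem enorm_sq' (z : Pt 2) : ‖z‖ₑ ^ 2 = ENNReal.ofReal (‖z‖ ^ 2) := by
  rw [ENNReal.ofReal_pow (norm_nonneg _), ofReal_norm]

theorem comp_compact (Φ : ℕ → Fin 3 → Pt 2 → ℂ) (h : ∀ n, Cl (Φ n)) (K : ℝ) (hK : ∀ n, ∫ x, tot (jet (Φ n) x) ≤ K) (j : Fin 3) :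
    ∃ σ : ℕ → ℕ, StrictMono σ ∧ ∀ ε : ℝ≥0∞, ε ≠ 0 → ∃ N, ∀ n ≥ N, ∀ m ≥ N, ∫⁻ x, ‖Φ (σ n) j x - Φ (σ m) j x‖ₑ ^ 2 ≤ ε := by
  refine compactness (fun n => Φ n j) (fun n => (h n).1 j) (fun n => (h n).memLp j) K (fun n => ?_) (fun n => ?_) (fun n => ?_)
  · refine lint_le (h n) (hK n) _ fun x => ?_
    rw [enorm_sq]
    refine ENNReal.ofReal_le_ofReal ?_
    have := sq_le_nsq (jet (Φ n) x 0) j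
    have n1 := nsq_nonneg (jet (Φ n) x 1)
    have n2 := nsq_nonneg (jet (Φ n) x 2)
    have n3 := nsq_nonneg (jet (Φ n) x 3)
    have n4 := nsq_nonneg (jet (Φ n) x 4)
    rw [tot_eq]
    have e : jet (Φ n) x 0 j = Φ n j x := rfl
    rw [e] at this
    linarith
  · refine lint_le (h n) (hK n) _ fun x => ?_
    rw [GG, enorm_sq, enorm_sq, ← ENNReal.ofReal_add (by positivity) (by positivity)]
    refine ENNReal.ofReal_le_ofReal ?_
    have h1 := sq_le_nsq (jet (Φ n) x 1) j
    have h2 := sq_le_nsq (jet (Φ n) x 2) j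
    have n0 := nsq_nonneg (jet (Φ n) x 0)
    have n3 := nsq_nonneg (jet (Φ n) x 3)
    have n4 := nsq_nonneg (jet (Φ n) x 4)
    rw [tot_eq]
    have e : jet (Φ n) x 1 j = dd 0 (Φ n j) x := rfl
    have e' : jet (Φ n) x 2 j = dd 1 (Φ n j) x := rfl
    rw [e] at h1
    rw [e'] at h2
    linarith
  · refine lint_le (h n) (hK n) _ fun x => ?_
    rw [enorm_sq, enorm_sq', ← ENNReal.ofReal_mul (by positivity)]
    refine ENNReal.ofReal_le_ofReal ?_
    have h1 := sq_le_nsq (jet (Φ n) x 3) j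
    have h2 := sq_le_nsq (jet (Φ n) x 4) j
    have n0 := nsq_nonneg (jet (Φ n) x 0)
    have n3 := nsq_nonneg (jet (Φ n) x 1)
    have n4 := nsq_nonneg (jet (Φ n) x 2)
    rw [tot_eq]
    have e : jet (Φ n) x 3 j = (x 0 : ℂ) * Φ n j x := rfl
    have e' : jet (Φ n) x 4 j = (x 1 : ℂ) * Φ n j x := rfl
    rw [e, norm_mul, norm_real, mul_pow, Real.norm_eq_abs, sq_abs] at h1
    rw [e', norm_mul, norm_real, mul_pow, Real.norm_eq_abs, sq_abs] at h2
    rw [EuclideanSpace.real_norm_sq_eq, Fin.sum_univ_two]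
    linarith

theorem cauchy_comp {f : ℕ → Pt 2 → ℂ} {σ τ : ℕ → ℕ} (hτ : StrictMono τ)
    (h : ∀ ε : ℝ≥0∞, ε ≠ 0 → ∃ N, ∀ n ≥ N, ∀ m ≥ N, ∫⁻ x, ‖f (σ n) x - f (σ m) x‖ₑ ^ 2 ≤ ε) :
    ∀ ε : ℝ≥0∞, ε ≠ 0 → ∃ N, ∀ n ≥ N, ∀ m ≥ N, ∫⁻ x, ‖f (σ (τ n)) x - f (σ (τ m)) x‖ₑ ^ 2 ≤ ε := by
  intro ε hε
  obtain ⟨N, hN⟩ := h ε hε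
  exact ⟨N, fun n hn m hm => hN _ (hn.trans (hτ.id_le n)) _ (hm.trans (hτ.id_le m))⟩

theorem cauchy3 (Φ : ℕ → Fin 3 → Pt 2 → ℂ) (h : ∀ n, Cl (Φ n)) (K : ℝ) (hK : ∀ n, ∫ x, tot (jet (Φ n) x) ≤ K) :
    ∃ σ : ℕ → ℕ, StrictMono σ ∧
      Filter.Tendsto (fun n : ℕ × ℕ => ∫ x, nsq (vv (Φ (σ n.1)) x - vv (Φ (σ n.2)) x)) Filter.atTop (𝓝 0) := by
  obtain ⟨σ0, s0, h0⟩ := comp_compact Φ h K hK 0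
  obtain ⟨σ1, s1, h1⟩ := comp_compact (fun n => Φ (σ0 n)) (fun n => h _) K (fun n => hK _) 1
  obtain ⟨σ2, s2, h2⟩ := comp_compact (fun n => Φ (σ0 (σ1 n))) (fun n => h _) K (fun n => hK _) 2
  refine ⟨fun n => σ0 (σ1 (σ2 n)), s0.comp (s1.comp s2), ?_⟩
  have k0 := cauchy_comp (f := fun n => Φ n 0) (s1.comp s2) h0
  have k1 := cauchy_comp (f := fun n => Φ (σ0 n) 1) s2 h1
  have all : ∀ ε : ℝ≥0∞, ε ≠ 0 → ∃ N, ∀ n ≥ N, ∀ m ≥ N, ∀ j, ∫⁻ x, ‖Φ (σ0 (σ1 (σ2 n))) j x - Φ (σ0 (σ1 (σ2 m))) j x‖ₑ ^ 2 ≤ ε := by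
    intro ε hε
    obtain ⟨N0, hN0⟩ := k0 ε hε
    obtain ⟨N1, hN1⟩ := k1 ε hε
    obtain ⟨N2, hN2⟩ := h2 ε hε
    refine ⟨max N0 (max N1 N2), fun n hn m hm j => ?_⟩
    simp only [ge_iff_le, max_le_iff] at hn hm
    fin_cases j
    · exact hN0 n hn.1 m hm.1
    · exact hN1 n hn.2.1 m hm.2.1
    · exact hN2 n hn.2.2 m hm.2.2
  rw [Metric.tendsto_nhds]
  intro ε hε
  obtain ⟨N, hN⟩ := all (ENNReal.ofReal (ε / 6)) (by simp; linarith)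
  refine Filter.eventually_atTop.2 ⟨(N, N), fun n hn => ?_⟩
  have hb := hN n.1 hn.1 n.2 hn.2
  set f := Φ (σ0 (σ1 (σ2 n.1))) with hf
  set g := Φ (σ0 (σ1 (σ2 n.2))) with hg
  have hfC : Cl f := h _
  have hgC : Cl g := h _
  have hm : ∀ j, MemLp (fun x => f j x - g j x) 2 := fun j => (hfC.memLp j).sub (hgC.memLp j)
  have hj : ∀ j, ∫ x, ‖f j x - g j x‖ ^ 2 ≤ ε / 6 := by
    intro j
    have := hb j
    simp only [enorm_sq] at this
    rw [← ofReal_integral_eq_lintegral_ofReal (sq_int (hm j)) (Filter.Eventually.of_forall fun x => by positivity)] at this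
    exact (ENNReal.ofReal_le_ofReal_iff (by positivity)).1 this
  have e : ∫ x, nsq (vv f x - vv g x) = ∑ j, ∫ x, ‖f j x - g j x‖ ^ 2 := by
    rw [← integral_finsetSum _ (fun j _ => sq_int (hm j))]; rfl
  have hn0 : 0 ≤ ∫ x, nsq (vv f x - vv g x) := integral_nonneg fun x => nsq_nonneg _
  rw [Real.dist_eq, sub_zero, abs_of_nonneg hn0, e, Fin.sum_univ_three]
  have := hj 0
  have := hj 1
  have := hj 2
  linarith
end

section
open scoped ContDiff ENNReal Topology

theorem tot_nonneg (w : W5) : 0 ≤ tot w := Finset.sum_nonneg fun j _ => nsq_nonneg _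

theorem norm_pow_le_sum (z : Z3) (p : ℕ) (hp : p ≠ 0) : ‖z‖ ^ p ≤ ∑ j, ‖z j‖ ^ p := by
  obtain ⟨j, hj⟩ : ∃ j, ‖z‖ = ‖z j‖ := by
    obtain ⟨j, -, hj⟩ := Finset.exists_mem_eq_sup Finset.univ Finset.univ_nonempty (fun j => ‖z j‖₊)
    refine ⟨j, ?_⟩
    rw [Pi.norm_def, hj]; rfl
  rw [hj]
  exact Finset.single_le_sum (f := fun j => ‖z j‖ ^ p) (fun j _ => by positivity) (Finset.mem_univ j)

theorem Cl.comp_bounds {Φ : Fin 3 → Pt 2 → ℂ} (h : Cl Φ) (j : Fin 3) :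
    (∫ x, ‖Φ j x‖ ^ 2) ≤ mass (vv Φ) ∧ (∫ x, (‖dd 0 (Φ j) x‖ ^ 2 + ‖dd 1 (Φ j) x‖ ^ 2)) ≤ ∫ x, tot (jet Φ x) := by
  refine ⟨integral_mono (sq_int (h.memLp j)) h.mass_int fun x => sq_le_nsq (vv Φ x) j, ?_⟩
  refine integral_mono ((sq_int (h.memLp_dd j 0)).add (sq_int (h.memLp_dd j 1))) (h.i2 tot_cont tot_smul) fun x => ?_
  have h1 := sq_le_nsq (jet Φ x 1) j
  have h2 := sq_le_nsq (jet Φ x 2) j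
  have n0 := nsq_nonneg (jet Φ x 0)
  have n3 := nsq_nonneg (jet Φ x 3)
  have n4 := nsq_nonneg (jet Φ x 4)
  simp only [tot_eq]
  have e : jet Φ x 1 j = dd 0 (Φ j) x := rfl
  have e' : jet Φ x 2 j = dd 1 (Φ j) x := rfl
  rw [e] at h1
  rw [e'] at h2
  linarith

theorem Cl.L4 {Φ : Fin 3 → Pt 2 → ℂ} (h : Cl Φ) : (∀ j, (∫ x, ‖Φ j x‖ ^ 4) ≤ 4 * mass (vv Φ) * ∫ x, tot (jet Φ x)) ∧
    ∫ x, ‖vv Φ x‖ ^ 4 ≤ 12 * mass (vv Φ) * ∫ x, tot (jet Φ x) := by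
  have hT : 0 ≤ ∫ x, tot (jet Φ x) := integral_nonneg fun x => tot_nonneg _
  have hM := mass_nonneg (vv Φ)
  have key : ∀ j, (∫ x, ‖Φ j x‖ ^ 4) ≤ 4 * mass (vv Φ) * ∫ x, tot (jet Φ x) := by
    intro j
    obtain ⟨b1, b2⟩ := h.comp_bounds j
    refine (lady4 (Φ j) (h.1 j) (h.memLp j) (h.memLp_dd j)).2.trans ?_
    have : 0 ≤ (∫ x, (‖dd 0 (Φ j) x‖ ^ 2 + ‖dd 1 (Φ j) x‖ ^ 2)) := integral_nonneg fun x => by positivity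
    gcongr
  refine ⟨key, ?_⟩
  have i4 : ∀ j, Integrable (fun x => ‖Φ j x‖ ^ 4) := fun j => (lady4 (Φ j) (h.1 j) (h.memLp j) (h.memLp_dd j)).1
  have : ∫ x, ‖vv Φ x‖ ^ 4 ≤ ∑ j, ∫ x, ‖Φ j x‖ ^ 4 := by
    rw [← integral_finsetSum _ (fun j _ => i4 j)]
    exact integral_mono (h.memLp4.integrable_norm_pow (p := 4) (by norm_num)) (integrable_finsetSum _ fun j _ => i4 j) fun x => norm_pow_le_sum _ 4 (by norm_num)
  rw [Fin.sum_univ_three] at this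
  have := key 0
  have := key 1
  have := key 2
  linarith

theorem Cl.L6 {Φ : Fin 3 → Pt 2 → ℂ} (h : Cl Φ) :
    ∫ x, ‖vv Φ x‖ ^ 6 ≤ 108 * mass (vv Φ) * (∫ x, tot (jet Φ x)) ^ 2 := by
  have hT : 0 ≤ ∫ x, tot (jet Φ x) := integral_nonneg fun x => tot_nonneg _
  have hM := mass_nonneg (vv Φ)
  have key : ∀ j, (∫ x, ‖Φ j x‖ ^ 6) ≤ 9 * (4 * mass (vv Φ) * ∫ x, tot (jet Φ x)) * ∫ x, tot (jet Φ x) := by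
    intro j
    obtain ⟨b1, b2⟩ := h.comp_bounds j
    refine (lady6 (Φ j) (h.1 j) (h.memLp j) (h.memLp_dd j)).2.trans ?_
    have : 0 ≤ (∫ x, (‖dd 0 (Φ j) x‖ ^ 2 + ‖dd 1 (Φ j) x‖ ^ 2)) := integral_nonneg fun x => by positivity
    have := h.L4.1 j
    gcongr
  have i4 : ∀ j, Integrable (fun x => ‖Φ j x‖ ^ 6) := fun j => (lady6 (Φ j) (h.1 j) (h.memLp j) (h.memLp_dd j)).1
  have : ∫ x, ‖vv Φ x‖ ^ 6 ≤ ∑ j, ∫ x, ‖Φ j x‖ ^ 6 := by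
    rw [← integral_finsetSum _ (fun j _ => i4 j)]
    exact integral_mono (h.memLp6.integrable_norm_pow (p := 6) (by norm_num)) (integrable_finsetSum _ fun j _ => i4 j) fun x => norm_pow_le_sum _ 6 (by norm_num)
  rw [Fin.sum_univ_three] at this
  have := key 0
  have := key 1
  have := key 2
  nlinarith

/-- difference of two triples -/
def df (Φ Ψ : Fin 3 → Pt 2 → ℂ) : Fin 3 → Pt 2 → ℂ := fun j x => Φ j x + ((-1 : ℝ) : ℂ) * Ψ j x
def sm (Φ Ψ : Fin 3 → Pt 2 → ℂ) : Fin 3 → Pt 2 → ℂ := fun j x => Φ j x + Ψ j x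

theorem Cl.df {Φ Ψ : Fin 3 → Pt 2 → ℂ} (h : Cl Φ) (h' : Cl Ψ) : Cl (df Φ Ψ) := h.add (h'.smul (-1))
theorem Cl.sm {Φ Ψ : Fin 3 → Pt 2 → ℂ} (h : Cl Φ) (h' : Cl Ψ) : Cl (sm Φ Ψ) := h.add h'
theorem jet_df {Φ Ψ : Fin 3 → Pt 2 → ℂ} (h : Cl Φ) (h' : Cl Ψ) (x : Pt 2) : jet (df Φ Ψ) x = jet Φ x - jet Ψ x := by
  have := congrFun (jet_add h.1 (h'.smul (-1)).1) x
  simp only [jet_smul'] at this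
  unfold _root_.df
  rw [this]; simp [sub_eq_add_neg]
theorem jet_sm {Φ Ψ : Fin 3 → Pt 2 → ℂ} (h : Cl Φ) (h' : Cl Ψ) (x : Pt 2) : jet (sm Φ Ψ) x = jet Φ x + jet Ψ x := by
  exact congrFun (jet_add h.1 h'.1) x
theorem vv_df (Φ Ψ : Fin 3 → Pt 2 → ℂ) (x : Pt 2) : vv (df Φ Ψ) x = vv Φ x - vv Ψ x := by
  ext j; simp [vv, df, sub_eq_add_neg]
theorem vv_sm (Φ Ψ : Fin 3 → Pt 2 → ℂ) (x : Pt 2) : vv (sm Φ Ψ) x = vv Φ x + vv Ψ x := rfl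

theorem nsq_par (a b : Z3) : nsq (a - b) + nsq (a + b) = 2 * nsq a + 2 * nsq b := by
  rw [nsq_sub, nsq_add]; ring
theorem tot_par (a b : W5) : tot (a - b) + tot (a + b) = 2 * tot a + 2 * tot b := by
  simp only [tot, Pi.sub_apply, Pi.add_apply, Finset.mul_sum, ← Finset.sum_add_distrib, nsq_par]
theorem qq_par (Ω γ γx γy : ℝ) (a b : W5) : qq Ω γ γx γy (a - b) + qq Ω γ γx γy (a + b) = 2 * qq Ω γ γx γy a + 2 * qq Ω γ γx γy b := by
  have h := qq_add Ω γ γx γy a ((-1 : ℝ) • b)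
  rw [qq_smul, sH_smul_left, re_ofReal_mul] at h
  rw [sub_eq_add_neg, show -b = (-1 : ℝ) • b by simp, h, qq_add]; ring

theorem Cl.tot_df {Φ Ψ : Fin 3 → Pt 2 → ℂ} (h : Cl Φ) (h' : Cl Ψ) :
    ∫ x, tot (jet (_root_.df Φ Ψ) x) ≤ 2 * (∫ x, tot (jet Φ x)) + 2 * ∫ x, tot (jet Ψ x) := by
  have i1 := h.i2 tot_cont tot_smul
  have i2 := h'.i2 tot_cont tot_smul
  rw [← integral_const_mul, ← integral_const_mul, ← integral_add (i1.const_mul 2) (i2.const_mul 2)]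
  refine integral_mono ((h.df h').i2 tot_cont tot_smul) ((i1.const_mul 2).add (i2.const_mul 2)) fun x => ?_
  have := tot_par (jet Φ x) (jet Ψ x)
  have := tot_nonneg (jet Φ x + jet Ψ x)
  simp only [jet_df h h', Pi.add_apply]
  linarith

theorem tend_sum {E : Type*} [NormedAddCommGroup E] (p : ℕ) (hp : p ≠ 0) (u : ℕ → Pt 2 → E) (v : Pt 2 → E) (hu : ∀ n, MemLp (u n) p) (hv : MemLp v p)
    (h : Filter.Tendsto (fun n => ∫ x, ‖u n x - v x‖ ^ p) Filter.atTop (𝓝 0)) :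
    Filter.Tendsto (fun n : ℕ × ℕ => ∫ x, ‖(u n.1 x + u n.2 x) - (v x + v x)‖ ^ p) Filter.atTop (𝓝 0) := by
  have : Fact ((1 : ℝ≥0∞) ≤ p) := ⟨by exact_mod_cast Nat.one_le_iff_ne_zero.2 hp⟩
  rw [← eLp_tend (fun (n : ℕ × ℕ) x => (u n.1 x + u n.2 x) - (v x + v x)) p hp (fun n => ((hu _).add (hu _)).sub (hv.add hv))]
  rw [← eLp_tend (fun (n : ℕ) x => u n x - v x) p hp (fun n => (hu _).sub hv)] at h
  rw [← Filter.prod_atTop_atTop_eq]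
  have h1 := (h.comp (Filter.tendsto_fst (g := Filter.atTop (α := ℕ)))).add (h.comp (Filter.tendsto_snd (f := Filter.atTop (α := ℕ))))
  simp only [add_zero] at h1
  refine tendsto_of_tendsto_of_tendsto_of_le_of_le tendsto_const_nhds h1 (fun n => zero_le) (fun n => ?_)
  have e : (fun x => (u n.1 x + u n.2 x) - (v x + v x)) = (fun x => u n.1 x - v x) + fun x => u n.2 x - v x := by
    ext x; simp; abel
  simp only [e]
  exact eLpNorm_add_le ((hu _).sub hv).1 ((hu _).sub hv).1 (Fact.out)
end

section
open scoped ContDiff ENNReal Topology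

theorem mass_df (Φ Ψ : Fin 3 → Pt 2 → ℂ) : mass (vv (df Φ Ψ)) = ∫ x, nsq (vv Φ x - vv Ψ x) := by
  simp only [mass, vv_df]

theorem mass_par {Φ Ψ : Fin 3 → Pt 2 → ℂ} (h : Cl Φ) (h' : Cl Ψ) :
    mass (vv (df Φ Ψ)) + mass (vv (sm Φ Ψ)) = 2 * mass (vv Φ) + 2 * mass (vv Ψ) := by
  unfold mass
  rw [← integral_add (h.df h').mass_int (h.sm h').mass_int, ← integral_const_mul, ← integral_const_mul,
    ← integral_add (h.mass_int.const_mul 2) (h'.mass_int.const_mul 2)]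
  simp only [vv_df, vv_sm, nsq_par]

theorem Cl.qq_int {Φ : Fin 3 → Pt 2 → ℂ} (h : Cl Φ) (Ω γ γx γy : ℝ) : Integrable (fun x => qq Ω γ γx γy (jet Φ x)) :=
  h.i2 (qq_cont Ω γ γx γy) (fun t w => by rw [qq_smul]; rfl)

theorem qint_par {Φ Ψ : Fin 3 → Pt 2 → ℂ} (h : Cl Φ) (h' : Cl Ψ) (Ω γ γx γy : ℝ) :
    (∫ x, qq Ω γ γx γy (jet (df Φ Ψ) x)) + (∫ x, qq Ω γ γx γy (jet (sm Φ Ψ) x)) = 2 * (∫ x, qq Ω γ γx γy (jet Φ x)) + 2 * (∫ x, qq Ω γ γx γy (jet Ψ x)) := by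
  rw [← integral_add ((h.df h').qq_int _ _ _ _) ((h.sm h').qq_int _ _ _ _), ← integral_const_mul, ← integral_const_mul,
    ← integral_add ((h.qq_int _ _ _ _).const_mul 2) ((h'.qq_int _ _ _ _).const_mul 2)]
  simp only [jet_df h h', jet_sm h h', qq_par]

theorem nn_bd (c0 c1 : ℝ) : ∃ C : ℝ, 0 ≤ C ∧ ∀ z, ‖nn c0 c1 z‖ ≤ C * ‖z‖ ^ 4 :=
  hom_bound (nn c0 c1) (nn_cont c0 c1) 4 (fun t z => by rw [nn_smul]; rfl)

/-- values converge in `L²`, `L⁴`, `L⁶` -/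
theorem vals_conv (Φ : ℕ → Fin 3 → Pt 2 → ℂ) (hC : ∀ n, Cl (Φ n)) (K : ℝ) (hK : ∀ n, ∫ x, tot (jet (Φ n) x) ≤ K)
    (hc : Filter.Tendsto (fun n : ℕ × ℕ => mass (vv (df (Φ n.1) (Φ n.2)))) Filter.atTop (𝓝 0)) :
    ∃ φ : Pt 2 → Z3, MemLp φ 2 ∧ MemLp φ 4 ∧ MemLp φ 6 ∧ TendstoInMeasure volume (fun n => vv (Φ n)) Filter.atTop φ ∧
      Filter.Tendsto (fun n => ∫ x, ‖vv (Φ n) x - φ x‖ ^ 2) Filter.atTop (𝓝 0) ∧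
      Filter.Tendsto (fun n => ∫ x, ‖vv (Φ n) x - φ x‖ ^ 4) Filter.atTop (𝓝 0) := by
  have hT : ∀ n : ℕ × ℕ, ∫ x, tot (jet (df (Φ n.1) (Φ n.2)) x) ≤ 4 * K := fun n => by
    have := (hC n.1).tot_df (hC n.2)
    linarith [hK n.1, hK n.2]
  have hT0 : ∀ n : ℕ × ℕ, 0 ≤ ∫ x, tot (jet (df (Φ n.1) (Φ n.2)) x) := fun n => integral_nonneg fun x => tot_nonneg _
  have hM := fun n : ℕ × ℕ => mass_nonneg (vv (df (Φ n.1) (Φ n.2)))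
  obtain ⟨φ, a1, a2, a3⟩ := complete_p 2 (by norm_num) (fun n => vv (Φ n)) (fun n => (hC n).memLp2) (by
    refine squeeze_zero (fun n => integral_nonneg fun x => by positivity) (fun n => ?_) hc
    rw [mass_df]
    refine integral_mono (((hC n.1).memLp2.sub (hC n.2).memLp2).integrable_norm_pow (p := 2) (by norm_num)) ?_ (fun x => norm_sq_le_nsq _)
    have := ((hC n.1).df (hC n.2)).mass_int
    simpa only [vv_df] using this)
  obtain ⟨φ4, b1, b2, b3⟩ := complete_p 4 (by norm_num) (fun n => vv (Φ n)) (fun n => (hC n).memLp4) (by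
    have h1 := hc.const_mul (48 * K)
    rw [mul_zero] at h1
    refine squeeze_zero (fun n => integral_nonneg fun x => by positivity) (fun n => ?_) h1
    have := ((hC n.1).df (hC n.2)).L4.2
    simp only [vv_df] at this
    refine this.trans ?_
    have := mul_le_mul_of_nonneg_left (hT n) (hM n)
    linarith)
  obtain ⟨φ6, d1, d2, d3⟩ := complete_p 6 (by norm_num) (fun n => vv (Φ n)) (fun n => (hC n).memLp6) (by
    have h1 := hc.const_mul (108 * (4 * K) ^ 2)
    rw [mul_zero] at h1
    refine squeeze_zero (fun n => integral_nonneg fun x => by positivity) (fun n => ?_) h1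
    have := ((hC n.1).df (hC n.2)).L6
    simp only [vv_df] at this
    refine this.trans ?_
    have := mul_le_mul_of_nonneg_left (pow_le_pow_left₀ (hT0 n) (hT n) 2) (hM n)
    linarith)
  have e4 : φ4 =ᵐ[volume] φ := tendstoInMeasure_ae_unique b3 a3
  have e6 : φ6 =ᵐ[volume] φ := tendstoInMeasure_ae_unique d3 a3
  refine ⟨φ, a1, b1.ae_eq e4, d1.ae_eq e6, a3, a2, ?_⟩
  refine b2.congr fun n => integral_congr_ae ?_
  filter_upwards [e4] with x hx
  rw [hx]

/-- convergence of the quartic part -/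
theorem nn_conv (c0 c1 : ℝ) {ι : Type*} {l : Filter ι} [l.IsCountablyGenerated] (u : ι → Pt 2 → Z3) (φ : Pt 2 → Z3)
    (u2 : ∀ i, MemLp (u i) 2) (u4 : ∀ i, MemLp (u i) 4) (p2 : MemLp φ 2) (p4 : MemLp φ 4)
    (t2 : Filter.Tendsto (fun n => ∫ x, ‖u n x - φ x‖ ^ 2) l (𝓝 0))
    (t4 : Filter.Tendsto (fun n => ∫ x, ‖u n x - φ x‖ ^ 4) l (𝓝 0)) :
    Filter.Tendsto (fun n => ∫ x, nn c0 c1 (u n x)) l (𝓝 (∫ x, nn c0 c1 (φ x))) := by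
  obtain ⟨D, hD0, hD⟩ := nn_bd c0 c1
  have hD' : ∀ z : Z3, ‖nn c0 c1 z‖ ≤ D * (‖z‖ ^ 4 + ‖z‖ ^ 2) := fun z => (hD z).trans (by
    have : 0 ≤ ‖z‖ ^ 2 := by positivity
    gcongr; linarith)
  exact (conv (ContinuousLinearMap.id ℝ Z3) u φ u2 p2 u4 p4
    t2 t4 (fun _ => nn c0 c1) (fun _ => nn_cont c0 c1) (fun n => (nn_cont c0 c1).comp_aestronglyMeasurable (u2 n).1)
    ((nn_cont c0 c1).comp_aestronglyMeasurable p2.1) D hD0 (fun _ => hD')).2.2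

set_option maxHeartbeats 400000 in
theorem jets_cauchy (c0 c1 Ω γ γx γy m : ℝ) (hγx : 0 < γx) (hγy : 0 < γy) (hΩ : |Ω| < min γx γy)
    (hm : ∀ Φ, Cl Φ → mass (vv Φ) = 1 → m ≤ EE c0 c1 Ω γ γx γy Φ)
    (Φ : ℕ → Fin 3 → Pt 2 → ℂ) (hC : ∀ n, Cl (Φ n)) (h1 : ∀ n, mass (vv (Φ n)) = 1)
    (hE : Filter.Tendsto (fun n => EE c0 c1 Ω γ γx γy (Φ n)) Filter.atTop (𝓝 m))
    (hc : Filter.Tendsto (fun n : ℕ × ℕ => mass (vv (df (Φ n.1) (Φ n.2)))) Filter.atTop (𝓝 0))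
    (φ : Pt 2 → Z3) (p2 : MemLp φ 2) (p4 : MemLp φ 4)
    (t2 : Filter.Tendsto (fun n => ∫ x, ‖vv (Φ n) x - φ x‖ ^ 2) Filter.atTop (𝓝 0))
    (t4 : Filter.Tendsto (fun n => ∫ x, ‖vv (Φ n) x - φ x‖ ^ 4) Filter.atTop (𝓝 0)) :
    Filter.Tendsto (fun n : ℕ × ℕ => ∫ x, ‖jet (Φ n.1) x - jet (Φ n.2) x‖ ^ 2) Filter.atTop (𝓝 0) := by
  obtain ⟨c, C, hcp, hC0, hco⟩ := qq_coer Ω γ γx γy hγx hγy hΩ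
  have N1 := nn_conv c0 c1 (fun n => vv (Φ n)) φ (fun n => (hC n).memLp2) (fun n => (hC n).memLp4) p2 p4 t2 t4
  have s2 := tend_sum 2 (by norm_num) (fun n => vv (Φ n)) φ (fun n => (hC n).memLp2) p2 t2
  have s4 := tend_sum 4 (by norm_num) (fun n => vv (Φ n)) φ (fun n => (hC n).memLp4) p4 t4
  have N2 := nn_conv c0 c1 (fun n : ℕ × ℕ => fun x => vv (Φ n.1) x + vv (Φ n.2) x) (fun x => φ x + φ x)
    (fun n => (hC n.1).memLp2.add (hC n.2).memLp2) (fun n => (hC n.1).memLp4.add (hC n.2).memLp4) (p2.add p2) (p4.add p4) s2 s4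
  have e16 : ∫ x, nn c0 c1 (φ x + φ x) = 16 * ∫ x, nn c0 c1 (φ x) := by
    rw [← integral_const_mul]
    congr 1; ext x
    rw [← two_smul ℝ, nn_smul]; norm_num
  rw [e16] at N2
  set N := ∫ x, nn c0 c1 (φ x) with hN
  have hQ : Filter.Tendsto (fun n => ∫ x, qq Ω γ γx γy (jet (Φ n) x)) Filter.atTop (𝓝 (m - N)) := by
    refine (hE.sub N1).congr fun n => ?_
    simp [EE]
  have hS : Filter.Tendsto (fun n : ℕ × ℕ => mass (vv (sm (Φ n.1) (Φ n.2)))) Filter.atTop (𝓝 4) := by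
    have := hc.const_sub 4
    rw [sub_zero] at this
    refine this.congr fun n => ?_
    have := mass_par (hC n.1) (hC n.2)
    rw [h1, h1] at this
    linarith
  have f1 : Filter.Tendsto (fun n : ℕ × ℕ => n.1) Filter.atTop Filter.atTop := by
    rw [← Filter.prod_atTop_atTop_eq]; exact Filter.tendsto_fst
  have f2 : Filter.Tendsto (fun n : ℕ × ℕ => n.2) Filter.atTop Filter.atTop := by
    rw [← Filter.prod_atTop_atTop_eq]; exact Filter.tendsto_snd
  have R := ((((((hQ.comp f1).const_mul 2).add ((hQ.comp f2).const_mul 2)).sub (hS.const_mul m)).add (N2.div hS (by norm_num))).add (hc.const_mul C)).const_mul c⁻¹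
  have e0 : c⁻¹ * (2 * (m - N) + 2 * (m - N) - m * 4 + 16 * N / 4 + C * 0) = 0 := by ring
  rw [e0] at R
  refine tendsto_of_tendsto_of_tendsto_of_le_of_le' tendsto_const_nhds R (Filter.Eventually.of_forall fun n => integral_nonneg fun x => by positivity) ?_
  filter_upwards [hS.eventually (lt_mem_nhds (show (0 : ℝ) < 4 by norm_num))] with n hn
  have hdf := (hC n.1).df (hC n.2)
  have hsm := (hC n.1).sm (hC n.2)
  have s := scaled c0 c1 Ω γ γx γy m hm _ hsm
  have par := qint_par (hC n.1) (hC n.2) Ω γ γx γy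
  have l1 : c * (∫ x, tot (jet (df (Φ n.1) (Φ n.2)) x)) ≤ (∫ x, qq Ω γ γx γy (jet (df (Φ n.1) (Φ n.2)) x)) + C * mass (vv (df (Φ n.1) (Φ n.2))) := by
    unfold mass
    rw [← integral_const_mul, ← integral_const_mul, ← integral_add (hdf.qq_int _ _ _ _) (hdf.mass_int.const_mul C)]
    exact integral_mono ((hdf.i2 tot_cont tot_smul).const_mul c) ((hdf.qq_int _ _ _ _).add (hdf.mass_int.const_mul C)) fun x => hco _
  have l2 : (∫ x, ‖jet (Φ n.1) x - jet (Φ n.2) x‖ ^ 2) ≤ ∫ x, tot (jet (df (Φ n.1) (Φ n.2)) x) := by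
    refine integral_mono (((hC n.1).2.sub (hC n.2).2).integrable_norm_pow (p := 2) (by norm_num)) (hdf.i2 tot_cont tot_smul) fun x => ?_
    simp only [jet_df (hC n.1) (hC n.2)]
    exact norm_sq_le_tot _
  have l3 : m * mass (vv (sm (Φ n.1) (Φ n.2))) ≤ (∫ x, qq Ω γ γx γy (jet (sm (Φ n.1) (Φ n.2)) x)) + (∫ x, nn c0 c1 (vv (Φ n.1) x + vv (Φ n.2) x)) / mass (vv (sm (Φ n.1) (Φ n.2))) := by
    have e : ∫ x, nn c0 c1 (vv (Φ n.1) x + vv (Φ n.2) x) = ∫ x, nn c0 c1 (vv (sm (Φ n.1) (Φ n.2)) x) := rfl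
    rw [e, ← sub_le_iff_le_add', le_div_iff₀ hn]
    linarith
  have l4 : c * (∫ x, ‖jet (Φ n.1) x - jet (Φ n.2) x‖ ^ 2) ≤ c * ∫ x, tot (jet (df (Φ n.1) (Φ n.2)) x) := by gcongr
  rw [le_inv_mul_iff₀ hcp]
  simp only [Function.comp_def, Pi.div_apply]
  linarith
end

section
open scoped ContDiff ENNReal Topology

/-- strong convergence of jets -/
structure LimD (Φ : ℕ → Fin 3 → Pt 2 → ℂ) (Ψ : Pt 2 → W5) : Prop where
  cl : ∀ n, Cl (Φ n)
  m2 : MemLp Ψ 2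
  m4 : MemLp (fun x => Ψ x 0) 4
  t2 : Filter.Tendsto (fun n => ∫ x, ‖jet (Φ n) x - Ψ x‖ ^ 2) Filter.atTop (𝓝 0)
  t4 : Filter.Tendsto (fun n => ∫ x, ‖vv (Φ n) x - Ψ x 0‖ ^ 4) Filter.atTop (𝓝 0)

def pr0 : W5 →L[ℝ] Z3 := ContinuousLinearMap.proj 0

theorem LimD.cv {Φ : ℕ → Fin 3 → Pt 2 → ℂ} {Ψ : Pt 2 → W5} (h : LimD Φ Ψ) {F : Type*} [NormedAddCommGroup F] [NormedSpace ℝ F]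
    (G : Pt 2 → W5 → F) (hG : Continuous (fun p : Pt 2 × W5 => G p.1 p.2)) (C : ℝ) (hC : 0 ≤ C)
    (hb : ∀ x w, ‖G x w‖ ≤ C * (‖w 0‖ ^ 4 + ‖w‖ ^ 2)) :
    (∀ i, Integrable (fun x => G x (jet (Φ i) x))) ∧ Integrable (fun x => G x (Ψ x)) ∧
    Filter.Tendsto (fun i => ∫ x, G x (jet (Φ i) x)) Filter.atTop (𝓝 (∫ x, G x (Ψ x))) := by
  refine conv pr0 (fun n => jet (Φ n)) Ψ (fun n => (h.cl n).2) h.m2 (fun n => (h.cl n).memLp4) h.m4 h.t2 h.t4 G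
    (fun x => hG.comp (Continuous.prodMk_right x)) (fun n => ?_) ?_ C hC hb
  · exact hG.comp_aestronglyMeasurable (continuous_id.aestronglyMeasurable.prodMk (h.cl n).2.1)
  · exact hG.comp_aestronglyMeasurable (continuous_id.aestronglyMeasurable.prodMk h.m2.1)

theorem LimD.quad {Φ : ℕ → Fin 3 → Pt 2 → ℂ} {Ψ : Pt 2 → W5} (h : LimD Φ Ψ) {F : Type*} [NormedAddCommGroup F] [NormedSpace ℝ F]
    (G : W5 → F) (hG : Continuous G) (hh : ∀ (t : ℝ) w, G (t • w) = t ^ 2 • G w) :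
    Integrable (fun x => G (Ψ x)) ∧
    Filter.Tendsto (fun i => ∫ x, G (jet (Φ i) x)) Filter.atTop (𝓝 (∫ x, G (Ψ x))) := by
  obtain ⟨C, hC, hb⟩ := hom_bound G hG 2 hh
  refine (h.cv (fun _ => G) (hG.comp continuous_snd) C hC fun x w => (hb w).trans ?_).2
  have : 0 ≤ ‖w 0‖ ^ 4 := by positivity
  gcongr; linarith

theorem LimD.quart {Φ : ℕ → Fin 3 → Pt 2 → ℂ} {Ψ : Pt 2 → W5} (h : LimD Φ Ψ) {F : Type*} [NormedAddCommGroup F] [NormedSpace ℝ F]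
    (G : Z3 → F) (hG : Continuous G) (hh : ∀ (t : ℝ) w, G (t • w) = t ^ 4 • G w) :
    Integrable (fun x => G (Ψ x 0)) ∧
    Filter.Tendsto (fun i => ∫ x, G (vv (Φ i) x)) Filter.atTop (𝓝 (∫ x, G (Ψ x 0))) := by
  obtain ⟨C, hC, hb⟩ := hom_bound G hG 4 hh
  refine (h.cv (fun _ w => G (w 0)) (hG.comp ((ev_cont 0).comp continuous_snd)) C hC fun x w => (hb _).trans ?_).2
  have : 0 ≤ ‖w‖ ^ 2 := by positivity
  gcongr; linarith

theorem LimD.mass {Φ : ℕ → Fin 3 → Pt 2 → ℂ} {Ψ : Pt 2 → W5} (h : LimD Φ Ψ) :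
    Integrable (fun x => nsq (Ψ x 0)) ∧ Filter.Tendsto (fun n => mass (vv (Φ n))) Filter.atTop (𝓝 (mass fun x => Ψ x 0)) :=
  h.quad (fun w => nsq (w 0)) (nsq_ev_cont 0) (fun t w => nsq_smul t (w 0))
theorem LimD.qq (Ω γ γx γy : ℝ) {Φ : ℕ → Fin 3 → Pt 2 → ℂ} {Ψ : Pt 2 → W5} (h : LimD Φ Ψ) :
    Integrable (fun x => qq Ω γ γx γy (Ψ x)) ∧ Filter.Tendsto (fun n => ∫ x, _root_.qq Ω γ γx γy (jet (Φ n) x)) Filter.atTop (𝓝 (∫ x, _root_.qq Ω γ γx γy (Ψ x))) :=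
  h.quad (_root_.qq Ω γ γx γy) (qq_cont Ω γ γx γy) (fun t w => qq_smul Ω γ γx γy t w)
theorem LimD.nn (c0 c1 : ℝ) {Φ : ℕ → Fin 3 → Pt 2 → ℂ} {Ψ : Pt 2 → W5} (h : LimD Φ Ψ) :
    Integrable (fun x => nn c0 c1 (Ψ x 0)) ∧ Filter.Tendsto (fun n => ∫ x, _root_.nn c0 c1 (vv (Φ n) x)) Filter.atTop (𝓝 (∫ x, _root_.nn c0 c1 (Ψ x 0))) :=
  h.quart (_root_.nn c0 c1) (nn_cont c0 c1) (fun t w => nn_smul c0 c1 t w)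

theorem LimD.addC {Φ : ℕ → Fin 3 → Pt 2 → ℂ} {Ψ : Pt 2 → W5} (h : LimD Φ Ψ) {ψ : Fin 3 → Pt 2 → ℂ} (hψ : Cl ψ) :
    LimD (fun n => sm (Φ n) ψ) (fun x => Ψ x + jet ψ x) where
  cl n := (h.cl n).sm hψ
  m2 := h.m2.add hψ.2
  m4 := h.m4.add hψ.memLp4
  t2 := by simpa only [jet_sm (h.cl _) hψ, add_sub_add_right_eq_sub] using h.t2
  t4 := by simpa only [vv_sm, Pi.add_apply, jet0, add_sub_add_right_eq_sub] using h.t4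

theorem LimD.xs {Φ : ℕ → Fin 3 → Pt 2 → ℂ} {Ψ : Pt 2 → W5} (h : LimD Φ Ψ) :
    ∀ᵐ x, ∀ j, Ψ x 3 j = (x 0 : ℂ) * Ψ x 0 j ∧ Ψ x 4 j = (x 1 : ℂ) * Ψ x 0 j := by
  obtain ⟨ms, -, hms⟩ := ae_subseq (fun n => jet (Φ n)) Ψ (fun n => (h.cl n).2.sub h.m2) h.t2
  filter_upwards [hms] with x hx j
  have e : ∀ k, Filter.Tendsto (fun n => jet (Φ (ms n)) x k j) Filter.atTop (𝓝 (Ψ x k j)) := fun k =>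
    (((continuous_apply j).comp (ev_cont k)).tendsto (Ψ x)).comp hx
  exact ⟨tendsto_nhds_unique (e 3) ((e 0).const_mul _), tendsto_nhds_unique (e 4) ((e 0).const_mul _)⟩

theorem exists_limit (c0 c1 Ω γ γx γy : ℝ) (hγx : 0 < γx) (hγy : 0 < γy) (hΩ : |Ω| < min γx γy) (hc0 : -Cb < c0) (hc01 : -Cb < c0 + c1) :
    ∃ (m : ℝ) (Φ : ℕ → Fin 3 → Pt 2 → ℂ) (Ψ : Pt 2 → W5), (∀ Φ, Cl Φ → mass (vv Φ) = 1 → m ≤ EE c0 c1 Ω γ γx γy Φ) ∧ LimD Φ Ψ ∧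
      MemLp (fun x => Ψ x 0) 6 ∧ mass (fun x => Ψ x 0) = 1 ∧ (∫ x, qq Ω γ γx γy (Ψ x)) + (∫ x, nn c0 c1 (Ψ x 0)) = m := by
  obtain ⟨c, C, hc, hC, hco⟩ := coer c0 c1 Ω γ γx γy hγx hγy hΩ hc0 hc01
  have hbd : BddBelow (SS c0 c1 Ω γ γx γy) := by
    refine ⟨-C, ?_⟩
    rintro _ ⟨Φ, h1, h2, rfl⟩
    have := hco Φ h1 h2
    have h3 : 0 ≤ c * ∫ x, tot (jet Φ x) := mul_nonneg hc.le (integral_nonneg fun x => tot_nonneg _)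
    unfold EE
    linarith
  obtain ⟨u, -, hu, huS⟩ := exists_seq_tendsto_sInf (SS_nonempty c0 c1 Ω γ γx γy) hbd
  set m := sInf (SS c0 c1 Ω γ γx γy)
  have hm : ∀ Φ, Cl Φ → mass (vv Φ) = 1 → m ≤ EE c0 c1 Ω γ γx γy Φ := fun Φ h1 h2 => csInf_le hbd ⟨Φ, h1, h2, rfl⟩
  choose Φ hCl hma hE using huS
  obtain ⟨B, hB⟩ := hu.bddAbove_range
  have hK : ∀ n, ∫ x, tot (jet (Φ n) x) ≤ c⁻¹ * (B + C) := fun n => by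
    have h1 := hco _ (hCl n) (hma n)
    have h2 : u n ≤ B := hB ⟨n, rfl⟩
    rw [hE n, EE] at h2
    rw [le_inv_mul_iff₀ hc]
    linarith
  obtain ⟨σ, hσ, hσc⟩ := cauchy3 Φ hCl _ hK
  have hc' : Filter.Tendsto (fun n : ℕ × ℕ => mass (vv (df (Φ (σ n.1)) (Φ (σ n.2))))) Filter.atTop (𝓝 0) := by
    simpa only [mass_df] using hσc
  have hE' : Filter.Tendsto (fun n => EE c0 c1 Ω γ γx γy (Φ (σ n))) Filter.atTop (𝓝 m) := by
    simpa only [Function.comp_def, hE] using hu.comp hσ.tendsto_atTop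
  obtain ⟨φ, p2, p4, p6, pm, t2, t4⟩ := vals_conv (fun n => Φ (σ n)) (fun n => hCl _) _ (fun n => hK _) hc'
  have hj := jets_cauchy c0 c1 Ω γ γx γy m hγx hγy hΩ hm (fun n => Φ (σ n)) (fun n => hCl _) (fun n => hma _) hE' hc' φ p2 p4 t2 t4
  obtain ⟨Ψ, q2, qt, qm⟩ := complete_p 2 (by norm_num) (fun n => jet (Φ (σ n))) (fun n => (hCl _).2) hj
  have qm0 : TendstoInMeasure volume (fun n => vv (Φ (σ n))) Filter.atTop (fun x => Ψ x 0) := by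
    intro ε hε
    refine tendsto_of_tendsto_of_tendsto_of_le_of_le tendsto_const_nhds (qm ε hε) (fun _ => zero_le) (fun n => measure_mono fun x hx => ?_)
    exact le_trans hx (edist_le_pi_edist (jet (Φ (σ n)) x) (Ψ x) 0)
  have e0 : φ =ᵐ[volume] (fun x => Ψ x 0) := tendstoInMeasure_ae_unique pm qm0
  have L : LimD (fun n => Φ (σ n)) Ψ := by
    refine ⟨fun n => hCl _, q2, p4.ae_eq e0, qt, t4.congr fun n => integral_congr_ae ?_⟩
    filter_upwards [e0] with x hx
    rw [hx]
  refine ⟨m, fun n => Φ (σ n), Ψ, hm, L, p6.ae_eq e0, ?_, ?_⟩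
  · refine tendsto_nhds_unique L.mass.2 ?_
    simp only [hma]; exact tendsto_const_nhds
  · exact tendsto_nhds_unique ((L.qq Ω γ γx γy).2.add (L.nn c0 c1).2) hE'
end

section
open scoped ContDiff ENNReal Topology

theorem Tst.memLp2 {θ : Pt 2 → ℂ} (h : Tst θ) : MemLp θ 2 := h.1.continuous.memLp_of_hasCompactSupport h.2
theorem tint {f θ : Pt 2 → ℂ} (hf : MemLp f 2) (h : Tst θ) : Integrable (fun x => f x * θ x) := hf.integrable_mul h.memLp2

theorem ibp {f : Pt 2 → ℂ} (hf : Differentiable ℝ f) {θ : Pt 2 → ℂ} (h : Tst θ) (k : Fin 2)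
    (i1 : Integrable (fun x => dd k f x * θ x)) :
    ∫ x, f x * dd k θ x = - ∫ x, dd k f x * θ x := by
  have hc : ∀ η, Tst η → Integrable (fun x => f x * η x) := fun η hη =>
    (hf.continuous.mul hη.1.continuous).integrable_of_hasCompactSupport hη.2.mul_left
  exact integral_mul_fderiv_eq_neg_fderiv_mul_of_integrable i1 (hc _ (h.dd k)) (hc _ h) (fun x _ => hf x) (fun x _ => smooth_diff h.1 x)

theorem lin_conv (u : ℕ → Pt 2 → ℂ) (v : Pt 2 → ℂ) (hu : ∀ n, MemLp (u n) 2) (hv : MemLp v 2)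
    (ht : Filter.Tendsto (fun n => ∫ x, ‖u n x - v x‖ ^ 2) Filter.atTop (𝓝 0)) {θ : Pt 2 → ℂ} (h : Tst θ) :
    Filter.Tendsto (fun n => ∫ x, u n x * θ x) Filter.atTop (𝓝 (∫ x, v x * θ x)) := by
  have mm : ∀ w : Pt 2 → ℂ, MemLp w 2 → MemLp (fun x => (w x, θ x)) 2 := fun w hw => by
    refine (hw.norm.add h.memLp2.norm).mono' (hw.1.prodMk h.memLp2.1) (Filter.Eventually.of_forall fun x => ?_)
    exact max_le_add_of_nonneg (norm_nonneg _) (norm_nonneg _)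
  refine (conv (0 : (ℂ × ℂ) →L[ℝ] ℂ) (fun n x => (u n x, θ x)) (fun x => (v x, θ x)) (fun n => mm _ (hu n)) (mm _ hv)
    (fun n => by simp) (by simp) ?_ (by simp) (fun _ p => p.1 * p.2) (fun _ => by fun_prop) (fun n => (tint (hu n) h).1)
    (tint hv h).1 1 zero_le_one (fun x w => ?_)).2.2
  · refine ht.congr fun n => integral_congr_ae (Filter.Eventually.of_forall fun x => ?_)
    simp [Prod.norm_def]
  · rw [norm_mul, one_mul]
    have h1 : ‖w.1‖ ≤ ‖w‖ := norm_fst_le w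
    have h2 : ‖w.2‖ ≤ ‖w‖ := norm_snd_le w
    have : ‖w.1‖ * ‖w.2‖ ≤ ‖w‖ * ‖w‖ := by gcongr
    simp
    nlinarith

theorem LimD.comp {Φ : ℕ → Fin 3 → Pt 2 → ℂ} {Ψ : Pt 2 → W5} (h : LimD Φ Ψ) (k : Fin 5) (j : Fin 3) :
    Filter.Tendsto (fun n => ∫ x, ‖jet (Φ n) x k j - Ψ x k j‖ ^ 2) Filter.atTop (𝓝 0) := by
  refine squeeze_zero (fun n => integral_nonneg fun x => by positivity) (fun n => ?_) h.t2
  have := memLp_W5.1 ((h.cl n).2.sub h.m2) k j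
  refine integral_mono (this.integrable_norm_pow (p := 2) (by norm_num)) (((h.cl n).2.sub h.m2).integrable_norm_pow (p := 2) (by norm_num)) fun x => ?_
  simp only
  gcongr
  exact (norm_le_pi_norm ((jet (Φ n) x - Ψ x) k) j).trans (norm_le_pi_norm (jet (Φ n) x - Ψ x) k)

/-- index of the derivative -/
def ix : Fin 2 → Fin 5 := ![1, 2]
theorem jet_ix (Φ : Fin 3 → Pt 2 → ℂ) (x : Pt 2) (k : Fin 2) (j : Fin 3) : jet Φ x (ix k) j = dd k (Φ j) x := by
  fin_cases k <;> rfl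

theorem LimD.wd {Φ : ℕ → Fin 3 → Pt 2 → ℂ} {Ψ : Pt 2 → W5} (h : LimD Φ Ψ) (k : Fin 2) (j : Fin 3) :
    WD k (fun x => Ψ x 0 j) (fun x => Ψ x (ix k) j) := by
  intro ψ hψ
  have m := fun k n => memLp_W5.1 (h.cl n).2 k j
  have l1 := lin_conv _ _ (m 0) (memLp_W5.1 h.m2 0 j) (h.comp 0 j) (hψ.dd k)
  have l2 := lin_conv _ _ (m (ix k)) (memLp_W5.1 h.m2 (ix k) j) (h.comp (ix k) j) hψ
  refine tendsto_nhds_unique l1 (l2.neg.congr fun n => ?_)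
  simp only [jet_ix]
  exact (ibp ((h.cl n).1 j) hψ k (tint ((h.cl n).memLp_dd j k) hψ)).symm

/-- derivative of a homogeneous cubic map -/
theorem fderiv_cubic (f : Z3 → ℂ) (hf : ContDiff ℝ ∞ f) (hh : ∀ (t : ℝ) z, f (t • z) = t ^ 3 • f z) :
    ∃ C : ℝ, 0 ≤ C ∧ ∀ z, ‖fderiv ℝ f z‖ ≤ C * ‖z‖ ^ 2 := by
  have hd : Differentiable ℝ f := hf.differentiable (by simp)
  have hc : Continuous (fderiv ℝ f) := hf.continuous_fderiv (by simp)
  have key : ∀ t : ℝ, t ≠ 0 → ∀ z, fderiv ℝ f (t • z) = t ^ 2 • fderiv ℝ f z := by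
    intro t ht z
    have h1 : HasFDerivAt (fun z => f (t • z)) ((fderiv ℝ f (t • z)).comp (t • ContinuousLinearMap.id ℝ Z3)) z :=
      (hd (t • z)).hasFDerivAt.comp z ((hasFDerivAt_id z).const_smul t)
    have h2 : HasFDerivAt (fun z => f (t • z)) (t ^ 3 • fderiv ℝ f z) z := by
      simp only [hh]
      exact (hd z).hasFDerivAt.const_smul (t ^ 3)
    have h3 := h1.unique h2
    ext v
    have h4 := congrArg (fun L => L v) h3
    simp only [ContinuousLinearMap.comp_apply, _root_.smul_apply, ContinuousLinearMap.id_apply, map_smul] at h4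
    have h5 : t • ((fderiv ℝ f (t • z)) v) = t • (t ^ 2 • (fderiv ℝ f z v)) := by
      rw [h4, smul_smul]; congr 1; ring
    exact smul_right_injective ℂ ht h5
  refine hom_bound (fderiv ℝ f) hc 2 fun t z => ?_
  rcases eq_or_ne t 0 with rfl | ht
  · have a1 : Filter.Tendsto (fun t : ℝ => fderiv ℝ f (t • z)) (𝓝[≠] 0) (𝓝 (fderiv ℝ f ((0 : ℝ) • z))) := by
      have : Continuous (fun t : ℝ => fderiv ℝ f (t • z)) := by fun_prop
      exact (this.tendsto 0).mono_left nhdsWithin_le_nhds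
    have a2 : Filter.Tendsto (fun t : ℝ => t ^ 2 • fderiv ℝ f z) (𝓝[≠] 0) (𝓝 ((0 : ℝ) ^ 2 • fderiv ℝ f z)) := by
      have : Continuous (fun t : ℝ => t ^ 2 • fderiv ℝ f z) := by fun_prop
      exact (this.tendsto 0).mono_left nhdsWithin_le_nhds
    refine tendsto_nhds_unique (a1.congr' ?_) a2
    filter_upwards [self_mem_nhdsWithin] with t ht using key t ht z
  · exact key t ht z

theorem cubic_wd {Φ : ℕ → Fin 3 → Pt 2 → ℂ} {Ψ : Pt 2 → W5} (h : LimD Φ Ψ)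
    (f : Z3 → ℂ) (hf : ContDiff ℝ ∞ f) (hh : ∀ (t : ℝ) z, f (t • z) = t ^ 3 • f z) (k : Fin 2) :
    WD k (fun x => f (Ψ x 0)) (fun x => fderiv ℝ f (Ψ x 0) (Ψ x (ix k))) := by
  intro ψ hψ
  obtain ⟨C, hC, hb⟩ := fderiv_cubic f hf hh
  obtain ⟨C', hC', hb'⟩ := hom_bound f hf.continuous 3 hh
  have hc : Continuous (fderiv ℝ f) := hf.continuous_fderiv (by simp)
  have hd : Differentiable ℝ f := hf.differentiable (by simp)
  obtain ⟨B, hB⟩ := hψ.bdd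
  obtain ⟨B', hB'⟩ := (hψ.dd k).bdd
  have hB0 : 0 ≤ B := (norm_nonneg _).trans (hB 0)
  have hB0' : 0 ≤ B' := (norm_nonneg _).trans (hB' 0)
  have hk : Continuous (fun p : Pt 2 × W5 => p.2 (ix k)) := (ev_cont (ix k)).comp continuous_snd
  have h0 : Continuous (fun p : Pt 2 × W5 => p.2 0) := (ev_cont 0).comp continuous_snd
  have l1 := h.cv (fun x w => f (w 0) * dd k ψ x) ((hf.continuous.comp h0).mul ((hψ.dd k).1.continuous.comp continuous_fst)) (C' * B') (by positivity) (fun x w => by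
    rw [norm_mul]
    have h1 := hb' (w 0)
    have h2 := hB' x
    have h3 : ‖w 0‖ ≤ ‖w‖ := norm_le_pi_norm w 0
    have h4 : ‖w 0‖ ^ 3 ≤ ‖w 0‖ ^ 4 + ‖w‖ ^ 2 := by
      have : ‖w 0‖ ^ 2 ≤ ‖w‖ ^ 2 := by gcongr
      nlinarith [sq_nonneg (‖w 0‖ ^ 2 - ‖w 0‖), norm_nonneg (w 0), sq_nonneg (‖w 0‖ ^ 2), sq_nonneg (‖w 0‖)]
    calc _ ≤ (C' * ‖w 0‖ ^ 3) * B' := by gcongr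
      _ ≤ (C' * (‖w 0‖ ^ 4 + ‖w‖ ^ 2)) * B' := by gcongr
      _ = _ := by ring)
  have l2 := h.cv (fun x w => fderiv ℝ f (w 0) (w (ix k)) * ψ x) (((hc.comp h0).clm_apply hk).mul (hψ.1.continuous.comp continuous_fst)) (C * B) (by positivity) (fun x w => by
    rw [norm_mul]
    have h1 := (fderiv ℝ f (w 0)).le_opNorm (w (ix k))
    have h2 := hB x
    have h3 : ‖w (ix k)‖ ≤ ‖w‖ := norm_le_pi_norm w _
    have h4 : ‖w 0‖ ^ 2 * ‖w‖ ≤ ‖w 0‖ ^ 4 + ‖w‖ ^ 2 := by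
      nlinarith [sq_nonneg (‖w 0‖ ^ 2 - ‖w‖), sq_nonneg (‖w 0‖ ^ 2), sq_nonneg (‖w‖)]
    calc _ ≤ (C * ‖w 0‖ ^ 2 * ‖w‖) * B := by
          gcongr
          exact h1.trans (by gcongr; exact hb _)
      _ = (C * (‖w 0‖ ^ 2 * ‖w‖)) * B := by ring
      _ ≤ (C * (‖w 0‖ ^ 4 + ‖w‖ ^ 2)) * B := by gcongr
      _ = _ := by ring)
  refine tendsto_nhds_unique l1.2.2 (l2.2.2.neg.congr fun n => ?_)
  have hD : ∀ x, HasFDerivAt (fun y => vv (Φ n) y) (ContinuousLinearMap.pi fun j => fderiv ℝ (Φ n j) x) x := fun x =>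
    hasFDerivAt_pi.2 fun j => ((h.cl n).1 j x).hasFDerivAt
  have e : ∀ x, dd k (fun y => f (vv (Φ n) y)) x = fderiv ℝ f (vv (Φ n) x) (jet (Φ n) x (ix k)) := fun x => by
    unfold dd
    have h1 : HasFDerivAt (fun y => f (vv (Φ n) y)) _ x := (hd (vv (Φ n) x)).hasFDerivAt.comp x (hD x)
    rw [h1.fderiv]
    simp only [ContinuousLinearMap.comp_apply]
    congr 1
    ext j
    rw [jet_ix]; rfl
  have := ibp (f := fun y => f (vv (Φ n) y)) (fun x => ((hd _).comp x (hD x).differentiableAt)) hψ k (by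
    simp only [e]; exact l2.1 n)
  simp only [e] at this
  exact this.symm
end

section
open scoped ContDiff ENNReal Topology

/-- the cubic nonlinearity -/
def Tz (c0 c1 : ℝ) (z : Z3) : Z3 := ∑ k, ((cc c0 c1 k * pk k z : ℝ) : ℂ) • PP k z

def rr (k : Fin 4) (p : Z3 × Z3) : ℝ := (ip p.2 (PP k p.1)).re
def n1 (c0 c1 : ℝ) (p : Z3 × Z3) : ℝ := ∑ k, cc c0 c1 k * (4 * pk k p.1 * rr k p)
def n2 (c0 c1 : ℝ) (p : Z3 × Z3) : ℝ := ∑ k, cc c0 c1 k * (4 * rr k p ^ 2 + 2 * pk k p.1 * pk k p.2)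
def n3 (c0 c1 : ℝ) (p : Z3 × Z3) : ℝ := ∑ k, cc c0 c1 k * (4 * rr k p * pk k p.2)

theorem rr_cont (k : Fin 4) : Continuous (rr k) := continuous_re.comp (ip_cont continuous_snd ((PP_cont k).comp continuous_fst))
theorem pk1_cont (k : Fin 4) : Continuous (fun p : Z3 × Z3 => pk k p.1) := (pk_cont k).comp continuous_fst
theorem pk2_cont (k : Fin 4) : Continuous (fun p : Z3 × Z3 => pk k p.2) := (pk_cont k).comp continuous_snd
theorem n1_cont (c0 c1 : ℝ) : Continuous (n1 c0 c1) := by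
  unfold n1; have := rr_cont; have := pk1_cont; have := pk2_cont; fun_prop
theorem n2_cont (c0 c1 : ℝ) : Continuous (n2 c0 c1) := by
  unfold n2; have := rr_cont; have := pk1_cont; have := pk2_cont; fun_prop
theorem n3_cont (c0 c1 : ℝ) : Continuous (n3 c0 c1) := by
  unfold n3; have := rr_cont; have := pk1_cont; have := pk2_cont; fun_prop

theorem PP_rsmul (k : Fin 4) (t : ℝ) (z : Z3) : PP k (t • z) = t • PP k z := by
  have := (PP k).map_smul (t : ℂ) z
  simpa using this

theorem rr_smul (k : Fin 4) (t : ℝ) (p : Z3 × Z3) : rr k (t • p) = t ^ 2 * rr k p := by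
  simp only [rr, Prod.smul_fst, Prod.smul_snd, PP_rsmul, ip_smul_left, ip_smul_right]
  rw [← mul_assoc, ← ofReal_mul, re_ofReal_mul]; ring
theorem n1_smul (c0 c1 t : ℝ) (p : Z3 × Z3) : n1 c0 c1 (t • p) = t ^ 4 • n1 c0 c1 p := by
  simp only [n1, rr_smul, Prod.smul_fst, pk_smul, smul_eq_mul, Finset.mul_sum]
  exact Finset.sum_congr rfl fun _ _ => by ring
theorem n2_smul (c0 c1 t : ℝ) (p : Z3 × Z3) : n2 c0 c1 (t • p) = t ^ 4 • n2 c0 c1 p := by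
  simp only [n2, rr_smul, Prod.smul_fst, Prod.smul_snd, pk_smul, smul_eq_mul, Finset.mul_sum]
  exact Finset.sum_congr rfl fun _ _ => by ring
theorem n3_smul (c0 c1 t : ℝ) (p : Z3 × Z3) : n3 c0 c1 (t • p) = t ^ 4 • n3 c0 c1 p := by
  simp only [n3, rr_smul, Prod.smul_snd, pk_smul, smul_eq_mul, Finset.mul_sum]
  exact Finset.sum_congr rfl fun _ _ => by ring

theorem nn_exp (c0 c1 t : ℝ) (z y : Z3) :
    nn c0 c1 (z + t • y) = nn c0 c1 z + t * n1 c0 c1 (z, y) + t ^ 2 * n2 c0 c1 (z, y) + t ^ 3 * n3 c0 c1 (z, y) + t ^ 4 * nn c0 c1 y := by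
  simp only [nn, n1, n2, n3, pk_add, pk_smul, ip_smul_left, re_ofReal_mul, rr, Finset.mul_sum, ← Finset.sum_add_distrib]
  exact Finset.sum_congr rfl fun _ _ => by ring

theorem n1_eq (c0 c1 : ℝ) (z y : Z3) : n1 c0 c1 (z, y) = (4 * ip y (Tz c0 c1 z)).re := by
  have : ip y (Tz c0 c1 z) = ∑ k, ((cc c0 c1 k * pk k z : ℝ) : ℂ) * ip y (PP k z) := by
    simp only [Tz, Fin.sum_univ_four, ip_add_right, ip_csmul_right]
  rw [this, Finset.mul_sum, re_sum, n1]
  refine Finset.sum_congr rfl fun k _ => ?_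
  rw [show (4 : ℂ) = ((4 : ℝ) : ℂ) by simp, re_ofReal_mul, re_ofReal_mul, rr]; ring

theorem poly_lin (p1 p2 p3 p4 : ℝ) (h : ∀ t : ℝ, 0 ≤ p1 * t + p2 * t ^ 2 + p3 * t ^ 3 + p4 * t ^ 4) : p1 = 0 := by
  have hd : HasDerivAt (fun t : ℝ => p1 * t + p2 * t ^ 2 + p3 * t ^ 3 + p4 * t ^ 4) p1 0 := by
    have := ((((hasDerivAt_id (0 : ℝ)).const_mul p1).add ((hasDerivAt_pow 2 (0 : ℝ)).const_mul p2)).add ((hasDerivAt_pow 3 (0 : ℝ)).const_mul p3)).add ((hasDerivAt_pow 4 (0 : ℝ)).const_mul p4)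
    exact this.congr_deriv (by norm_num)
  refine IsLocalMin.hasDerivAt_eq_zero (Filter.Eventually.of_forall fun t => ?_) hd
  simpa using h t

theorem EL_real (c0 c1 Ω γ γx γy m : ℝ) (hm : ∀ Φ, Cl Φ → mass (vv Φ) = 1 → m ≤ EE c0 c1 Ω γ γx γy Φ)
    {Φ : ℕ → Fin 3 → Pt 2 → ℂ} {Ψ : Pt 2 → W5} (h : LimD Φ Ψ) (h1 : mass (fun x => Ψ x 0) = 1)
    (hE : (∫ x, qq Ω γ γx γy (Ψ x)) + (∫ x, nn c0 c1 (Ψ x 0)) = m) (ψ : Fin 3 → Pt 2 → ℂ) (hψ : Cl ψ) :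
    2 * (∫ x, (sH Ω γ γx γy (jet ψ x) (Ψ x)).re) + (2 * (∫ x, qq Ω γ γx γy (Ψ x)) - 4 * m) * (∫ x, (ip (vv ψ x) (Ψ x 0)).re)
      + (∫ x, (4 * ip (vv ψ x) (Tz c0 c1 (Ψ x 0))).re) = 0 := by
  -- integrability facts
  have m20 : MemLp (fun x => Ψ x 0) 2 := memLp_pi_iff.1 h.m2 0
  have pr4 : MemLp (fun x => (Ψ x 0, vv ψ x)) 4 := by
    refine (h.m4.norm.add hψ.memLp4.norm).mono' (h.m4.1.prodMk hψ.memLp4.1) (Filter.Eventually.of_forall fun x => ?_)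
    exact max_le_add_of_nonneg (norm_nonneg _) (norm_nonneg _)
  have pr2 : MemLp (fun x => (jet ψ x, Ψ x)) 2 := by
    refine (hψ.2.norm.add h.m2.norm).mono' (hψ.2.1.prodMk h.m2.1) (Filter.Eventually.of_forall fun x => ?_)
    exact max_le_add_of_nonneg (norm_nonneg _) (norm_nonneg _)
  have i1 : Integrable (fun x => n1 c0 c1 (Ψ x 0, vv ψ x)) := int_hom 4 (by norm_num) pr4 _ (n1_cont c0 c1) (n1_smul c0 c1)
  have i2 : Integrable (fun x => n2 c0 c1 (Ψ x 0, vv ψ x)) := int_hom 4 (by norm_num) pr4 _ (n2_cont c0 c1) (n2_smul c0 c1)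
  have i3 : Integrable (fun x => n3 c0 c1 (Ψ x 0, vv ψ x)) := int_hom 4 (by norm_num) pr4 _ (n3_cont c0 c1) (n3_smul c0 c1)
  have i4 : Integrable (fun x => nn c0 c1 (vv ψ x)) := hψ.i4 (nn_cont c0 c1) (fun t w => nn_smul c0 c1 t w)
  have i0 : Integrable (fun x => nn c0 c1 (Ψ x 0)) := (h.nn c0 c1).1
  have j0 : Integrable (fun x => qq Ω γ γx γy (Ψ x)) := (h.qq Ω γ γx γy).1
  have j1 : Integrable (fun x => (sH Ω γ γx γy (jet ψ x) (Ψ x)).re) :=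
    int_hom 2 (by norm_num) pr2 (fun p => (sH Ω γ γx γy p.1 p.2).re) (continuous_re.comp (sH_cont Ω γ γx γy)) (fun t p => by
      simp only [Prod.smul_fst, Prod.smul_snd, sH_smul_left, sH_smul_right]
      rw [← mul_assoc, ← ofReal_mul, re_ofReal_mul, smul_eq_mul]; ring)
  have j2 := hψ.qq_int Ω γ γx γy
  have k0 := h.mass.1
  have k1 : Integrable (fun x => (ip (vv ψ x) (Ψ x 0)).re) :=
    int_hom 2 (by norm_num) pr2 (fun p => (ip (p.1 0) (p.2 0)).re) (continuous_re.comp (ip_cont ((ev_cont 0).comp continuous_fst) ((ev_cont 0).comp continuous_snd))) (fun t p => by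
      simp only [Prod.smul_fst, Prod.smul_snd, Pi.smul_apply, ip_smul_left, ip_smul_right]
      rw [← mul_assoc, ← ofReal_mul, re_ofReal_mul, smul_eq_mul]; ring)
  have k2 := hψ.mass_int
  -- names
  set Q := ∫ x, qq Ω γ γx γy (Ψ x) with hQ
  set N := ∫ x, nn c0 c1 (Ψ x 0) with hN
  set q1 := ∫ x, (sH Ω γ γx γy (jet ψ x) (Ψ x)).re with hq1
  set a1 := ∫ x, (ip (vv ψ x) (Ψ x 0)).re with ha1
  set q2 := ∫ x, qq Ω γ γx γy (jet ψ x) with hq2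
  set a2 := mass (vv ψ) with ha2
  simp only [← n1_eq]
  set b1 := ∫ x, n1 c0 c1 (Ψ x 0, vv ψ x) with hb1
  set b2 := ∫ x, n2 c0 c1 (Ψ x 0, vv ψ x) with hb2
  set b3 := ∫ x, n3 c0 c1 (Ψ x 0, vv ψ x) with hb3
  set b4 := ∫ x, nn c0 c1 (vv ψ x) with hb4
  have eA : ∀ t : ℝ, mass (fun x => (Ψ x + t • jet ψ x) 0) = 1 + 2 * t * a1 + t ^ 2 * a2 := fun t => by
    rw [← h1, ha1, ha2]
    unfold mass
    have s1 : Integrable (fun x => nsq (Ψ x 0) + 2 * t * (ip (vv ψ x) (Ψ x 0)).re) := k0.add (k1.const_mul _)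
    rw [← integral_const_mul, ← integral_const_mul, ← integral_add k0 (k1.const_mul _), ← integral_add s1 (k2.const_mul _)]
    congr 1; ext x
    simp only [Pi.add_apply, Pi.smul_apply, jet0, nsq_add, nsq_smul, ip_smul_right, re_ofReal_mul, ip_re_comm (Ψ x 0)]
    ring
  have eQ : ∀ t : ℝ, ∫ x, qq Ω γ γx γy (Ψ x + t • jet ψ x) = Q + 2 * t * q1 + t ^ 2 * q2 := fun t => by
    rw [hQ, hq1, hq2]
    have s1 : Integrable (fun x => qq Ω γ γx γy (Ψ x) + 2 * t * (sH Ω γ γx γy (jet ψ x) (Ψ x)).re) := j0.add (j1.const_mul _)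
    rw [← integral_const_mul, ← integral_const_mul, ← integral_add j0 (j1.const_mul _), ← integral_add s1 (j2.const_mul _)]
    congr 1; ext x
    simp only [qq_add, qq_smul, sH_smul_left, re_ofReal_mul, Pi.add_apply]
    ring
  have eN : ∀ t : ℝ, ∫ x, nn c0 c1 ((Ψ x + t • jet ψ x) 0) = N + t * b1 + t ^ 2 * b2 + t ^ 3 * b3 + t ^ 4 * b4 := fun t => by
    rw [hN, hb1, hb2, hb3, hb4]
    have s1 : Integrable (fun x => nn c0 c1 (Ψ x 0) + t * n1 c0 c1 (Ψ x 0, vv ψ x)) := i0.add (i1.const_mul _)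
    have s2 : Integrable (fun x => nn c0 c1 (Ψ x 0) + t * n1 c0 c1 (Ψ x 0, vv ψ x) + t ^ 2 * n2 c0 c1 (Ψ x 0, vv ψ x)) := s1.add (i2.const_mul _)
    have s3 : Integrable (fun x => nn c0 c1 (Ψ x 0) + t * n1 c0 c1 (Ψ x 0, vv ψ x) + t ^ 2 * n2 c0 c1 (Ψ x 0, vv ψ x) + t ^ 3 * n3 c0 c1 (Ψ x 0, vv ψ x)) := s2.add (i3.const_mul _)
    rw [← integral_const_mul, ← integral_const_mul, ← integral_const_mul, ← integral_const_mul, ← integral_add i0 (i1.const_mul _), ← integral_add s1 (i2.const_mul _),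
      ← integral_add s2 (i3.const_mul _), ← integral_add s3 (i4.const_mul _)]
    congr 1; ext x
    exact nn_exp c0 c1 t _ _
  have hP : ∀ t : ℝ, m * (1 + 2 * t * a1 + t ^ 2 * a2) ^ 2 ≤ (1 + 2 * t * a1 + t ^ 2 * a2) * (Q + 2 * t * q1 + t ^ 2 * q2)
      + (N + t * b1 + t ^ 2 * b2 + t ^ 3 * b3 + t ^ 4 * b4) := fun t => by
    have L := h.addC (hψ.smul t)
    simp only [jet_smul'] at L
    have l := le_of_tendsto_of_tendsto' ((L.mass.2.pow 2).const_mul m) ((L.mass.2.mul (L.qq Ω γ γx γy).2).add (L.nn c0 c1).2)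
      (fun n => scaled c0 c1 Ω γ γx γy m hm _ (L.cl n))
    rwa [eA, eQ, eN] at l
  have := poly_lin (2 * q1 + (2 * Q - 4 * m) * a1 + b1) (q2 + 4 * a1 * q1 + a2 * Q + b2 - m * (4 * a1 ^ 2 + 2 * a2))
    (2 * a1 * q2 + 2 * a2 * q1 + b3 - 4 * m * a1 * a2) (a2 * q2 + b4 - m * a2 ^ 2) (fun t => by
      have := hP t
      have hE' : N = m - Q := by linarith
      rw [hE'] at this
      nlinarith)
  exact this
end

section
open scoped ContDiff ENNReal Topology

/-- `f` is integrable with integral `a` -/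
def HI (f : Pt 2 → ℂ) (a : ℂ) : Prop := Integrable f ∧ ∫ x, f x = a

theorem HI.of {f : Pt 2 → ℂ} (h : Integrable f) : HI f (∫ x, f x) := ⟨h, rfl⟩
theorem HI.add {f g : Pt 2 → ℂ} {a b : ℂ} (hf : HI f a) (hg : HI g b) : HI (fun x => f x + g x) (a + b) :=
  ⟨hf.1.add hg.1, by rw [integral_add hf.1 hg.1, hf.2, hg.2]⟩
theorem HI.cm {f : Pt 2 → ℂ} {a : ℂ} (c : ℂ) (hf : HI f a) : HI (fun x => c * f x) (c * a) :=
  ⟨hf.1.const_mul c, by rw [integral_const_mul, hf.2]⟩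
theorem HI.congr {f g : Pt 2 → ℂ} {a : ℂ} (hf : HI f a) (h : f =ᵐ[volume] g) : HI g a :=
  ⟨hf.1.congr h, by rw [← integral_congr_ae h, hf.2]⟩
theorem HI.re {f : Pt 2 → ℂ} {a : ℂ} (hf : HI f a) : ∫ x, (f x).re = a.re := by
  have := integral_re hf.1
  simp only [RCLike.re_to_complex] at this
  rw [this, hf.2]

theorem conj_Tst {θ : Pt 2 → ℂ} (h : Tst θ) : Tst (fun x => (starRingEnd ℂ) (θ x)) :=
  ⟨conjCLE.contDiff.comp h.1, h.2.comp_left (g := starRingEnd ℂ) (by simp)⟩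
theorem dd_conj (k : Fin 2) {θ : Pt 2 → ℂ} (h : Differentiable ℝ θ) (x : Pt 2) :
    dd k (fun x => (starRingEnd ℂ) (θ x)) x = (starRingEnd ℂ) (dd k θ x) := by
  have := (conjCLE : ℂ ≃L[ℝ] ℂ).hasFDerivAt.comp x (h x).hasFDerivAt
  unfold dd
  rw [show (fun x => (starRingEnd ℂ) (θ x)) = (conjCLE : ℂ → ℂ) ∘ θ from rfl, this.fderiv]
  rfl
theorem dd_zero (k : Fin 2) (x : Pt 2) : dd k (fun _ => 0) x = 0 := by simp [dd]
theorem dd_cmul (k : Fin 2) (c : ℂ) {θ : Pt 2 → ℂ} (h : Differentiable ℝ θ) (x : Pt 2) :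
    dd k (fun x => c * θ x) x = c * dd k θ x := by
  unfold dd
  rw [fderiv_const_mul (h x)]; simp

/-- coordinate functions -/
def xc (k : Fin 2) (x : Pt 2) : ℂ := (x k : ℂ)
theorem xc_smooth (k : Fin 2) : ContDiff ℝ ∞ (xc k) := by
  unfold xc
  exact ofRealCLM.contDiff.comp (EuclideanSpace.proj (𝕜 := ℝ) k).contDiff
theorem dd_xc (k l : Fin 2) (x : Pt 2) : dd k (xc l) x = if l = k then 1 else 0 := by
  let L : Pt 2 →L[ℝ] ℂ := ofRealCLM.comp (EuclideanSpace.proj l)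
  have h : xc l = L := rfl
  unfold dd
  rw [h, L.fderiv]
  simp [L, ee, apply_ite]

def et (j : Fin 3) (t : ℂ) : Z3 := fun i => if i = j then (starRingEnd ℂ) t else 0
theorem ip_et (j : Fin 3) (t : ℂ) (b : Z3) : ip (et j t) b = t * b j := by
  simp [ip, et, apply_ite]
def pt (j : Fin 3) (θ : Pt 2 → ℂ) : Fin 3 → Pt 2 → ℂ := fun i x => et j (θ x) i

theorem Tst_pt (j : Fin 3) {θ : Pt 2 → ℂ} (h : Tst θ) (i : Fin 3) : Tst (pt j θ i) := by
  by_cases hij : i = j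
  · have : pt j θ i = fun x => (starRingEnd ℂ) (θ x) := by ext x; simp [pt, et, hij]
    rw [this]; exact conj_Tst h
  · have : pt j θ i = fun x => 0 := by ext x; simp [pt, et, hij]
    rw [this]; exact ⟨contDiff_const, HasCompactSupport.zero⟩
theorem dd_pt (j : Fin 3) {θ : Pt 2 → ℂ} (h : Tst θ) (k : Fin 2) (x : Pt 2) : (fun i => dd k (pt j θ i) x) = et j (dd k θ x) := by
  ext i
  by_cases hij : i = j
  · have : pt j θ i = fun x => (starRingEnd ℂ) (θ x) := by ext x; simp [pt, et, hij]
    rw [this, dd_conj k (smooth_diff h.1)]; simp [et, hij]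
  · have : pt j θ i = fun x => 0 := by ext x; simp [pt, et, hij]
    rw [this, dd_zero]; simp [et, hij]
theorem jet_pt (j : Fin 3) {θ : Pt 2 → ℂ} (h : Tst θ) (x : Pt 2) :
    jet (pt j θ) x = ![et j (θ x), et j (dd 0 θ x), et j (dd 1 θ x), et j (xc 0 x * θ x), et j (xc 1 x * θ x)] := by
  unfold jet
  rw [dd_pt j h, dd_pt j h]
  have e : ∀ k : Fin 2, (fun i => (x k : ℂ) * pt j θ i x) = et j (xc k x * θ x) := fun k => by
    ext i; by_cases hij : i = j <;> simp [pt, et, hij, xc]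
  rw [e, e]; rfl

theorem ip_W1 (Ω γ : ℝ) (v : W5) (b : Z3) : ip (W1 Ω γ v) b = - γ * ip (v 0) (M1 b) - I * Ω * ip (v 4) b := by
  rw [W1, ip_add_left, ip_csmul_left, ip_csmul_left, M1_anti]; simp [sub_eq_add_neg]
theorem ip_W2 (Ω γ : ℝ) (v : W5) (b : Z3) : ip (W2 Ω γ v) b = - γ * ip (v 0) (M2 b) + I * Ω * ip (v 3) b := by
  rw [W2, sub_eq_add_neg, ← neg_smul, ip_add_left, ip_csmul_left, ip_csmul_left, M2_anti]; simp

theorem sH_pt (Ω γ γx γy : ℝ) (j : Fin 3) (a0 a1 a2 a3 a4 : ℂ) (w : W5) :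
    2 * sH Ω γ γx γy ![et j a0, et j a1, et j a2, et j a3, et j a4] w =
      a1 * w 1 j + a2 * w 2 j + γ * (a1 * M1 (w 0) j) + I * Ω * (a1 * w 4 j) + γ * (a2 * M2 (w 0) j) - I * Ω * (a2 * w 3 j)
      - γ * (a0 * M1 (w 1) j) - I * Ω * (a4 * w 1 j) - γ * (a0 * M2 (w 2) j) + I * Ω * (a3 * w 2 j)
      + γx ^ 2 * (a3 * w 3 j) + γy ^ 2 * (a4 * w 4 j) := by
  rw [sH, ip_W1, ip_W2]
  have e1 : W1 Ω γ w j = γ * M1 (w 0) j + I * Ω * w 4 j := by simp [W1]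
  have e2 : W2 Ω γ w j = γ * M2 (w 0) j - I * Ω * w 3 j := by simp [W2]
  have q1 : (![et j a0, et j a1, et j a2, et j a3, et j a4] : W5) 0 = et j a0 := rfl
  have q2 : (![et j a0, et j a1, et j a2, et j a3, et j a4] : W5) 1 = et j a1 := rfl
  have q3 : (![et j a0, et j a1, et j a2, et j a3, et j a4] : W5) 2 = et j a2 := rfl
  have q4 : (![et j a0, et j a1, et j a2, et j a3, et j a4] : W5) 3 = et j a3 := rfl
  have q5 : (![et j a0, et j a1, et j a2, et j a3, et j a4] : W5) 4 = et j a4 := rfl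
  rw [q1, q2, q3, q4, q5]
  simp only [ip_et, e1, e2]
  ring

def m1m : Matrix (Fin 3) (Fin 3) ℂ := !![0, I, 0; I, 0, I; 0, I, 0]
def m2m : Matrix (Fin 3) (Fin 3) ℂ := !![0, 1, 0; -1, 0, 1; 0, -1, 0]
theorem M1_sum (z : Z3) (j : Fin 3) : M1 z j = ∑ i, m1m j i * z i := rfl
theorem M2_sum (z : Z3) (j : Fin 3) : M2 z j = ∑ i, m2m j i * z i := rfl

theorem wd_sum {f g : Fin 3 → Pt 2 → ℂ} {k : Fin 2} (hf : ∀ i, MemLp (f i) 2) (hg : ∀ i, MemLp (g i) 2) (h : ∀ i, WD k (f i) (g i)) (c : Fin 3 → ℂ) :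
    WD k (fun x => ∑ i, c i * f i x) (fun x => ∑ i, c i * g i x) := by
  intro ψ hψ
  have h1 : ∫ x, (∑ i, c i * f i x) * dd k ψ x = ∑ i, c i * ∫ x, f i x * dd k ψ x := by
    simp only [Finset.sum_mul, mul_assoc]
    rw [integral_finsetSum _ fun i _ => (tint (hf i) (hψ.dd k)).const_mul _]
    simp only [integral_const_mul]
  have h2 : ∫ x, (∑ i, c i * g i x) * ψ x = ∑ i, c i * ∫ x, g i x * ψ x := by
    simp only [Finset.sum_mul, mul_assoc]
    rw [integral_finsetSum _ fun i _ => (tint (hg i) hψ).const_mul _]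
    simp only [integral_const_mul]
  rw [h1, h2, ← Finset.sum_neg_distrib]
  exact Finset.sum_congr rfl fun i _ => by rw [h i ψ hψ]; ring
end

section
open scoped ContDiff ENNReal Topology

theorem Tz_smul (c0 c1 t : ℝ) (z : Z3) : Tz c0 c1 (t • z) = t ^ 3 • Tz c0 c1 z := by
  simp only [Tz, Finset.smul_sum]
  refine Finset.sum_congr rfl fun k _ => ?_
  rw [pk_smul, PP_rsmul]
  ext j
  simp; ring

theorem Tzj_smul (c0 c1 : ℝ) (j : Fin 3) (t : ℝ) (z : Z3) : (4 * Tz c0 c1 (t • z) j : ℂ) = t ^ 3 • (4 * Tz c0 c1 z j) := by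
  rw [Tz_smul]; simp; ring

theorem Tzj_smooth (c0 c1 : ℝ) (j : Fin 3) : ContDiff ℝ ∞ (fun z => 4 * Tz c0 c1 z j) := by
  have hP : ∀ k i, ContDiff ℝ ∞ (fun z => PP k z i) := fun k i => by
    have h := (((PP k).restrictScalars ℝ).toContinuousLinearMap).contDiff (n := ∞)
    exact (contDiff_pi.1 h) i
  have hi : ∀ i, ContDiff ℝ ∞ (fun z : Z3 => z i) := fun i => contDiff_apply ℝ ℂ i
  have hc : ∀ i, ContDiff ℝ ∞ (fun z : Z3 => (starRingEnd ℂ) (z i)) := fun i => conjCLE.contDiff.comp (hi i)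
  have hp : ∀ k, ContDiff ℝ ∞ (pk k) := fun k => by
    unfold pk ip
    have hs : ContDiff ℝ ∞ (fun z : Z3 => ∑ i, (starRingEnd ℂ) (z i) * PP k z i) := ContDiff.sum fun i _ => (hc i).mul (hP k i)
    exact reCLM.contDiff.comp hs
  have e : (fun z => 4 * Tz c0 c1 z j) = fun z => 4 * ∑ k, ((cc c0 c1 k * pk k z : ℝ) : ℂ) * PP k z j := by
    ext z; simp [Tz]
  rw [e]
  refine contDiff_const.mul (ContDiff.sum fun k _ => ?_)
  exact (ofRealCLM.contDiff.comp (contDiff_const.mul (hp k))).mul (hP k j)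

theorem Tzj_memLp (c0 c1 : ℝ) (j : Fin 3) {u : Pt 2 → Z3} (hu : MemLp u 6) : MemLp (fun x => 4 * Tz c0 c1 (u x) j) 2 := by
  obtain ⟨C, hC, hb⟩ := hom_bound _ (Tzj_smooth c0 c1 j).continuous 3 (Tzj_smul c0 c1 j)
  have h3 : MemLp (fun x => ‖u x‖ ^ 3) 2 := by
    have := hu.norm_rpow_div 3
    have e : (6 : ℝ≥0∞) / 3 = 2 := by
      symm; rw [ENNReal.eq_div_iff (by norm_num) (by norm_num)]; norm_num
    rw [e] at this
    simpa using this
  refine h3.of_le_mul (c := C) ((Tzj_smooth c0 c1 j).continuous.comp_aestronglyMeasurable hu.1) (Filter.Eventually.of_forall fun x => ?_)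
  have := hb (u x)
  simpa using this

def pp (γx γy μ : ℝ) (j i : Fin 3) (x : Pt 2) : ℂ := if i = j then γx ^ 2 * xc 0 x ^ 2 + γy ^ 2 * xc 1 x ^ 2 + μ else 0
def qf (Ω γ : ℝ) (j i : Fin 3) (k : Fin 2) (x : Pt 2) : ℂ :=
  if k = 0 then -2 * γ * m1m j i - (if i = j then 2 * I * Ω * xc 1 x else 0) else -2 * γ * m2m j i + (if i = j then 2 * I * Ω * xc 0 x else 0)

theorem pp_smooth (γx γy μ : ℝ) (j i : Fin 3) : ContDiff ℝ ∞ (pp γx γy μ j i) := by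
  have := xc_smooth
  unfold pp
  by_cases h : i = j
  · simp only [h, if_true]; fun_prop
  · simp only [h, if_false]; fun_prop
theorem qf_smooth (Ω γ : ℝ) (j i : Fin 3) (k : Fin 2) : ContDiff ℝ ∞ (qf Ω γ j i k) := by
  have := xc_smooth
  unfold qf
  by_cases h : i = j <;> by_cases h2 : k = 0 <;> simp only [h, h2, if_true, if_false] <;> fun_prop

theorem xTst (k : Fin 2) {θ : Pt 2 → ℂ} (h : Tst θ) : Tst (fun x => xc k x * θ x) := by
  have := h.mul (xc_smooth k)
  simpa only [mul_comm] using this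

theorem R_eq (c0 c1 Ω γ γx γy μ : ℝ) (w : W5) (x : Pt 2) (j : Fin 3) :
    ∑ i, pp γx γy μ j i x * w 0 i + ∑ i, ∑ k, qf Ω γ j i k x * w (ix k) i + 4 * Tz c0 c1 (w 0) j =
    (γx ^ 2 * xc 0 x ^ 2 + γy ^ 2 * xc 1 x ^ 2 + μ) * w 0 j - 2 * γ * M1 (w 1) j - 2 * I * Ω * xc 1 x * w 1 j
      - 2 * γ * M2 (w 2) j + 2 * I * Ω * xc 0 x * w 2 j + 4 * Tz c0 c1 (w 0) j := by
  have e1 : ∑ i, pp γx γy μ j i x * w 0 i = (γx ^ 2 * xc 0 x ^ 2 + γy ^ 2 * xc 1 x ^ 2 + μ) * w 0 j := by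
    simp [pp]
  have e2 : ∑ i, ∑ k, qf Ω γ j i k x * w (ix k) i = - 2 * γ * M1 (w 1) j - 2 * I * Ω * xc 1 x * w 1 j
      - 2 * γ * M2 (w 2) j + 2 * I * Ω * xc 0 x * w 2 j := by
    simp only [Fin.sum_univ_two, qf, ix, M1_sum, M2_sum]
    fin_cases j <;> simp [Fin.sum_univ_three] <;> ring
  rw [e1, e2]; ring

theorem dd_xmul (k l : Fin 2) (hkl : l ≠ k) {θ : Pt 2 → ℂ} (h : Tst θ) (x : Pt 2) :
    dd k (fun x => xc l x * θ x) x = xc l x * dd k θ x := by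
  rw [dd_mul k (smooth_diff (xc_smooth l) x) (smooth_diff h.1 x), dd_xc]; simp [hkl]

theorem heq_re (c0 c1 Ω γ γx γy m : ℝ) (hm : ∀ Φ, Cl Φ → mass (vv Φ) = 1 → m ≤ EE c0 c1 Ω γ γx γy Φ)
    {Φ : ℕ → Fin 3 → Pt 2 → ℂ} {Ψ : Pt 2 → W5} (h : LimD Φ Ψ) (h6 : MemLp (fun x => Ψ x 0) 6) (h1 : mass (fun x => Ψ x 0) = 1)
    (hE : (∫ x, qq Ω γ γx γy (Ψ x)) + (∫ x, nn c0 c1 (Ψ x 0)) = m) (j : Fin 3) (θ : Pt 2 → ℂ) (hθ : Tst θ) :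
    (∫ x, Ψ x 0 j * Lap θ x).re =
      (∫ x, (∑ i, pp γx γy (2 * (∫ x, qq Ω γ γx γy (Ψ x)) - 4 * m) j i x * Ψ x 0 i
        + ∑ i, ∑ k, qf Ω γ j i k x * Ψ x (ix k) i + 4 * Tz c0 c1 (Ψ x 0) j) * θ x).re := by
  have E := EL_real c0 c1 Ω γ γx γy m hm h h1 hE (pt j θ) (Tst_Cl (Tst_pt j hθ))
  set μ : ℝ := 2 * (∫ x, qq Ω γ γx γy (Ψ x)) - 4 * m with hμ
  have mm := memLp_W5.1 h.m2
  have mM1 : ∀ k, MemLp (fun x => M1 (Ψ x k) j) 2 := fun k => by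
    simp only [M1_sum]; exact memLp_finsetSum _ fun i _ => (mm k i).const_mul _
  have mM2 : ∀ k, MemLp (fun x => M2 (Ψ x k) j) 2 := fun k => by
    simp only [M2_sum]; exact memLp_finsetSum _ fun i _ => (mm k i).const_mul _
  have mT := Tzj_memLp c0 c1 j h6
  have t1 := HI.of (tint (mm 1 j) (hθ.dd 0))
  have t2 := HI.of (tint (mm 2 j) (hθ.dd 1))
  have t3 := HI.of (tint (mM1 0) (hθ.dd 0))
  have t4 := HI.of (tint (mm 0 j) (xTst 1 (hθ.dd 0)))
  have t5 := HI.of (tint (mM2 0) (hθ.dd 1))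
  have t6 := HI.of (tint (mm 0 j) (xTst 0 (hθ.dd 1)))
  have t7 := HI.of (tint (mM1 1) hθ)
  have t8 := HI.of (tint (mm 1 j) (xTst 1 hθ))
  have t9 := HI.of (tint (mM2 2) hθ)
  have t10 := HI.of (tint (mm 2 j) (xTst 0 hθ))
  have t11 := HI.of (tint (mm 0 j) (xTst 0 (xTst 0 hθ)))
  have t12 := HI.of (tint (mm 0 j) (xTst 1 (xTst 1 hθ)))
  have t13 := HI.of (tint (mm 0 j) hθ)
  have t14 := HI.of (tint mT hθ)
  -- weak derivative identities
  have w1 := h.wd 0 j _ (hθ.dd 0)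
  have w2 := h.wd 1 j _ (hθ.dd 1)
  have w3 : ∫ x, M1 (Ψ x 0) j * dd 0 θ x = - ∫ x, M1 (Ψ x 1) j * θ x := by
    simp only [M1_sum]
    exact wd_sum (fun i => mm 0 i) (fun i => mm 1 i) (fun i => h.wd 0 i) _ θ hθ
  have w5 : ∫ x, M2 (Ψ x 0) j * dd 1 θ x = - ∫ x, M2 (Ψ x 2) j * θ x := by
    simp only [M2_sum]
    exact wd_sum (fun i => mm 0 i) (fun i => mm 2 i) (fun i => h.wd 1 i) _ θ hθ
  have w4 := h.wd 0 j _ (xTst 1 hθ)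
  have w6 := h.wd 1 j _ (xTst 0 hθ)
  simp only [dd_xmul 0 1 (by simp) hθ] at w4
  simp only [dd_xmul 1 0 (by simp) hθ] at w6
  change _ = - ∫ x, Ψ x 1 j * _ at w1
  change _ = - ∫ x, Ψ x 2 j * _ at w2
  change _ = - ∫ x, Ψ x 1 j * _ at w4
  change _ = - ∫ x, Ψ x 2 j * _ at w6
  have wL : ∫ x, Ψ x 0 j * Lap θ x = (∫ x, Ψ x 0 j * dd 0 (dd 0 θ) x) + ∫ x, Ψ x 0 j * dd 1 (dd 1 θ) x := by
    rw [← integral_add (tint (mm 0 j) ((hθ.dd 0).dd 0)) (tint (mm 0 j) ((hθ.dd 1).dd 1))]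
    congr 1; ext x; simp only [Lap, Fin.sum_univ_two]; ring
  -- quadratic part
  have hS := (((((((((((t1.add t2).add (t3.cm γ)).add (t4.cm (I * Ω))).add (t5.cm γ)).add (t6.cm (-(I * Ω)))).add (t7.cm (-γ))).add
    (t8.cm (-(I * Ω)))).add (t9.cm (-γ))).add (t10.cm (I * Ω))).add (t11.cm (γx ^ 2))).add (t12.cm (γy ^ 2)))
  have hS' := (hS.congr (g := fun x => 2 * sH Ω γ γx γy (jet (pt j θ) x) (Ψ x)) (by
    filter_upwards [h.xs] with x hx
    rw [jet_pt j hθ, sH_pt, (hx j).1, (hx j).2]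
    simp only [xc]
    ring)).re
  have h13 := (t13.congr (g := fun x => ip (vv (pt j θ) x) (Ψ x 0)) (Filter.Eventually.of_forall fun x => by
    change _ = ip (et j (θ x)) _
    rw [ip_et]; ring)).re
  have h14 := (t14.congr (g := fun x => 4 * ip (vv (pt j θ) x) (Tz c0 c1 (Ψ x 0))) (Filter.Eventually.of_forall fun x => by
    change _ = 4 * ip (et j (θ x)) _
    rw [ip_et]; ring)).re
  have hS2 : 2 * (∫ x, (sH Ω γ γx γy (jet (pt j θ) x) (Ψ x)).re) = ∫ x, (2 * sH Ω γ γx γy (jet (pt j θ) x) (Ψ x)).re := by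
    rw [← integral_const_mul]; congr 1; ext x; simp
  rw [hS2, hS', h13, h14] at E
  have hR := (((((((t11.cm (γx ^ 2)).add (t12.cm (γy ^ 2))).add (t13.cm μ)).add (t7.cm (-2 * γ))).add (t8.cm (-2 * I * Ω))).add (t9.cm (-2 * γ))).add
    (t10.cm (2 * I * Ω))).add t14
  have hR' := (hR.congr (g := fun x => (∑ i, pp γx γy μ j i x * Ψ x 0 i
        + ∑ i, ∑ k, qf Ω γ j i k x * Ψ x (ix k) i + 4 * Tz c0 c1 (Ψ x 0) j) * θ x) (Filter.Eventually.of_forall fun x => by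
    change _ = _ * θ x
    rw [R_eq]
    ring)).2
  rw [hR', wL, w1, w2]
  rw [w3, w4, w5, w6, ← re_ofReal_mul, ← add_re, ← add_re] at E
  rw [← sub_eq_zero, ← sub_re]
  rw [← neg_eq_zero, ← neg_re, ← E]
  congr 1
  ring

theorem heq_cx (c0 c1 Ω γ γx γy m : ℝ) (hm : ∀ Φ, Cl Φ → mass (vv Φ) = 1 → m ≤ EE c0 c1 Ω γ γx γy Φ)
    {Φ : ℕ → Fin 3 → Pt 2 → ℂ} {Ψ : Pt 2 → W5} (h : LimD Φ Ψ) (h6 : MemLp (fun x => Ψ x 0) 6) (h1 : mass (fun x => Ψ x 0) = 1)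
    (hE : (∫ x, qq Ω γ γx γy (Ψ x)) + (∫ x, nn c0 c1 (Ψ x 0)) = m) (j : Fin 3) (θ : Pt 2 → ℂ) (hθ : Tst θ) :
    (∫ x, Ψ x 0 j * Lap θ x) =
      (∫ x, (∑ i, pp γx γy (2 * (∫ x, qq Ω γ γx γy (Ψ x)) - 4 * m) j i x * Ψ x 0 i
        + ∑ i, ∑ k, qf Ω γ j i k x * Ψ x (ix k) i + 4 * Tz c0 c1 (Ψ x 0) j) * θ x) := by
  refine Complex.ext (heq_re c0 c1 Ω γ γx γy m hm h h6 h1 hE j θ hθ) ?_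
  have hI : Tst (fun x => I * θ x) := by
    have := hθ.mul (p := fun _ => I) contDiff_const
    simpa only [mul_comm] using this
  have := heq_re c0 c1 Ω γ γx γy m hm h h6 h1 hE j _ hI
  have e1 : ∀ x, Lap (fun x => I * θ x) x = I * Lap θ x := fun x => by
    have : ∀ k, dd k (fun x => I * θ x) = fun x => I * dd k θ x := fun k => by
      ext x; exact dd_cmul k I (smooth_diff hθ.1) x
    simp only [Lap, this, Finset.mul_sum]
    exact Finset.sum_congr rfl fun k _ => dd_cmul k I (smooth_diff (hθ.dd k).1) x
  simp only [e1, mul_left_comm _ I, integral_const_mul] at this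
  simpa using this
end

section
open scoped ContDiff ENNReal Topology

theorem wd_classical {f u g : Pt 2 → ℂ} {k : Fin 2} (hf : ContDiff ℝ 1 f) (hu : u =ᵐ[volume] f) (hg : MemLp g 2) (h : WD k u g) :
    dd k f =ᵐ[volume] g := by
  have hcd : Continuous (dd k f) := (hf.continuous_fderiv (by simp)).clm_apply continuous_const
  have hd : Differentiable ℝ f := hf.differentiable (by simp)
  refine ae_eq_of_integral_contDiff_smul_eq hcd.locallyIntegrable (hg.locallyIntegrable (by norm_num)) fun ψ hψ hc => ?_
  have hT : Tst (fun x => (ψ x : ℂ)) := ⟨ofRealCLM.contDiff.comp hψ, hc.comp_left (g := fun t : ℝ => (t : ℂ)) (by simp)⟩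
  have i1 : Integrable (fun x => dd k f x * (ψ x : ℂ)) :=
    (hcd.mul hT.1.continuous).integrable_of_hasCompactSupport hT.2.mul_left
  have e1 := ibp hd hT k i1
  have e2 := h _ hT
  have e3 : ∫ x, u x * dd k (fun x => (ψ x : ℂ)) x = ∫ x, f x * dd k (fun x => (ψ x : ℂ)) x :=
    integral_congr_ae (by filter_upwards [hu] with x hx; rw [hx])
  rw [e3, e1] at e2
  simp only [real_smul, mul_comm (ofReal _)]
  exact neg_injective e2

theorem z3_norm_le (z : Z3) : ‖z‖ ≤ ∑ i, ‖z i‖ :=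
  (pi_norm_le_iff_of_nonneg (by positivity)).2 fun i =>
    Finset.single_le_sum (f := fun i => ‖z i‖) (fun _ _ => norm_nonneg _) (Finset.mem_univ i)

theorem exists_min (c0 c1 Ω γ γx γy : ℝ) (hγx : 0 < γx) (hγy : 0 < γy) (hΩ : |Ω| < min γx γy) (hc0 : -Cb < c0) (hc01 : -Cb < c0 + c1) :
    ∃ (m : ℝ) (f : Fin 3 → Pt 2 → ℂ), (∀ Φ, Cl Φ → mass (vv Φ) = 1 → m ≤ EE c0 c1 Ω γ γx γy Φ) ∧ Cl f ∧ mass (vv f) = 1 ∧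
      EE c0 c1 Ω γ γx γy f = m := by
  obtain ⟨m, Φ, Ψ, hm, h, h6, h1, hE⟩ := exists_limit c0 c1 Ω γ γx γy hγx hγy hΩ hc0 hc01
  have mm := memLp_W5.1 h.m2
  have m20 : ∀ k, MemLp (fun x => Ψ x k) 2 := fun k => memLp_pi_iff.1 h.m2 k
  choose C hC hCb using fun j => fderiv_cubic _ (Tzj_smooth c0 c1 j) (Tzj_smul c0 c1 j)
  have hreg := reg_main (fun j x => Ψ x 0 j) (fun j k x => Ψ x (ix k) j) (fun j => mm 0 j) (fun j k => mm _ j)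
    (fun j k => h.wd k j) (fun j x => 4 * Tz c0 c1 (Ψ x 0) j) (fun j => Tzj_memLp c0 c1 j h6)
    (fun j k x => fderiv ℝ (fun z => 4 * Tz c0 c1 z j) (Ψ x 0) (Ψ x (ix k)))
    (fun j k => cubic_wd h _ (Tzj_smooth c0 c1 j) (Tzj_smul c0 c1 j) k)
    (fun j k => by
      have hc : Continuous (fun p : Z3 × Z3 => fderiv ℝ (fun z => 4 * Tz c0 c1 z j) p.1 p.2) :=
        (((Tzj_smooth c0 c1 j).continuous_fderiv (by simp)).comp continuous_fst).clm_apply continuous_snd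
      exact hc.comp_aestronglyMeasurable ((m20 0).1.prodMk (m20 (ix k)).1))
    (∑ j, C j) (fun j k => Filter.Eventually.of_forall fun x => by
      have a1 : ‖Ψ x 0‖ ≤ ∑ i, ‖Ψ x 0 i‖ := z3_norm_le _
      have a2 : ‖Ψ x (ix k)‖ ≤ ∑ i, ∑ l, ‖Ψ x (ix l) i‖ := (z3_norm_le _).trans
        (Finset.sum_le_sum fun i _ => Finset.single_le_sum (f := fun l => ‖Ψ x (ix l) i‖) (fun _ _ => norm_nonneg _) (Finset.mem_univ k))
      have a3 : C j ≤ ∑ j, C j := Finset.single_le_sum (fun i _ => hC i) (Finset.mem_univ j)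
      have a4 : 0 ≤ ∑ j, C j := (hC j).trans a3
      calc _ ≤ ‖fderiv ℝ (fun z => 4 * Tz c0 c1 z j) (Ψ x 0)‖ * ‖Ψ x (ix k)‖ := ContinuousLinearMap.le_opNorm _ _
        _ ≤ (C j * ‖Ψ x 0‖ ^ 2) * ‖Ψ x (ix k)‖ := by gcongr; exact hCb j _
        _ ≤ ((∑ j, C j) * (∑ i, ‖Ψ x 0 i‖) ^ 2) * (∑ i, ∑ l, ‖Ψ x (ix l) i‖) := by gcongr)
    (pp γx γy (2 * (∫ x, qq Ω γ γx γy (Ψ x)) - 4 * m)) (fun j i => pp_smooth _ _ _ j i) (qf Ω γ) (fun j i k => qf_smooth Ω γ j i k)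
    (fun j ψ hψ => heq_cx c0 c1 Ω γ γx γy m hm h h6 h1 hE j ψ hψ)
  choose f hf hfe using hreg
  have hdd := fun j k => wd_classical (hf j) (hfe j) (mm (ix k) j) (h.wd k j)
  have hjet : jet f =ᵐ[volume] Ψ := by
    filter_upwards [h.xs, ae_all_iff.2 hfe, ae_all_iff.2 fun j => ae_all_iff.2 (hdd j)] with x h1 h2 h3
    ext k j
    fin_cases k
    · exact (h2 j).symm
    · exact h3 j 0
    · exact h3 j 1
    · exact (by rw [← h2 j]; exact (h1 j).1.symm : (x 0 : ℂ) * f j x = Ψ x 3 j)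
    · exact (by rw [← h2 j]; exact (h1 j).2.symm : (x 1 : ℂ) * f j x = Ψ x 4 j)
  have hv : vv f =ᵐ[volume] fun x => Ψ x 0 := by
    filter_upwards [hjet] with x hx
    rw [← hx]; rfl
  refine ⟨m, f, hm, ⟨fun j => (hf j).differentiable (by simp), h.m2.ae_eq hjet.symm⟩, ?_, ?_⟩
  · rw [← h1]
    exact integral_congr_ae (by filter_upwards [hv] with x hx; rw [hx])
  · rw [← hE, EE]
    congr 1
    · exact integral_congr_ae (by filter_upwards [hjet] with x hx; rw [hx])
    · exact integral_congr_ae (by filter_upwards [hv] with x hx; rw [hx])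

theorem main_thm (c0 c1 Ω γ γx γy : ℝ) (hγx : 0 < γx) (hγy : 0 < γy) (hΩ : |Ω| < min γx γy) (hc0 : -Cb < c0) (hc01 : -Cb < c0 + c1)
    (V : Pt 2 → ℝ) (hV : ∀ x : Pt 2, V x = 1 / 2 * (γx ^ 2 * (x 0) ^ 2 + γy ^ 2 * (x 1) ^ 2)) :
    (∃ m : ℝ, ∀ φ1 φ0 φm1, InM 2 V φ1 φ0 φm1 → m ≤ Etot 2 V c0 c1 Ω γ φ1 φ0 φm1) ∧
    ∃ g1 g0 gm1, InM 2 V g1 g0 gm1 ∧ ∀ φ1 φ0 φm1, InM 2 V φ1 φ0 φm1 → Etot 2 V c0 c1 Ω γ g1 g0 gm1 ≤ Etot 2 V c0 c1 Ω γ φ1 φ0 φm1 := by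
  obtain ⟨m, f, hm, hf, hf1, hfE⟩ := exists_min c0 c1 Ω γ γx γy hγx hγy hΩ hc0 hc01
  have lb : ∀ φ1 φ0 φm1, InM 2 V φ1 φ0 φm1 → m ≤ Etot 2 V c0 c1 Ω γ φ1 φ0 φm1 := by
    intro φ1 φ0 φm1 hM
    obtain ⟨h1, h2⟩ := Cl_of_InM γx γy hγx hγy V hV φ1 φ0 φm1 hM
    rw [Etot_eq c0 c1 Ω γ γx γy V hV φ1 φ0 φm1 h1]
    exact hm _ h1 h2
  have e : f = ![f 0, f 1, f 2] := by ext j; fin_cases j <;> rfl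
  have hf' : Cl ![f 0, f 1, f 2] := e ▸ hf
  have hE : Etot 2 V c0 c1 Ω γ (f 0) (f 1) (f 2) = m := by
    rw [Etot_eq c0 c1 Ω γ γx γy V hV _ _ _ hf', ← e]
    exact hfE
  refine ⟨⟨m, lb⟩, f 0, f 1, f 2, InM_of_Cl γx γy V hV _ _ _ hf' (by rw [← e]; exact hf1), fun φ1 φ0 φm1 h => ?_⟩
  rw [hE]; exact lb _ _ _ h
end

/-- Existence of a ground state in 2D: if `|Ω| < min{γx, γy}`, `c₀ > −C_b` and
`c₀ + c₁ > −C_b`, then the energy is bounded below on `M` and attains its infimum. -/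
theorem stmt6 (c0 c1 Ω γ γx γy : ℝ) (hγx : 0 < γx) (hγy : 0 < γy)
    (hΩ : |Ω| < min γx γy) (hc0 : -Cb < c0) (hc01 : -Cb < c0 + c1)
    (V : Pt 2 → ℝ) (hV : ∀ x : Pt 2, V x = 1 / 2 * (γx ^ 2 * (x 0) ^ 2 + γy ^ 2 * (x 1) ^ 2)) :
    (∃ m : ℝ, ∀ φ1 φ0 φm1 : Pt 2 → ℂ, InM 2 V φ1 φ0 φm1 →
      m ≤ Etot 2 V c0 c1 Ω γ φ1 φ0 φm1) ∧
    ∃ g1 g0 gm1 : Pt 2 → ℂ, InM 2 V g1 g0 gm1 ∧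
      ∀ φ1 φ0 φm1 : Pt 2 → ℂ, InM 2 V φ1 φ0 φm1 →
        Etot 2 V c0 c1 Ω γ g1 g0 gm1 ≤ Etot 2 V c0 c1 Ω γ φ1 φ0 φm1 := by
  exact main_thm c0 c1 Ω γ γx γy hγx hγy hΩ hc0 hc01 V hV

end
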